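/- Let p(x) = b_0 + b_1 x + ⋯ + b_m x^m be a polynomial with real coefficients, m ≥ 1 and b_m > 0, set a_k = [p(k)] (the integer part of p(k)), and let (X,T) be a topological dynamical system with positive topological entropy. Then (X,T) is multivariant mean Li-Yorke chaotic along {a_k}: there exists a Cantor subset K of X such that for every integer n ≥ 2 and all pairwise distinct points x_1, x_2, …, x_n in K one has liminf_{N→∞} (1/N) Σ_{k=1}^N max_{1≤i<j≤n} d(T^{a_k} x_i, T^{a_k} x_j) = 0 and limsup_{N→∞} (1/N) Σ_{k=1}^N min_{1≤i<j≤n} d(T^{a_k} x_i, T^{a_k} x_j) > 0. -/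

import Mathlib

open Filter MeasureTheory Topology

/-- A Cantor set: a nonempty compact perfect totally disconnected subset. -/
def IsCantorSet {X : Type*} [TopologicalSpace X] (K : Set X) : Prop :=
  K.Nonempty ∧ IsCompact K ∧ Perfect K ∧ IsTotallyDisconnected K

/-- `max_{1 ≤ i < j ≤ n} d(y i, y j)`. -/
noncomputable def maxPairDist {X : Type*} [PseudoMetricSpace X] {n : ℕ} (y : Fin n → X) : ℝ :=
  sSup {r : ℝ | ∃ i j : Fin n, i < j ∧ r = dist (y i) (y j)}

/-- `min_{1 ≤ i < j ≤ n} d(y i, y j)`. -/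
noncomputable def minPairDist {X : Type*} [PseudoMetricSpace X] {n : ℕ} (y : Fin n → X) : ℝ :=
  sInf {r : ℝ | ∃ i j : Fin n, i < j ∧ r = dist (y i) (y j)}

/-- The `m`-th iterate of a homeomorphism `T`, for an integer `m`
(using the inverse for negative `m`). -/
def homeoIter {X : Type*} [TopologicalSpace X] (T : X ≃ₜ X) : ℤ → X → X
  | Int.ofNat n => (⇑T)^[n]
  | Int.negSucc n => (⇑T.symm)^[n + 1]

set_option linter.unusedSectionVars false

namespace PolyChaos

/-! ### Entropy of finite families of sets -/

/-- The atom of the partition generated by `B i`, `i ∈ S`, on which exactly the sets indexed by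
`S ∩ T` occur. -/
def cell {ι Ω : Type*} (B : ι → Set Ω) (S T : Finset ι) : Set Ω :=
  {x | ∀ i ∈ S, (x ∈ B i ↔ i ∈ T)}

/-- The Shannon entropy of the partition generated by `B i`, `i ∈ S`. -/
noncomputable def setEntropy {ι Ω : Type*} [MeasurableSpace Ω] (ν : Measure Ω) (B : ι → Set Ω)
    (S : Finset ι) : ℝ :=
  ∑ T ∈ S.powerset, Real.negMulLog (ν.real (cell B S T))

/-- The entropy gained by splitting an atom of mass `u + v` into atoms of mass `u` and `v`. -/
noncomputable def splitEntropy (u v : ℝ) : ℝ :=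
  Real.negMulLog u + Real.negMulLog v - Real.negMulLog (u + v)

lemma negMulLog_add_mul_log_le {u s U S : ℝ} (hu : 0 ≤ u) (hus : u ≤ s) (hU : 0 < U)
    (hS : 0 < S) :
    Real.negMulLog u + u * Real.log s ≤ u * (Real.log S - Real.log U) + s * U / S - u := by
  rcases hu.eq_or_lt with rfl | hu
  · simp only [Real.negMulLog_zero, zero_mul, add_zero, sub_zero, zero_add]
    positivity
  · have hs : 0 < s := hu.trans_le hus
    have h := Real.log_le_sub_one_of_pos (x := s * U / (u * S)) (by positivity)
    rw [Real.log_div (by positivity) (by positivity), Real.log_mul hs.ne' hU.ne',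
      Real.log_mul hu.ne' hS.ne'] at h
    have h2 := mul_le_mul_of_nonneg_left h hu.le
    have h3 : u * (s * U / (u * S) - 1) = s * U / S - u := by field_simp
    rw [h3] at h2
    rw [Real.negMulLog]
    linarith

lemma negMulLog_add_mul_log_add_le {u s u' s' : ℝ} (hu : 0 ≤ u) (hus : u ≤ s) (hu' : 0 ≤ u')
    (hus' : u' ≤ s') :
    (Real.negMulLog u + u * Real.log s) + (Real.negMulLog u' + u' * Real.log s') ≤
      Real.negMulLog (u + u') + (u + u') * Real.log (s + s') := by
  rcases (add_nonneg hu hu').eq_or_lt with h | h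
  · have h1 : u = 0 := by linarith
    have h2 : u' = 0 := by linarith
    simp [h1, h2]
  · have hS : 0 < s + s' := by linarith
    have e1 := negMulLog_add_mul_log_le hu hus h hS
    have e2 := negMulLog_add_mul_log_le hu' hus' h hS
    have e3 : s * (u + u') / (s + s') + s' * (u + u') / (s + s') = u + u' := by field_simp
    have e4 : Real.negMulLog (u + u') = -((u + u') * Real.log (u + u')) := by
      rw [Real.negMulLog]; ring
    rw [e4]
    linarith

lemma splitEntropy_add_le {u v u' v' : ℝ} (hu : 0 ≤ u) (hv : 0 ≤ v) (hu' : 0 ≤ u')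
    (hv' : 0 ≤ v') :
    splitEntropy u v + splitEntropy u' v' ≤ splitEntropy (u + u') (v + v') := by
  have e1 := negMulLog_add_mul_log_add_le hu (le_add_of_nonneg_right hv) hu'
    (le_add_of_nonneg_right hv')
  have e2 := negMulLog_add_mul_log_add_le hv (le_add_of_nonneg_left hu) hv'
    (le_add_of_nonneg_left hu')
  have key : ∀ a b : ℝ, splitEntropy a b =
      (Real.negMulLog a + a * Real.log (a + b)) + (Real.negMulLog b + b * Real.log (a + b)) := by
    intro a b
    rw [splitEntropy, Real.negMulLog, Real.negMulLog, Real.negMulLog]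
    ring
  have e3 : u + v + (u' + v') = u + u' + (v + v') := by ring
  rw [e3] at e1 e2
  rw [key, key, key]
  linarith

lemma splitEntropy_nonneg {u v : ℝ} (hu : 0 ≤ u) (hv : 0 ≤ v) : 0 ≤ splitEntropy u v := by
  have key : ∀ {a b : ℝ}, 0 ≤ a → 0 ≤ b → 0 ≤ Real.negMulLog a + a * Real.log (a + b) := by
    intro a b ha hb
    rcases ha.eq_or_lt with rfl | ha
    · simp
    · have h := mul_le_mul_of_nonneg_left
        (Real.log_le_log ha (le_add_of_nonneg_right hb)) ha.le
      rw [Real.negMulLog]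
      linarith
  have h1 := key hu hv
  have h2 := key hv hu
  rw [add_comm v u] at h2
  have h3 : splitEntropy u v =
      (Real.negMulLog u + u * Real.log (u + v)) + (Real.negMulLog v + v * Real.log (u + v)) := by
    rw [splitEntropy, Real.negMulLog, Real.negMulLog, Real.negMulLog]
    ring
  linarith

lemma splitEntropy_mul (c : ℝ) (u v : ℝ) :
    splitEntropy (c * u) (c * v) = c * splitEntropy u v := by
  simp only [splitEntropy, ← mul_add, Real.negMulLog_mul]
  ring

lemma splitEntropy_le {u v : ℝ} (hu : 0 ≤ u) (hv : 0 ≤ v) :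
    splitEntropy u v ≤ (u + v) * Real.log 2 := by
  have h := splitEntropy_add_le hu hv hv hu
  have h1 : splitEntropy v u = splitEntropy u v := by
    simp only [splitEntropy, add_comm]
  have h2 : splitEntropy (u + v) (v + u) = 2 * ((u + v) * Real.log 2) := by
    rw [add_comm v u, splitEntropy, ← two_mul (u + v), Real.negMulLog_mul 2 (u + v)]
    simp only [Real.negMulLog]
    ring
  linarith

section
variable {ι Ω : Type*} [DecidableEq ι] [MeasurableSpace Ω]

/-- The entropy gained by adding the set `B i` to the family `S`. -/
noncomputable def entropyGain (ν : Measure Ω) (B : ι → Set Ω) (S : Finset ι) (i : ι) : ℝ :=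
  ∑ T ∈ S.powerset, splitEntropy (ν.real (cell B S T ∩ B i)) (ν.real (cell B S T \ B i))

lemma cell_insert_of_subset {B : ι → Set Ω} {S T : Finset ι} {i : ι} (hi : i ∉ S) (hT : T ⊆ S) :
    cell B (insert i S) T = cell B S T \ B i := by
  ext x
  have : i ∉ T := fun h => hi (hT h)
  simp only [cell, Finset.mem_insert, forall_eq_or_imp, Set.mem_ofPred_eq, Set.mem_sdiff, this,
    iff_false]
  tauto

lemma cell_insert_insert {B : ι → Set Ω} {S T : Finset ι} {i : ι} (hi : i ∉ S) :
    cell B (insert i S) (insert i T) = cell B S T ∩ B i := by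
  ext x
  simp only [cell, Finset.mem_insert, forall_eq_or_imp, Set.mem_ofPred_eq, Set.mem_inter_iff,
    true_or, iff_true]
  constructor
  · rintro ⟨h1, h2⟩
    refine ⟨fun j hj => ?_, h1⟩
    have : j ≠ i := fun h => hi (h ▸ hj)
    simpa [this] using h2 j hj
  · rintro ⟨h1, h2⟩
    refine ⟨h2, fun j hj => ?_⟩
    have : j ≠ i := fun h => hi (h ▸ hj)
    simpa [this] using h1 j hj

lemma measurableSet_cell {B : ι → Set Ω} (hB : ∀ i, MeasurableSet (B i)) (S T : Finset ι) :
    MeasurableSet (cell B S T) := by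
  classical
  have : cell B S T = ⋂ i ∈ S, if i ∈ T then B i else (B i)ᶜ := by
    ext x
    simp only [cell, Set.mem_ofPred_eq, Set.mem_iInter]
    refine forall₂_congr fun i _ => ?_
    by_cases h : i ∈ T <;> simp [h]
  rw [this]
  refine Finset.measurableSet_biInter _ fun i _ => ?_
  split_ifs
  exacts [hB i, (hB i).compl]

lemma setEntropy_insert (ν : Measure Ω) [IsFiniteMeasure ν] {B : ι → Set Ω}
    (hB : ∀ i, MeasurableSet (B i)) {S : Finset ι} {i : ι} (hi : i ∉ S) :
    setEntropy ν B (insert i S) = setEntropy ν B S + entropyGain ν B S i := by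
  rw [setEntropy, Finset.sum_powerset_insert hi, setEntropy, entropyGain,
    ← Finset.sum_add_distrib, ← Finset.sum_add_distrib]
  refine Finset.sum_congr rfl fun T hT => ?_
  rw [cell_insert_of_subset hi (Finset.mem_powerset.1 hT), cell_insert_insert hi, splitEntropy,
    measureReal_inter_add_sdiff (hB i)]
  ring

lemma entropyGain_nonneg (ν : Measure Ω) (B : ι → Set Ω) (S : Finset ι) (i : ι) :
    0 ≤ entropyGain ν B S i :=
  Finset.sum_nonneg fun _ _ => splitEntropy_nonneg measureReal_nonneg measureReal_nonneg

lemma entropyGain_insert_le (ν : Measure Ω) [IsFiniteMeasure ν] {B : ι → Set Ω}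
    (hB : ∀ i, MeasurableSet (B i)) {S : Finset ι} (i : ι) {j : ι} (hj : j ∉ S) :
    entropyGain ν B (insert j S) i ≤ entropyGain ν B S i := by
  rw [entropyGain, Finset.sum_powerset_insert hj, entropyGain, ← Finset.sum_add_distrib]
  refine Finset.sum_le_sum fun T hT => ?_
  rw [cell_insert_of_subset hj (Finset.mem_powerset.1 hT), cell_insert_insert hj]
  refine (splitEntropy_add_le measureReal_nonneg measureReal_nonneg measureReal_nonneg
    measureReal_nonneg).trans_eq ?_
  have h1 : ν.real ((cell B S T \ B j) ∩ B i) + ν.real (cell B S T ∩ B j ∩ B i) =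
      ν.real (cell B S T ∩ B i) := by
    rw [← measureReal_inter_add_sdiff (s := cell B S T ∩ B i) (hB j), add_comm]
    congr 2 <;> ext x <;> simp only [Set.mem_inter_iff, Set.mem_sdiff] <;> tauto
  have h2 : ν.real ((cell B S T \ B j) \ B i) + ν.real ((cell B S T ∩ B j) \ B i) =
      ν.real (cell B S T \ B i) := by
    rw [← measureReal_inter_add_sdiff (s := cell B S T \ B i) (hB j), add_comm]
    congr 2 <;> ext x <;> simp only [Set.mem_inter_iff, Set.mem_sdiff] <;> tauto
  rw [h1, h2]

lemma entropyGain_add_le (ν ν' : Measure Ω) [IsFiniteMeasure ν] [IsFiniteMeasure ν']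
    (B : ι → Set Ω) (S : Finset ι) (i : ι) :
    entropyGain ν B S i + entropyGain ν' B S i ≤ entropyGain (ν + ν') B S i := by
  rw [entropyGain, entropyGain, entropyGain, ← Finset.sum_add_distrib]
  refine Finset.sum_le_sum fun T _ => ?_
  rw [measureReal_add_apply, measureReal_add_apply]
  exact splitEntropy_add_le measureReal_nonneg measureReal_nonneg measureReal_nonneg
    measureReal_nonneg

lemma cell_self_empty (B : ι → Set Ω) (T : Finset ι) : cell B ∅ T = Set.univ := by
  ext; simp [cell]

lemma sum_measureReal_cell (ν : Measure Ω) [IsFiniteMeasure ν] {B : ι → Set Ω}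
    (hB : ∀ i, MeasurableSet (B i)) (S : Finset ι) :
    ∑ T ∈ S.powerset, ν.real (cell B S T) = ν.real Set.univ := by
  induction S using Finset.induction_on with
  | empty => simp [cell_self_empty]
  | insert i S hi ih =>
    rw [Finset.sum_powerset_insert hi, ← ih, ← Finset.sum_add_distrib]
    refine Finset.sum_congr rfl fun T hT => ?_
    rw [cell_insert_of_subset hi (Finset.mem_powerset.1 hT), cell_insert_insert hi, add_comm,
      measureReal_inter_add_sdiff (hB i)]

lemma entropyGain_le (ν : Measure Ω) [IsFiniteMeasure ν] {B : ι → Set Ω}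
    (hB : ∀ i, MeasurableSet (B i)) (S : Finset ι) (i : ι) :
    entropyGain ν B S i ≤ ν.real Set.univ * Real.log 2 := by
  rw [← sum_measureReal_cell ν hB S, Finset.sum_mul]
  refine Finset.sum_le_sum fun T _ => ?_
  rw [← measureReal_inter_add_sdiff (s := cell B S T) (hB i)]
  exact splitEntropy_le measureReal_nonneg measureReal_nonneg

end

/-! ### Monotone submodular set functions -/

/-- Monotone submodular functions on finite sets, in terms of marginals. -/
structure IsPolymatroid {ι : Type*} [DecidableEq ι] (H : Finset ι → ℝ) : Prop where
  le_insert : ∀ S i, H S ≤ H (insert i S)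
  insert_insert_le : ∀ S i j, H (insert i (insert j S)) + H S ≤ H (insert i S) + H (insert j S)

/-- The conditional value `H(A | S)`. -/
def condVal {ι : Type*} [DecidableEq ι] (H : Finset ι → ℝ) (A S : Finset ι) : ℝ :=
  H (A ∪ S) - H S

lemma isPolymatroid_setEntropy {ι Ω : Type*} [DecidableEq ι] [MeasurableSpace Ω] (ν : Measure Ω)
    [IsFiniteMeasure ν] {B : ι → Set Ω} (hB : ∀ i, MeasurableSet (B i)) :
    IsPolymatroid (setEntropy ν B) := by
  have hle : ∀ S i, setEntropy ν B S ≤ setEntropy ν B (insert i S) := by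
    intro S i
    by_cases hi : i ∈ S
    · rw [Finset.insert_eq_of_mem hi]
    · rw [setEntropy_insert ν hB hi]
      linarith [entropyGain_nonneg ν B S i]
  refine ⟨hle, fun S i j => ?_⟩
  by_cases hj : j ∈ S
  · rw [Finset.insert_eq_of_mem hj]
  by_cases hi : i ∈ S
  · rw [Finset.insert_eq_of_mem hi, Finset.insert_eq_of_mem (Finset.mem_insert_of_mem hi),
      add_comm]
  by_cases hij : i = j
  · subst hij
    rw [Finset.insert_eq_of_mem (Finset.mem_insert_self _ _)]
    linarith [hle S i]
  · have hi' : i ∉ insert j S := by simp [hij, hi]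
    rw [setEntropy_insert ν hB hi', setEntropy_insert ν hB hi]
    linarith [entropyGain_insert_le ν hB i hj]

section
variable {ι : Type*} [DecidableEq ι] {H : Finset ι → ℝ}

lemma IsPolymatroid.mono (hH : IsPolymatroid H) {S S' : Finset ι} (h : S ⊆ S') : H S ≤ H S' := by
  have : ∀ A : Finset ι, H S ≤ H (A ∪ S) := by
    intro A
    induction A using Finset.induction_on with
    | empty => simp
    | insert i A _ ih =>
      rw [Finset.insert_union]
      exact ih.trans (hH.le_insert _ _)
  simpa [Finset.union_eq_left.2 h] using this S'

lemma IsPolymatroid.gain_antitone (hH : IsPolymatroid H) (i : ι) {S S' : Finset ι} (h : S ⊆ S') :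
    H (insert i S') - H S' ≤ H (insert i S) - H S := by
  have : ∀ A : Finset ι, H (insert i (A ∪ S)) - H (A ∪ S) ≤ H (insert i S) - H S := by
    intro A
    induction A using Finset.induction_on with
    | empty => simp
    | insert j A _ ih =>
      rw [Finset.insert_union]
      linarith [hH.insert_insert_le (A ∪ S) i j]
  simpa [Finset.union_eq_left.2 h] using this S'

lemma condVal_nonneg (hH : IsPolymatroid H) (A S : Finset ι) : 0 ≤ condVal H A S :=
  sub_nonneg.2 (hH.mono Finset.subset_union_right)

lemma condVal_antitone (hH : IsPolymatroid H) (A : Finset ι) {S S' : Finset ι} (h : S ⊆ S') :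
    condVal H A S' ≤ condVal H A S := by
  induction A using Finset.induction_on with
  | empty => simp [condVal]
  | insert i A _ ih =>
    have h2 := hH.gain_antitone i (Finset.union_subset_union_right (s := A) h)
    simp only [condVal, Finset.insert_union] at ih ⊢
    linarith

lemma condVal_union (A A' S : Finset ι) :
    condVal H (A ∪ A') S = condVal H A (A' ∪ S) + condVal H A' S := by
  simp only [condVal, Finset.union_assoc]
  ring

end

section
variable {ι Ω : Type*} [DecidableEq ι] [MeasurableSpace Ω]

lemma condVal_setEntropy_add_le (ν ν' : Measure Ω) [IsFiniteMeasure ν] [IsFiniteMeasure ν']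
    {B : ι → Set Ω} (hB : ∀ i, MeasurableSet (B i)) (A S : Finset ι) :
    condVal (setEntropy ν B) A S + condVal (setEntropy ν' B) A S ≤
      condVal (setEntropy (ν + ν') B) A S := by
  induction A using Finset.induction_on with
  | empty => simp [condVal]
  | insert i A _ ih =>
    simp only [condVal, Finset.insert_union] at ih ⊢
    by_cases hi : i ∈ A ∪ S
    · rwa [Finset.insert_eq_of_mem hi]
    · rw [setEntropy_insert ν hB hi, setEntropy_insert ν' hB hi, setEntropy_insert _ hB hi]
      linarith [entropyGain_add_le ν ν' B (A ∪ S) i]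

lemma condVal_setEntropy_smul (c : NNReal) (ν : Measure Ω) [IsFiniteMeasure ν]
    {B : ι → Set Ω} (hB : ∀ i, MeasurableSet (B i)) (A S : Finset ι) :
    condVal (setEntropy (c • ν) B) A S = c * condVal (setEntropy ν B) A S := by
  induction A using Finset.induction_on with
  | empty => simp [condVal]
  | insert i A _ ih =>
    simp only [condVal, Finset.insert_union] at ih ⊢
    by_cases hi : i ∈ A ∪ S
    · rwa [Finset.insert_eq_of_mem hi]
    · rw [setEntropy_insert ν hB hi, setEntropy_insert _ hB hi]
      have : entropyGain (c • ν) B (A ∪ S) i = c * entropyGain ν B (A ∪ S) i := by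
        simp only [entropyGain, Finset.mul_sum]
        refine Finset.sum_congr rfl fun T _ => ?_
        rw [← splitEntropy_mul, measureReal_nnreal_smul_apply, measureReal_nnreal_smul_apply]
      linarith

lemma condVal_setEntropy_sum_le {κ : Type*} (K : Finset κ) (ν : κ → Measure Ω)
    [∀ k, IsFiniteMeasure (ν k)] {B : ι → Set Ω} (hB : ∀ i, MeasurableSet (B i))
    (A S : Finset ι) :
    ∑ k ∈ K, condVal (setEntropy (ν k) B) A S ≤ condVal (setEntropy (∑ k ∈ K, ν k) B) A S := by
  classical
  induction K using Finset.induction_on with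
  | empty =>
    simp only [Finset.sum_empty]
    exact condVal_nonneg (isPolymatroid_setEntropy 0 hB) _ _
  | insert k K hk ih =>
    rw [Finset.sum_insert hk, Finset.sum_insert hk]
    exact (add_le_add_right ih _).trans (condVal_setEntropy_add_le _ _ hB A S)

lemma condVal_setEntropy_le_card (ν : Measure Ω) [IsProbabilityMeasure ν]
    {B : ι → Set Ω} (hB : ∀ i, MeasurableSet (B i)) (A S : Finset ι) :
    condVal (setEntropy ν B) A S ≤ A.card * Real.log 2 := by
  induction A using Finset.induction_on with
  | empty => simp [condVal]
  | insert i A hiA ih =>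
    simp only [condVal, Finset.insert_union] at ih ⊢
    rw [Finset.card_insert_of_notMem hiA]
    push_cast
    have hlog := Real.log_nonneg (one_le_two (α := ℝ))
    by_cases hi : i ∈ A ∪ S
    · rw [Finset.insert_eq_of_mem hi]
      linarith
    · rw [setEntropy_insert ν hB hi]
      have := entropyGain_le ν hB (A ∪ S) i
      simp only [probReal_univ, one_mul] at this
      linarith
end

section
variable {ι : Type*} [DecidableEq ι] {H : Finset ι → ℝ}

/-- The conditional value `H(A | 𝓢)` for a possibly infinite set `𝓢`. -/
noncomputable def condInf (H : Finset ι → ℝ) (A : Finset ι) (𝓢 : Set ι) : ℝ :=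
  ⨅ S : {S : Finset ι // (S : Set ι) ⊆ 𝓢}, condVal H A S

instance (𝓢 : Set ι) : Nonempty {S : Finset ι // (S : Set ι) ⊆ 𝓢} := ⟨⟨∅, by simp⟩⟩

lemma condInf_le (hH : IsPolymatroid H) (A : Finset ι) {𝓢 : Set ι} {S : Finset ι}
    (hS : (S : Set ι) ⊆ 𝓢) : condInf H A 𝓢 ≤ condVal H A S :=
  ciInf_le (f := fun S : {S : Finset ι // (S : Set ι) ⊆ 𝓢} => condVal H A S)
    ⟨0, by rintro _ ⟨S, rfl⟩; exact condVal_nonneg hH _ _⟩ ⟨S, hS⟩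

lemma le_condInf {A : Finset ι} {𝓢 : Set ι} {c : ℝ}
    (h : ∀ S : Finset ι, (S : Set ι) ⊆ 𝓢 → c ≤ condVal H A S) : c ≤ condInf H A 𝓢 :=
  le_ciInf fun S => h S.1 S.2

lemma condInf_antitone (hH : IsPolymatroid H) (A : Finset ι) {𝓢 𝓣 : Set ι} (h : 𝓢 ⊆ 𝓣) :
    condInf H A 𝓣 ≤ condInf H A 𝓢 :=
  le_condInf fun _ hS => condInf_le hH A (hS.trans h)

lemma exists_condVal_lt {A : Finset ι} {𝓢 : Set ι} {c : ℝ} (h : condInf H A 𝓢 < c) :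
    ∃ S : Finset ι, (S : Set ι) ⊆ 𝓢 ∧ condVal H A S < c := by
  obtain ⟨⟨S, hS⟩, h⟩ := exists_lt_of_ciInf_lt h
  exact ⟨S, hS, h⟩

lemma condInf_union (hH : IsPolymatroid H) (A A' : Finset ι) (𝓢 : Set ι) :
    condInf H (A ∪ A') 𝓢 = condInf H A (↑A' ∪ 𝓢) + condInf H A' 𝓢 := by
  apply le_antisymm
  · refine le_of_forall_pos_le_add fun ε hε => ?_
    obtain ⟨S₁, hS₁, h₁⟩ := exists_condVal_lt
      (show condInf H A (↑A' ∪ 𝓢) < condInf H A (↑A' ∪ 𝓢) + ε / 2 by linarith)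
    obtain ⟨S₂, hS₂, h₂⟩ := exists_condVal_lt
      (show condInf H A' 𝓢 < condInf H A' 𝓢 + ε / 2 by linarith)
    have hS : ((S₁ \ A' ∪ S₂ : Finset ι) : Set ι) ⊆ 𝓢 := by
      intro x hx
      simp only [Finset.coe_union, Finset.coe_sdiff, Set.mem_union, Set.mem_sdiff,
        Finset.mem_coe] at hx
      rcases hx with ⟨h1, h2⟩ | h
      · exact (hS₁ h1).resolve_left h2
      · exact hS₂ h
    have e1 := condInf_le hH (A ∪ A') hS
    rw [condVal_union] at e1
    have e2 : condVal H A (A' ∪ (S₁ \ A' ∪ S₂)) ≤ condVal H A S₁ := by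
      refine condVal_antitone hH A fun x hx => ?_
      simp only [Finset.mem_union, Finset.mem_sdiff]
      tauto
    have e3 : condVal H A' (S₁ \ A' ∪ S₂) ≤ condVal H A' S₂ :=
      condVal_antitone hH A' Finset.subset_union_right
    linarith
  · refine le_condInf fun S hS => ?_
    rw [condVal_union]
    refine add_le_add (condInf_le hH A ?_) (condInf_le hH A' hS)
    rw [Finset.coe_union]
    exact Set.union_subset_union_right _ hS

lemma condInf_map {e : ι ≃ ι} (he : ∀ S, H (S.map e.toEmbedding) = H S) (A : Finset ι)
    (𝓢 : Set ι) : condInf H (A.map e.toEmbedding) (e '' 𝓢) = condInf H A 𝓢 := by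
  have key : ∀ S, condVal H (A.map e.toEmbedding) (S.map e.toEmbedding) = condVal H A S := by
    intro S
    rw [condVal, ← Finset.map_union, he, he, condVal]
  let E : {S : Finset ι // (S : Set ι) ⊆ 𝓢} ≃ {S : Finset ι // (S : Set ι) ⊆ e '' 𝓢} :=
    { toFun := fun S => ⟨S.1.map e.toEmbedding, by
        rw [Finset.coe_map]; exact Set.image_mono S.2⟩
      invFun := fun S => ⟨S.1.map e.symm.toEmbedding, by
        rw [Finset.coe_map]
        rintro _ ⟨x, hx, rfl⟩
        obtain ⟨y, hy, rfl⟩ := S.2 hx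
        simpa using hy⟩
      left_inv := fun S => by
        ext x; simp
      right_inv := fun S => by
        ext x; simp }
  rw [condInf, condInf, ← E.iInf_comp]
  exact iInf_congr fun S => key S.1

/-- The information that `𝓥` carries about `S` relative to `𝓢` is monotone in `S`. -/
lemma condInf_sub_mono (hH : IsPolymatroid H) {S S' : Finset ι} (h : S ⊆ S') {𝓢 𝓣 : Set ι}
    (h𝓢 : 𝓢 ⊆ 𝓣) :
    condInf H S 𝓢 - condInf H S 𝓣 ≤ condInf H S' 𝓢 - condInf H S' 𝓣 := by
  have e : S' = (S' \ S) ∪ S := (Finset.sdiff_union_of_subset h).symm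
  rw [e, condInf_union hH, condInf_union hH]
  linarith [condInf_antitone hH (S' \ S) (Set.union_subset_union_right (↑S) h𝓢)]

end

/-! ### Tails of stationary submodular functions -/

/-- Translation of the time coordinate. -/
def timeShift (s : ℤ) : ℤ × ℕ ≃ ℤ × ℕ := (Equiv.addRight s).prodCongr (Equiv.refl ℕ)

@[simp] lemma timeShift_apply (s : ℤ) (p : ℤ × ℕ) : timeShift s p = (p.1 + s, p.2) := rfl

/-- Times in `[a, b)`, indices below `k`. -/
noncomputable def block (a b : ℤ) (k : ℕ) : Finset (ℤ × ℕ) := Finset.Ico a b ×ˢ Finset.range k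

/-- Times at least `a`, indices in `E`. -/
def ray (a : ℤ) (E : Set ℕ) : Set (ℤ × ℕ) := {p | a ≤ p.1 ∧ p.2 ∈ E}

lemma mem_block {a b : ℤ} {k : ℕ} {p : ℤ × ℕ} :
    p ∈ block a b k ↔ (a ≤ p.1 ∧ p.1 < b) ∧ p.2 < k := by
  simp [block]

lemma mem_ray {a : ℤ} {E : Set ℕ} {p : ℤ × ℕ} : p ∈ ray a E ↔ a ≤ p.1 ∧ p.2 ∈ E := Iff.rfl

lemma block_map (a b : ℤ) (k : ℕ) (s : ℤ) :
    (block a b k).map (timeShift s).toEmbedding = block (a + s) (b + s) k := by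
  ext ⟨t, j⟩
  simp only [Finset.mem_map_equiv, mem_block]
  have : (timeShift s).symm (t, j) = (t - s, j) := by
    rw [Equiv.symm_apply_eq]; simp
  rw [this]
  constructor <;> rintro ⟨⟨h1, h2⟩, h3⟩ <;> refine ⟨⟨?_, ?_⟩, h3⟩ <;> dsimp only at * <;> omega

lemma ray_image (a : ℤ) (E : Set ℕ) (s : ℤ) : timeShift s '' ray a E = ray (a + s) E := by
  ext ⟨t, j⟩
  rw [(timeShift s).image_eq_preimage_symm, Set.mem_preimage]
  have : (timeShift s).symm (t, j) = (t - s, j) := by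
    rw [Equiv.symm_apply_eq]; simp
  rw [this, mem_ray, mem_ray]
  constructor <;> rintro ⟨h1, h2⟩ <;> refine ⟨?_, h2⟩ <;> dsimp only at * <;> omega

/-- Shift-invariant monotone submodular functions. -/
structure IsStationary (H : Finset (ℤ × ℕ) → ℝ) : Prop where
  poly : IsPolymatroid H
  shift : ∀ s S, H (S.map (timeShift s).toEmbedding) = H S

section
variable {H : Finset (ℤ × ℕ) → ℝ}

lemma block_succ (M : ℕ) (k : ℕ) :
    block 0 ((M : ℤ) + 1) k = block 0 1 k ∪ block 1 ((M : ℤ) + 1) k := by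
  ext p
  simp only [Finset.mem_union, mem_block]
  omega

lemma condInf_block_eq_sum (hH : IsStationary H) (k : ℕ) (E : Set ℕ) (c M : ℕ) :
    condInf H (block 0 M k) (ray M (Set.Iio k) ∪ ray (M + c) E) =
      ∑ m ∈ Finset.range M, condInf H (block 0 1 k) (ray 1 (Set.Iio k) ∪ ray (m + 1 + c) E) := by
  induction M with
  | zero =>
    have : block 0 ((0 : ℕ) : ℤ) k = ∅ := by simp [block]
    rw [this]
    simp only [Finset.range_zero, Finset.sum_empty]
    refine le_antisymm ?_ (le_condInf fun S _ => by simp [condVal])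
    exact (condInf_le hH.poly ∅ (S := ∅) (by simp)).trans (by simp [condVal])
  | succ M ih =>
    rw [Finset.sum_range_succ, ← ih, ← condInf_map (hH.shift 1) (block 0 (M : ℤ) k)
      (ray M (Set.Iio k) ∪ ray (M + c) E), Set.image_union, ray_image,
      ray_image, block_map]
    push_cast
    rw [block_succ, condInf_union hH.poly, add_comm]
    have e1 : (↑(block 1 ((M : ℤ) + 1) k) : Set (ℤ × ℕ)) ∪
        (ray ((M : ℤ) + 1) (Set.Iio k) ∪ ray ((M : ℤ) + 1 + c) E) =
        ray 1 (Set.Iio k) ∪ ray ((M : ℤ) + 1 + c) E := by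
      ext p
      simp only [Set.mem_union, Finset.mem_coe, mem_block, mem_ray, Set.mem_Iio]
      constructor
      · rintro (h | h | h)
        · left; omega
        · left; omega
        · right; exact h
      · rintro (h | h)
        · by_cases hp : p.1 < (M : ℤ) + 1
          · left; omega
          · right; left; omega
        · right; right; exact h
    rw [e1, show (M : ℤ) + c + 1 = M + 1 + c by ring]

lemma ray_empty (a : ℤ) : ray a ∅ = ∅ := by ext; simp [ray]

lemma condInf_block_eq_mul (hH : IsStationary H) (k M : ℕ) :
    condInf H (block 0 M k) (ray M (Set.Iio k)) =
      M * condInf H (block 0 1 k) (ray 1 (Set.Iio k)) := by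
  simpa [ray_empty] using condInf_block_eq_sum hH k ∅ 0 M

lemma sub_block_eq_sum (hH : IsStationary H) (k M : ℕ) :
    H (block 0 M k) - H ∅ =
      ∑ i ∈ Finset.range M, condVal H (block 0 1 k) (block 1 (i + 1) k) := by
  induction M with
  | zero => simp [block]
  | succ M ih =>
    rw [Finset.sum_range_succ, ← ih, ← hH.shift 1 (block 0 M k), block_map, condVal]
    push_cast
    rw [block_succ]
    ring

lemma tendsto_condVal_block (hH : IsStationary H) (k : ℕ) :
    Tendsto (fun i : ℕ => condVal H (block 0 1 k) (block 1 (i + 1) k)) atTop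
      (𝓝 (condInf H (block 0 1 k) (ray 1 (Set.Iio k)))) := by
  have hsub : ∀ i : ℕ, (↑(block 1 ((i : ℤ) + 1) k) : Set (ℤ × ℕ)) ⊆ ray 1 (Set.Iio k) := by
    intro i p hp
    rw [Finset.mem_coe, mem_block] at hp
    exact ⟨hp.1.1, hp.2⟩
  rw [Metric.tendsto_atTop]
  intro ε hε
  obtain ⟨S, hS, hSε⟩ := exists_condVal_lt
    (show condInf H (block 0 1 k) (ray 1 (Set.Iio k)) <
      condInf H (block 0 1 k) (ray 1 (Set.Iio k)) + ε by linarith)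
  obtain ⟨N, hN⟩ : ∃ N : ℕ, ∀ p ∈ S, p.1 < N := by
    obtain ⟨N, hN⟩ := (S.image Prod.fst).exists_le
    refine ⟨(N + 1).toNat, fun p hp => ?_⟩
    have := hN p.1 (Finset.mem_image_of_mem _ hp)
    omega
  refine ⟨N, fun i hi => ?_⟩
  have h1 := condInf_le hH.poly (block 0 1 k) (hsub i)
  have h2 : condVal H (block 0 1 k) (block 1 ((i : ℤ) + 1) k) ≤ condVal H (block 0 1 k) S := by
    refine condVal_antitone hH.poly _ fun p hp => ?_
    have h3 := hS (Finset.mem_coe.2 hp)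
    have h4 := hN p hp
    rw [mem_block]
    simp only [mem_ray, Set.mem_Iio] at h3
    omega
  rw [Real.dist_eq, abs_lt]
  constructor <;> linarith

/-- The remote future of one more process gives no information about the present. -/
lemma tendsto_condInf_ray (hH : IsStationary H) (k : ℕ) :
    Tendsto (fun m : ℕ => condInf H (block 0 1 k) (ray 1 (Set.Iio k) ∪ ray (m + 1) {k})) atTop
      (𝓝 (condInf H (block 0 1 k) (ray 1 (Set.Iio k)))) := by
  set b : ℕ → ℝ := fun m => condInf H (block 0 1 k) (ray 1 (Set.Iio k) ∪ ray (m + 1) {k})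
    with hb
  set hQ := condInf H (block 0 1 k) (ray 1 (Set.Iio k)) with hhQ
  set hQ' := condInf H (block 0 1 (k + 1)) (ray 1 (Set.Iio (k + 1))) with hhQ'
  have hmono : Monotone b := by
    intro m n hmn
    refine condInf_antitone hH.poly _ (Set.union_subset_union_right _ ?_)
    rintro p ⟨h1, h2⟩
    refine ⟨?_, h2⟩
    omega
  have hle : ∀ m, b m ≤ hQ := fun m => condInf_antitone hH.poly _ Set.subset_union_left
  have hlim : Tendsto b atTop (𝓝 (⨆ m, b m)) :=
    tendsto_atTop_ciSup hmono ⟨hQ, by rintro _ ⟨m, rfl⟩; exact hle m⟩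
  have hces := hlim.cesaro
  have hg := (tendsto_condVal_block hH (k + 1)).cesaro
  have hineq : ∀ M : ℕ, M * hQ' - ∑ i ∈ Finset.range M,
      condVal H (block 0 1 (k + 1)) (block 1 (i + 1) (k + 1)) + M * hQ ≤
      ∑ m ∈ Finset.range M, b m := by
    intro M
    have e1 := condInf_block_eq_mul hH (k + 1) M
    have e2 : block 0 M (k + 1) = (Finset.Ico 0 (M : ℤ) ×ˢ {k}) ∪ block 0 M k := by
      ext p
      simp only [Finset.mem_union, mem_block, Finset.mem_product, Finset.mem_Ico,
        Finset.mem_singleton]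
      omega
    have e3 : ray M (Set.Iio (k + 1)) = ray M (Set.Iio k) ∪ ray ((M : ℤ) + (0 : ℕ)) {k} := by
      ext p
      simp only [Set.mem_union, mem_ray, Set.mem_Iio, Set.mem_singleton_iff]
      omega
    have e4 := condInf_block_eq_sum hH k {k} 0 M
    rw [← e3] at e4
    rw [e2, condInf_union hH.poly, e4] at e1
    have e5 : condInf H (Finset.Ico 0 (M : ℤ) ×ˢ {k})
        (↑(block 0 M k) ∪ ray M (Set.Iio (k + 1))) ≤ H (block 0 M (k + 1)) - H (block 0 M k) := by
      refine (condInf_le hH.poly _ (S := block 0 M k) Set.subset_union_left).trans_eq ?_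
      rw [condVal, e2]
    have e6 := sub_block_eq_sum hH (k + 1) M
    have e7 : M * hQ ≤ H (block 0 M k) - H ∅ := by
      rw [sub_block_eq_sum hH k M, ← nsmul_eq_mul, ← Finset.card_range M, ← Finset.sum_const]
      simp only [Finset.card_range]
      refine Finset.sum_le_sum fun i _ => condInf_le hH.poly _ fun p hp => ?_
      rw [Finset.mem_coe, mem_block] at hp
      exact ⟨hp.1.1, hp.2⟩
    simp only [Nat.cast_zero, add_zero] at e1
    rw [← e6]
    linarith
  have hge : hQ ≤ ⨆ m, b m := by
    have hL : Tendsto (fun M : ℕ => hQ' - (M : ℝ)⁻¹ * ∑ i ∈ Finset.range M,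
        condVal H (block 0 1 (k + 1)) (block 1 (i + 1) (k + 1)) + hQ) atTop
        (𝓝 (hQ' - hQ' + hQ)) := (hg.const_sub hQ').add_const hQ
    rw [sub_self, zero_add] at hL
    refine le_of_tendsto_of_tendsto hL hces ?_
    filter_upwards [eventually_gt_atTop 0] with M hM
    have hM' : (0 : ℝ) < M := by exact_mod_cast hM
    have := mul_le_mul_of_nonneg_left (hineq M) (inv_nonneg.2 hM'.le)
    refine le_trans (le_of_eq ?_) this
    field_simp
  rwa [le_antisymm (ciSup_le hle) hge] at hlim

lemma exists_ray_condInf_le (hH : IsStationary H) {k r : ℕ} {A : Finset (ℤ × ℕ)}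
    (hA : A ⊆ block 0 r k) {𝓗 : Set (ℤ × ℕ)} (h1 : ray r (Set.Iio k) ⊆ 𝓗)
    (h2 : 𝓗 ⊆ ray 0 (Set.Iio k)) {ε : ℝ} (hε : 0 < ε) :
    ∃ m : ℕ, 1 ≤ m ∧ condInf H A 𝓗 ≤ condInf H A (𝓗 ∪ ray m {k}) + ε := by
  classical
  set hQ := condInf H (block 0 1 k) (ray 1 (Set.Iio k)) with hhQ
  have hsum : Tendsto (fun c : ℕ => ∑ i ∈ Finset.range r, (hQ -
      condInf H (block 0 1 k) (ray 1 (Set.Iio k) ∪ ray ((i + c : ℕ) + 1) {k}))) atTop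
      (𝓝 (∑ _i ∈ Finset.range r, (hQ - hQ))) := by
    refine tendsto_finsetSum _ fun i _ => tendsto_const_nhds.sub ?_
    refine (tendsto_condInf_ray hH k).comp (tendsto_atTop_mono (fun c => ?_) tendsto_id)
    exact Nat.le_add_left c i
  simp only [sub_self, Finset.sum_const_zero] at hsum
  obtain ⟨c, hc⟩ := (hsum.eventually (gt_mem_nhds hε)).exists
  refine ⟨r + c + 1, by omega, ?_⟩
  set 𝓥 := ray ((r + c + 1 : ℕ) : ℤ) {k} with h𝓥
  set F := (block 0 r k).filter (· ∈ 𝓗) with hF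
  have e𝓗 : 𝓗 = ↑F ∪ ray r (Set.Iio k) := by
    ext p
    simp only [hF, Set.mem_union, Finset.coe_filter, Set.mem_ofPred_eq, mem_block]
    constructor
    · intro hp
      have h3 := h2 hp
      simp only [mem_ray, Set.mem_Iio] at h3 ⊢
      by_cases h4 : p.1 < r
      · left; exact ⟨⟨⟨h3.1, h4⟩, h3.2⟩, hp⟩
      · right; omega
    · rintro (hp | hp)
      · exact hp.2
      · exact h1 hp
  have e1 := condInf_union hH.poly A F (ray r (Set.Iio k))
  have e2 := condInf_union hH.poly A F (ray r (Set.Iio k) ∪ 𝓥)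
  rw [← e𝓗] at e1
  rw [← Set.union_assoc, ← e𝓗] at e2
  have hsub : ray r (Set.Iio k) ⊆ ray r (Set.Iio k) ∪ 𝓥 := Set.subset_union_left
  have e3 := condInf_antitone hH.poly F hsub
  have e4 := condInf_sub_mono hH.poly (Finset.union_subset hA (Finset.filter_subset _ _) :
    A ∪ F ⊆ block 0 r k) hsub
  have e5 : condInf H (block 0 r k) (ray r (Set.Iio k)) -
      condInf H (block 0 r k) (ray r (Set.Iio k) ∪ 𝓥) < ε := by
    have e6 := condInf_block_eq_sum hH k {k} (c + 1) r
    have e7 : ((r : ℤ) + (c + 1 : ℕ)) = ((r + c + 1 : ℕ) : ℤ) := by push_cast; ring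
    rw [e7] at e6
    rw [h𝓥, e6, condInf_block_eq_mul hH]
    refine lt_of_le_of_lt ?_ hc
    rw [Finset.sum_sub_distrib]
    simp only [Finset.sum_const, Finset.card_range, nsmul_eq_mul, ← hhQ]
    refine sub_le_sub_left (Finset.sum_le_sum fun i _ => ?_) _
    refine condInf_antitone hH.poly _ (Set.union_subset_union_right _ ?_)
    rintro p ⟨hp1, hp2⟩
    refine ⟨?_, hp2⟩
    push_cast at hp1 ⊢
    omega
  linarith

/-- A future set that eventually contains every process and still leaves uncertainty about the
present of the first `r` processes. -/
theorem exists_future (hH : IsStationary H) {r : ℕ} {h : ℝ} (hh : 0 < h)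
    (hpos : ∀ q : ℕ, h ≤ condVal H (block 0 1 r) (block 1 (q + 1) r)) :
    ∃ 𝓗 : Set (ℤ × ℕ), (∀ t j, (t, j) ∈ 𝓗 → (t + 1, j) ∈ 𝓗) ∧
      (∀ j, ∃ R : ℤ, ∀ t, R ≤ t → (t, j) ∈ 𝓗) ∧
      ∀ S : Finset (ℤ × ℕ), (S : Set (ℤ × ℕ)) ⊆ 𝓗 → h / 2 ≤ condVal H (block 0 1 r) S := by
  let P : ℕ → Set (ℤ × ℕ) → Prop := fun n 𝓗 =>
    𝓗 ⊆ ray 1 (Set.Iio (r + n)) ∧ (∃ R : ℕ, 1 ≤ R ∧ ray R (Set.Iio (r + n)) ⊆ 𝓗) ∧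
    (∀ t j, (t, j) ∈ 𝓗 → (t + 1, j) ∈ 𝓗) ∧
    h / 2 + h / 2 ^ (n + 1) ≤ condInf H (block 0 1 r) 𝓗
  have hbase : P 0 (ray 1 (Set.Iio r)) := by
    refine ⟨by simp, ⟨1, le_rfl, by simp⟩, fun t j ht => ⟨by have := ht.1; dsimp only at *; omega,
      ht.2⟩, ?_⟩
    have : h / 2 + h / 2 ^ (0 + 1) = h := by ring
    rw [this]
    exact ge_of_tendsto' (tendsto_condVal_block hH r) hpos
  have hstep : ∀ n 𝓗, P n 𝓗 → ∃ 𝓗', 𝓗 ⊆ 𝓗' ∧ P (n + 1) 𝓗' := by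
    rintro n 𝓗 ⟨h1, ⟨R, hR1, hR⟩, h3, h4⟩
    have hA : block 0 1 r ⊆ block 0 R (r + n) := by
      intro p hp
      rw [mem_block] at hp ⊢
      omega
    obtain ⟨m, hm1, hm⟩ := exists_ray_condInf_le hH hA hR
      (h1.trans fun p hp => ⟨by have := hp.1; omega, hp.2⟩)
      (show 0 < h / 2 ^ (n + 1 + 1) by positivity)
    refine ⟨𝓗 ∪ ray m {r + n}, Set.subset_union_left, ?_, ⟨R + m, by omega, ?_⟩, ?_, ?_⟩
    · rintro p (hp | hp)
      · have := h1 hp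
        simp only [mem_ray, Set.mem_Iio] at this ⊢
        omega
      · simp only [mem_ray, Set.mem_singleton_iff, Set.mem_Iio] at hp ⊢
        omega
    · intro p hp
      simp only [mem_ray, Set.mem_Iio] at hp
      by_cases hpr : p.2 < r + n
      · left
        apply hR
        simp only [mem_ray, Set.mem_Iio]
        omega
      · right
        simp only [mem_ray, Set.mem_singleton_iff]
        omega
    · rintro t j (ht | ht)
      · exact Or.inl (h3 t j ht)
      · refine Or.inr ⟨?_, ht.2⟩
        have := ht.1
        dsimp only at *
        omega
    · have : h / 2 ^ (n + 1) = h / 2 ^ (n + 1 + 1) + h / 2 ^ (n + 1 + 1) := by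
        rw [pow_succ 2 (n + 1)]; ring
      linarith
  choose! g hg1 hg2 using hstep
  let f : ℕ → Set (ℤ × ℕ) := fun n => Nat.rec (ray 1 (Set.Iio r)) (fun n 𝓗 => g n 𝓗) n
  have hf : ∀ n, P n (f n) := by
    intro n
    induction n with
    | zero => exact hbase
    | succ n ih => exact hg2 n (f n) ih
  have hfm : Monotone f := monotone_nat_of_le_succ fun n => hg1 n (f n) (hf n)
  refine ⟨⋃ n, f n, ?_, ?_, ?_⟩
  · intro t j ht
    obtain ⟨n, hn⟩ := Set.mem_iUnion.1 ht
    exact Set.mem_iUnion.2 ⟨n, (hf n).2.2.1 t j hn⟩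
  · intro j
    obtain ⟨R, -, hR⟩ := (hf (j + 1)).2.1
    refine ⟨R, fun t ht => Set.mem_iUnion.2 ⟨j + 1, hR ⟨ht, ?_⟩⟩⟩
    simp only [Set.mem_Iio]
    omega
  · intro S hS
    obtain ⟨n, hn⟩ : ∃ n, (S : Set (ℤ × ℕ)) ⊆ f n :=
      hfm.directed_le.exists_mem_subset_of_finset_subset_biUnion hS
    have h1 := (hf n).2.2.2
    have h2 := condInf_le hH.poly (block 0 1 r) hn
    have h3 : 0 < h / 2 ^ (n + 1) := by positivity
    linarith

end

section
variable {X : Type*} [MetricSpace X]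

lemma exists_separated (T : X → X) (hent : 0 < Dynamics.coverEntropy T Set.univ) :
    ∃ ε : ℝ, 0 < ε ∧ ∃ h : ℝ, 0 < h ∧ ∃ᶠ n : ℕ in atTop, ∃ E : Finset X,
      h * n ≤ Real.log E.card ∧ E.Nonempty ∧
      ∀ x ∈ E, ∀ y ∈ E, x ≠ y → ∃ k < n, ε ≤ dist (T^[k] x) (T^[k] y) := by
  rw [Dynamics.coverEntropy_eq_iSup_basis_netEntropyEntourage Metric.uniformity_basis_dist,
    lt_iSup_iff] at hent
  obtain ⟨ε, hent⟩ := hent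
  rw [lt_iSup_iff] at hent
  obtain ⟨hε, hent⟩ := hent
  obtain ⟨h, h0, hlt⟩ := EReal.lt_iff_exists_real_btwn.1 hent
  have h0' : 0 < h := by exact_mod_cast h0
  refine ⟨ε, hε, h / 2, by positivity, ?_⟩
  have hfr := (ExpGrowth.frequently_exp_le hlt).and_eventually (eventually_gt_atTop 0)
  refine hfr.mono fun n ⟨hn, hn0⟩ => ?_
  have hn0' : (0 : ℝ) < n := by exact_mod_cast hn0
  have e1 : ((h : EReal) * (n : EReal)).exp = ENNReal.ofReal (Real.exp (h * n)) := by
    rw [← EReal.exp_coe]; norm_cast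
  rw [e1] at hn
  have hlt2 : (⌊Real.exp (h / 2 * n)⌋₊ : ℕ∞) <
      Dynamics.netMaxcard T Set.univ {p : X × X | dist p.1 p.2 < ε} n := by
    rw [← ENat.toENNReal_lt]
    refine lt_of_lt_of_le ?_ hn
    rw [ENat.toENNReal_coe, ← ENNReal.ofReal_natCast]
    refine (ENNReal.ofReal_lt_ofReal_iff (Real.exp_pos _)).2 ?_
    refine lt_of_le_of_lt (Nat.floor_le (Real.exp_pos _).le) (Real.exp_lt_exp.2 ?_)
    nlinarith
  rw [Dynamics.netMaxcard, lt_iSup_iff] at hlt2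
  obtain ⟨E, hlt2⟩ := hlt2
  rw [lt_iSup_iff] at hlt2
  obtain ⟨hE, hlt2⟩ := hlt2
  have hlt3 : ⌊Real.exp (h / 2 * n)⌋₊ < E.card := by exact_mod_cast hlt2
  have hlt4 := (Nat.floor_lt (Real.exp_pos _).le).1 hlt3
  refine ⟨E, ?_, Finset.card_pos.1 (by omega), ?_⟩
  · rw [← Real.log_exp (h / 2 * n)]
    exact Real.log_le_log (Real.exp_pos _) hlt4.le
  · intro x hx y hy hxy
    by_contra! hcon
    have hdis := hE.2 hx hy hxy
    refine (Set.disjoint_left.1 hdis : ∀ ⦃a⦄, _) (Dynamics.mem_ball_dynEntourage.2 hcon)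
      (Dynamics.mem_ball_dynEntourage.2 fun k _ => ?_)
    simpa [UniformSpace.ball] using hε

end

section
variable {X : Type*} [TopologicalSpace X] (T : X ≃ₜ X)

/-- The sets `T^{-t} C_j`. -/
def dynSets (C : ℕ → Set X) : ℤ × ℕ → Set X := fun p => ⇑(T ^ p.1) ⁻¹' C p.2

lemma zpow_apply_add (s t : ℤ) (x : X) : (T ^ (s + t)) x = (T ^ s) ((T ^ t) x) := by
  rw [zpow_add]; rfl

lemma preimage_dynSets (C : ℕ → Set X) (s : ℤ) (p : ℤ × ℕ) :
    ⇑(T ^ s) ⁻¹' dynSets T C p = dynSets T C (timeShift s p) := by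
  ext x
  simp [dynSets, zpow_apply_add]

lemma zpow_natCast_apply (k : ℕ) (x : X) : (T ^ (k : ℤ)) x = T^[k] x := by
  rw [zpow_natCast]
  induction k generalizing x with
  | zero => rfl
  | succ k ih => rw [pow_succ, Function.iterate_succ_apply, ← ih]; rfl

variable [MeasurableSpace X] [BorelSpace X]

lemma measurableSet_dynSets {C : ℕ → Set X} (hC : ∀ j, MeasurableSet (C j)) (p : ℤ × ℕ) :
    MeasurableSet (dynSets T C p) :=
  (T ^ p.1).measurable (hC p.2)

lemma setEntropy_map (ν : Measure X) {C : ℕ → Set X} (hC : ∀ j, MeasurableSet (C j)) (s : ℤ)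
    (S : Finset (ℤ × ℕ)) :
    setEntropy (ν.map ⇑(T ^ s)) (dynSets T C) S =
      setEntropy ν (dynSets T C) (S.map (timeShift s).toEmbedding) := by
  rw [setEntropy, setEntropy]
  refine Finset.sum_bij (fun A _ => A.map (timeShift s).toEmbedding) ?_ ?_ ?_ ?_
  · intro A hA
    simpa using hA
  · intro A _ A' _ h
    exact Finset.map_injective _ h
  · intro A hA
    refine ⟨A.map (timeShift s).symm.toEmbedding, ?_, ?_⟩
    · rw [Finset.mem_powerset] at hA ⊢
      intro p hp
      rw [Finset.mem_map_equiv, Equiv.symm_symm] at hp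
      have h1 := hA hp
      rwa [Finset.mem_map_equiv, Equiv.symm_apply_apply] at h1
    · ext p; simp [Finset.mem_map_equiv]
  · intro A _
    rw [map_measureReal_apply (T ^ s).measurable
      (measurableSet_cell (measurableSet_dynSets T hC) S A)]
    congr 2
    ext x
    simp only [cell, Set.mem_preimage, Set.mem_ofPred_eq]
    constructor
    · intro h p hp
      obtain ⟨p, rfl⟩ := (timeShift s).surjective p
      rw [Finset.mem_map_equiv, Equiv.symm_apply_apply] at hp
      rw [Finset.mem_map_equiv, Equiv.symm_apply_apply, ← h p hp, ← preimage_dynSets]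
      rfl
    · intro h p hp
      have := h (timeShift s p) (Finset.mem_map_of_mem _ hp)
      rw [Finset.mem_map_equiv, Equiv.symm_apply_apply, ← preimage_dynSets] at this
      exact this

lemma condVal_setEntropy_map (ν : Measure X) {C : ℕ → Set X} (hC : ∀ j, MeasurableSet (C j))
    (s : ℤ) (A S : Finset (ℤ × ℕ)) :
    condVal (setEntropy (ν.map ⇑(T ^ s)) (dynSets T C)) A S =
      condVal (setEntropy ν (dynSets T C)) (A.map (timeShift s).toEmbedding)
        (S.map (timeShift s).toEmbedding) := by
  rw [condVal, condVal, setEntropy_map T ν hC, setEntropy_map T ν hC, Finset.map_union]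

end

/-- Chain rule over consecutive times, keeping only `q` future steps in the conditions. -/
lemma sub_block_le {H : Finset (ℤ × ℕ) → ℝ} (hH : IsPolymatroid H) {r : ℕ} {c : ℝ}
    (hc : ∀ (i : ℤ) S, condVal H (block i (i + 1) r) S ≤ c) (n q : ℕ) :
    H (block 0 n r) - H ∅ ≤
      ∑ i ∈ Finset.range n, condVal H (block i (i + 1) r) (block (i + 1) (i + 1 + q) r) + q * c := by
  have hc0 : 0 ≤ c := (condVal_nonneg hH _ _).trans (hc 0 ∅)
  have htel : ∀ m : ℕ, m ≤ n → H (block 0 n r) - H (block m n r) =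
      ∑ i ∈ Finset.range m, condVal H (block i (i + 1) r) (block (i + 1) n r) := by
    intro m
    induction m with
    | zero => simp
    | succ m ih =>
      intro hm
      rw [Finset.sum_range_succ, ← ih (by omega), condVal]
      have : block m n r = block m (m + 1) r ∪ block (m + 1) n r := by
        ext p
        simp only [Finset.mem_union, mem_block]
        omega
      rw [this]
      push_cast
      ring
  have h1 := htel n le_rfl
  have h2 : block n n r = ∅ := by simp [block]
  rw [h2] at h1
  rw [h1]
  have h3 : ∀ i ∈ Finset.range n, condVal H (block i (i + 1) r) (block (i + 1) n r) ≤
      condVal H (block i (i + 1) r) (block (i + 1) (i + 1 + q) r) +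
        if n ≤ i + q then c else 0 := by
    intro i _
    split_ifs with hi
    · linarith [condVal_nonneg hH (block i (i + 1) r) (block (i + 1) (i + 1 + q) r),
        hc i (block (i + 1) n r)]
    · rw [add_zero]
      refine condVal_antitone hH _ fun p hp => ?_
      rw [mem_block] at hp ⊢
      omega
  refine (Finset.sum_le_sum h3).trans ?_
  rw [Finset.sum_add_distrib, ← Finset.sum_filter, Finset.sum_const, nsmul_eq_mul]
  gcongr
  have : (Finset.range n).filter (fun i => n ≤ i + q) ⊆ Finset.Ico (n - q) n := by
    intro i hi
    simp only [Finset.mem_filter, Finset.mem_range, Finset.mem_Ico] at hi ⊢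
    omega
  refine (Finset.card_le_card this).trans ?_
  rw [Nat.card_Ico]
  omega

lemma setEntropy_eq_log {ι Ω : Type*} [DecidableEq ι] [MeasurableSpace Ω] (ν : Measure Ω)
    [IsProbabilityMeasure ν] {B : ι → Set Ω} (hB : ∀ i, MeasurableSet (B i)) (S : Finset ι)
    {c : ℝ} (h : ∀ A, ν.real (cell B S A) = 0 ∨ ν.real (cell B S A) = c⁻¹) :
    setEntropy ν B S = Real.log c := by
  have h1 : ∀ A ∈ S.powerset, Real.negMulLog (ν.real (cell B S A)) =
      ν.real (cell B S A) * Real.log c := by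
    intro A _
    rcases h A with h | h <;> rw [h]
    · simp
    · rw [Real.negMulLog, Real.log_inv]; ring
  rw [setEntropy, Finset.sum_congr rfl h1, ← Finset.sum_mul, sum_measureReal_cell ν hB]
  simp

section
variable {X : Type*} [MetricSpace X] [CompactSpace X] [MeasurableSpace X] [BorelSpace X]

/-- The uniform measure on a finite set of points. -/
noncomputable def uniformMeasure (E : Finset X) : Measure X :=
  (E.card : NNReal)⁻¹ • ∑ x ∈ E, Measure.dirac x

lemma uniformMeasure_real (E : Finset X) {A : Set X} (hA : MeasurableSet A)
    [DecidablePred (· ∈ A)] :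
    (uniformMeasure E).real A = (E.card : ℝ)⁻¹ * (E.filter (· ∈ A)).card := by
  rw [uniformMeasure, measureReal_nnreal_smul_apply]
  congr 1
  rw [measureReal_def, Measure.finsetSum_apply]
  simp only [Measure.dirac_apply' _ hA, Set.indicator_apply, Pi.one_apply, Finset.sum_boole]
  simp

lemma isProbabilityMeasure_uniformMeasure {E : Finset X} (hE : E.Nonempty) :
    IsProbabilityMeasure (uniformMeasure E) := by
  have hE' : (E.card : NNReal) ≠ 0 := by simpa using hE.ne_empty
  constructor
  rw [uniformMeasure, Measure.smul_apply, Measure.finsetSum_apply]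
  simp only [measure_univ, Finset.sum_const, nsmul_eq_mul, mul_one]
  rw [ENNReal.smul_def, smul_eq_mul, ENNReal.coe_inv hE']
  exact ENNReal.inv_mul_cancel (by simpa using hE.ne_empty) (by simp)

/-- Averages of a measure along an orbit segment. -/
noncomputable def orbitMeasure (T : X ≃ₜ X) (σ : Measure X) (n : ℕ) : Measure X :=
  (n : NNReal)⁻¹ • ∑ i ∈ Finset.range n, σ.map ⇑(T ^ (i : ℤ))

lemma isProbabilityMeasure_orbitMeasure (T : X ≃ₜ X) (σ : Measure X) [IsProbabilityMeasure σ]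
    {n : ℕ} (hn : n ≠ 0) : IsProbabilityMeasure (orbitMeasure T σ n) := by
  constructor
  rw [orbitMeasure, Measure.smul_apply, Measure.finsetSum_apply]
  have : ∀ i : ℕ, (σ.map ⇑(T ^ (i : ℤ))) Set.univ = 1 := fun i => by
    rw [Measure.map_apply (T ^ (i : ℤ)).measurable MeasurableSet.univ]; simp
  simp only [this, Finset.sum_const, nsmul_eq_mul, mul_one, Finset.card_range]
  rw [ENNReal.smul_def, smul_eq_mul, ENNReal.coe_inv (by simpa using hn)]
  exact ENNReal.inv_mul_cancel (by simpa using hn) (by simp)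

lemma log_card_le (T : X ≃ₜ X) {ε : ℝ} {n : ℕ} (hn : n ≠ 0) {E : Finset X} (hEne : E.Nonempty)
    (hE : ∀ x ∈ E, ∀ y ∈ E, x ≠ y → ∃ k < n, ε ≤ dist (T^[k] x) (T^[k] y))
    {C : ℕ → Set X} (hC : ∀ j, MeasurableSet (C j)) {r : ℕ}
    (hcov : ∀ x, ∃ j < r, x ∈ C j) (hdiam : ∀ j < r, ∀ x ∈ C j, ∀ y ∈ C j, dist x y < ε) (q : ℕ) :
    Real.log E.card ≤ n * condVal (setEntropy (orbitMeasure T (uniformMeasure E) n) (dynSets T C))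
      (block 0 1 r) (block 1 (q + 1) r) + q * (r * Real.log 2) := by
  classical
  have := isProbabilityMeasure_uniformMeasure hEne
  set σ := uniformMeasure E
  have hB := measurableSet_dynSets T hC
  have hlog : setEntropy σ (dynSets T C) (block 0 n r) = Real.log E.card := by
    refine setEntropy_eq_log σ hB _ fun A => ?_
    rw [uniformMeasure_real E (measurableSet_cell hB _ _)]
    have hcard : (E.filter (· ∈ cell (dynSets T C) (block 0 n r) A)).card ≤ 1 := by
      rw [Finset.card_le_one]
      intro x hx y hy
      rw [Finset.mem_filter] at hx hy
      by_contra hxy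
      obtain ⟨k, hk, hd⟩ := hE x hx.1 y hy.1 hxy
      obtain ⟨j, hj, hxj⟩ := hcov (T^[k] x)
      have hkj : ((k : ℤ), j) ∈ block 0 n r := by
        rw [mem_block]; simp only; omega
      have h1 : x ∈ dynSets T C ((k : ℤ), j) := by
        rw [← zpow_natCast_apply] at hxj
        exact hxj
      have h2 := (hy.2 _ hkj).2 ((hx.2 _ hkj).1 h1)
      have h3 : T^[k] y ∈ C j := by
        have h4 : (T ^ (k : ℤ)) y ∈ C j := h2
        rwa [zpow_natCast_apply] at h4
      exact absurd (hdiam j hj _ hxj _ h3) (not_lt.2 hd)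
    interval_cases h : (E.filter (· ∈ cell (dynSets T C) (block 0 n r) A)).card
    · left; simp
    · right; simp
  have hempty : setEntropy σ (dynSets T C) ∅ = 0 := by
    simp [setEntropy, cell_self_empty]
  have hpoly := isPolymatroid_setEntropy σ hB
  have hc : ∀ (i : ℤ) S, condVal (setEntropy σ (dynSets T C)) (block i (i + 1) r) S ≤
      r * Real.log 2 := by
    intro i S
    refine (condVal_setEntropy_le_card σ hB _ S).trans_eq ?_
    simp [block]
  have h1 := sub_block_le hpoly hc n q
  rw [hlog, hempty, sub_zero] at h1
  refine h1.trans ?_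
  gcongr
  have hprob : ∀ i : ℕ, IsProbabilityMeasure (σ.map ⇑(T ^ (i : ℤ))) := fun i =>
    Measure.isProbabilityMeasure_map (T ^ (i : ℤ)).measurable.aemeasurable
  have h2 : ∀ i : ℕ, condVal (setEntropy σ (dynSets T C)) (block i (i + 1) r)
      (block (i + 1) (i + 1 + q) r) = condVal (setEntropy (σ.map ⇑(T ^ (i : ℤ))) (dynSets T C))
      (block 0 1 r) (block 1 (q + 1) r) := by
    intro i
    rw [condVal_setEntropy_map T σ hC, block_map, block_map]
    congr 2 <;> ring
  simp_rw [h2]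
  rw [orbitMeasure, condVal_setEntropy_smul _ _ hB, ← mul_assoc]
  have hn' : (n : ℝ) * ((n : NNReal)⁻¹ : NNReal) = 1 := by
    push_cast
    exact mul_inv_cancel₀ (by exact_mod_cast hn)
  rw [hn', one_mul]
  exact condVal_setEntropy_sum_le _ _ hB _ _

lemma abs_integral_orbitMeasure_sub_le (T : X ≃ₜ X) (σ : Measure X) [IsProbabilityMeasure σ]
    {n : ℕ} (f : BoundedContinuousFunction X ℝ) :
    |∫ x, f (T x) ∂(orbitMeasure T σ n) - ∫ x, f x ∂(orbitMeasure T σ n)| ≤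
      (n : ℝ)⁻¹ * (2 * ‖f‖) := by
  have hint : ∀ g : BoundedContinuousFunction X ℝ, ∫ x, g x ∂(orbitMeasure T σ n) =
      (n : ℝ)⁻¹ * ∑ i ∈ Finset.range n, ∫ x, g ((T ^ (i : ℤ)) x) ∂σ := by
    intro g
    have hprob : ∀ i : ℕ, IsProbabilityMeasure (σ.map ⇑(T ^ (i : ℤ))) := fun i =>
      Measure.isProbabilityMeasure_map (T ^ (i : ℤ)).measurable.aemeasurable
    rw [orbitMeasure, integral_smul_nnreal_measure, integral_finsetSum_measure
      (fun i _ => g.integrable _), NNReal.smul_def, smul_eq_mul]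
    congr 1
    refine Finset.sum_congr rfl fun i _ => ?_
    rw [integral_map (T ^ (i : ℤ)).measurable.aemeasurable
      g.continuous.measurable.aestronglyMeasurable]
  have h1 := hint (f.compContinuous ⟨T, T.continuous⟩)
  have h2 := hint f
  simp only [BoundedContinuousFunction.compContinuous_apply, ContinuousMap.coe_mk] at h1
  rw [h1, h2, ← mul_sub, ← Finset.sum_sub_distrib, abs_mul, abs_of_nonneg (by positivity)]
  gcongr
  have h3 : ∀ i : ℕ, (fun x => f (T ((T ^ (i : ℤ)) x))) = fun x =>
      f ((T ^ ((i + 1 : ℕ) : ℤ)) x) := by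
    intro i
    ext x
    push_cast
    rw [add_comm, zpow_apply_add, zpow_one]
  simp_rw [h3]
  rw [Finset.sum_range_sub (fun i : ℕ => ∫ x, f ((T ^ (i : ℤ)) x) ∂σ)]
  have h4 : ∀ i : ℕ, |∫ x, f ((T ^ (i : ℤ)) x) ∂σ| ≤ ‖f‖ := by
    intro i
    have := norm_integral_le_of_norm_le_const (μ := σ) (f := fun x => f ((T ^ (i : ℤ)) x))
      (C := ‖f‖) (ae_of_all _ fun x => f.norm_coe_le_norm _)
    simpa using this
  refine (abs_sub _ _).trans ?_
  linarith [h4 n, h4 0]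

end

lemma cell_congr {ι Ω : Type*} {B B' : ι → Set Ω} {S : Finset ι} (h : ∀ i ∈ S, B i = B' i)
    (A : Finset ι) : cell B S A = cell B' S A := by
  ext x
  simp only [cell, Set.mem_ofPred_eq]
  exact forall₂_congr fun i hi => by rw [h i hi]

lemma setEntropy_congr {ι Ω : Type*} [MeasurableSpace Ω] (ν : Measure Ω) {B B' : ι → Set Ω}
    {S : Finset ι} (h : ∀ i ∈ S, B i = B' i) : setEntropy ν B S = setEntropy ν B' S := by
  simp only [setEntropy, cell_congr h]

section
variable {X : Type*} [MetricSpace X] [MeasurableSpace X] [BorelSpace X]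

lemma measure_frontier_cell {ι : Type*} (μ : Measure X) {B : ι → Set X}
    (S A : Finset ι) (h : ∀ i ∈ S, μ (frontier (B i)) = 0) : μ (frontier (cell B S A)) = 0 := by
  classical
  induction S using Finset.induction_on with
  | empty => simp [cell_self_empty]
  | insert i S hi ih =>
    have h1 := ih fun j hj => h j (Finset.mem_insert_of_mem hj)
    have h2 := h i (Finset.mem_insert_self _ _)
    have e : cell B (insert i S) A = cell B S A ∩ (if i ∈ A then B i else (B i)ᶜ) := by
      ext x
      simp only [cell, Finset.mem_insert, forall_eq_or_imp, Set.mem_ofPred_eq, Set.mem_inter_iff]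
      split_ifs with hA <;> simp [hA, and_comm]
    rw [e]
    refine measure_mono_null (frontier_inter_subset _ _)
      (measure_union_null (measure_mono_null Set.inter_subset_left h1)
        (measure_mono_null Set.inter_subset_right ?_))
    split_ifs
    · exact h2
    · rwa [frontier_compl]

variable [CompactSpace X]

lemma measurePreserving_zpow {T : X ≃ₜ X} {μ : Measure X} (hT : MeasurePreserving T μ μ) (s : ℤ) :
    MeasurePreserving ⇑(T ^ s) μ μ := by
  have hnat : ∀ n : ℕ, MeasurePreserving ⇑(T ^ (n : ℤ)) μ μ := by
    intro n
    have : ⇑(T ^ (n : ℤ)) = T^[n] := funext (zpow_natCast_apply T n)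
    rw [this]
    exact hT.iterate n
  obtain ⟨n, rfl | rfl⟩ := s.eq_nat_or_neg
  · exact hnat n
  · rw [zpow_neg]
    exact MeasurePreserving.symm (T ^ (n : ℤ)).toMeasurableEquiv (hnat n)

lemma isStationary_setEntropy {T : X ≃ₜ X} {μ : Measure X} [IsProbabilityMeasure μ]
    (hT : MeasurePreserving T μ μ) {C : ℕ → Set X} (hC : ∀ j, MeasurableSet (C j)) :
    IsStationary (setEntropy μ (dynSets T C)) where
  poly := isPolymatroid_setEntropy μ (measurableSet_dynSets T hC)
  shift s S := by rw [← setEntropy_map T μ hC, (measurePreserving_zpow hT s).map_eq]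

lemma exists_null_frontier_cover (μ : Measure X) [IsProbabilityMeasure μ] {ε : ℝ} (hε : 0 < ε) :
    ∃ (r : ℕ) (C : ℕ → Set X), (∀ j, IsOpen (C j)) ∧ (∀ j, μ (frontier (C j)) = 0) ∧
      (∀ x, ∃ j < r, x ∈ C j) ∧ ∀ j < r, ∀ x ∈ C j, ∀ y ∈ C j, dist x y < ε := by
  have h1 : ∀ x : X, ∃ ρ, (0 < ρ ∧ ρ < ε / 2) ∧ μ (frontier (Metric.ball x ρ)) = 0 := by
    intro x
    obtain ⟨ρ, hρ, hμ⟩ := exists_null_frontier_thickening μ {x} (half_pos hε)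
    rw [Metric.thickening_singleton] at hμ
    exact ⟨ρ, hρ, hμ⟩
  choose ρ hρ hμ using h1
  obtain ⟨F, hF⟩ := isCompact_univ.elim_finite_subcover (fun x => Metric.ball x (ρ x))
    (fun x => Metric.isOpen_ball) fun x _ => Set.mem_iUnion.2 ⟨x, Metric.mem_ball_self (hρ x).1⟩
  let L := F.toList
  refine ⟨L.length, fun j => if h : j < L.length then Metric.ball L[j] (ρ L[j]) else ∅, ?_, ?_, ?_,
    ?_⟩
  · intro j
    dsimp only
    split_ifs
    · exact Metric.isOpen_ball
    · exact isOpen_empty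
  · intro j
    dsimp only
    split_ifs
    · exact hμ _
    · simp
  · intro x
    obtain ⟨z, hz, hx⟩ := Set.mem_iUnion₂.1 (hF (Set.mem_univ x))
    obtain ⟨j, hj, rfl⟩ := List.getElem_of_mem (Finset.mem_toList.2 hz)
    refine ⟨j, hj, ?_⟩
    have hj' : j < L.length := hj
    dsimp only
    rw [dif_pos hj']
    exact hx
  · intro j hj x hx y hy
    dsimp only at hx hy
    rw [dif_pos hj, Metric.mem_ball] at hx hy
    have := (hρ L[j]).2
    calc dist x y ≤ dist x L[j] + dist y L[j] := dist_triangle_right _ _ _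
      _ < ε := by linarith

/-- A topological system of positive entropy carries an invariant measure of positive entropy. -/
theorem exists_measure (T : X ≃ₜ X) (hent : 0 < Dynamics.coverEntropy T Set.univ) :
    ∃ μ : Measure X, IsProbabilityMeasure μ ∧ MeasurePreserving T μ μ ∧ ∃ h : ℝ, 0 < h ∧
      ∃ (r : ℕ) (C : ℕ → Set X), (∀ j, IsOpen (C j)) ∧
        ∀ C' : ℕ → Set X, (∀ j < r, C' j = C j) → ∀ q : ℕ,
          h ≤ condVal (setEntropy μ (dynSets T C')) (block 0 1 r) (block 1 (q + 1) r) := by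
  classical
  obtain ⟨ε, hε, h, hh, hfr⟩ := exists_separated T hent
  have hfr' := hfr.and_eventually (eventually_gt_atTop 0)
  let P : ℕ → Finset X → Prop := fun n E => h * n ≤ Real.log E.card ∧ E.Nonempty ∧
      ∀ x ∈ E, ∀ y ∈ E, x ≠ y → ∃ k < n, ε ≤ dist (T^[k] x) (T^[k] y)
  let good : Set ℕ := {n | (∃ E, P n E) ∧ 0 < n}
  have hNB : (atTop ⊓ 𝓟 good).NeBot := frequently_mem_iff_neBot.1 hfr'
  obtain ⟨n₀, ⟨E₀, hE₀⟩, -⟩ := hfr'.exists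
  have hx₀ : Nonempty X := ⟨hE₀.2.1.choose⟩
  let x₀ : X := Classical.arbitrary X
  have hch : ∀ n, ∃ E : Finset X, E.Nonempty ∧ (n ∈ good → P n E) := by
    intro n
    by_cases hn : n ∈ good
    · obtain ⟨E, hE⟩ := hn.1
      exact ⟨E, hE.2.1, fun _ => hE⟩
    · exact ⟨{x₀}, by simp, fun h => absurd h hn⟩
  choose E hEne hE using hch
  have hσ : ∀ n, IsProbabilityMeasure (uniformMeasure (E n)) := fun n =>
    isProbabilityMeasure_uniformMeasure (hEne n)
  let μs : ℕ → ProbabilityMeasure X := fun n =>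
    if hn : n ≠ 0 then ⟨orbitMeasure T (uniformMeasure (E n)) n,
      isProbabilityMeasure_orbitMeasure T _ hn⟩ else ⟨Measure.dirac x₀, inferInstance⟩
  have hμs : ∀ n, n ≠ 0 →
      (μs n : Measure X) = orbitMeasure T (uniformMeasure (E n)) n := by
    intro n hn
    simp [μs, hn]
  let u := Ultrafilter.of (atTop ⊓ 𝓟 good)
  have hu : (u : Filter ℕ) ≤ atTop ⊓ 𝓟 good := Ultrafilter.of_le _
  have hutop : (u : Filter ℕ) ≤ atTop := hu.trans inf_le_left
  have hugood : ∀ᶠ n in (u : Filter ℕ), n ∈ good :=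
    (hu.trans inf_le_right) (mem_principal_self good)
  obtain ⟨μ, -, hμ⟩ := (isCompact_univ (X := ProbabilityMeasure X)).ultrafilter_le_nhds
    (u.map μs) (by simp)
  have hlim : Tendsto μs u (𝓝 μ) := hμ
  have hinv : MeasurePreserving T (μ : Measure X) (μ : Measure X) := by
    refine ⟨T.measurable, ?_⟩
    have : IsProbabilityMeasure ((μ : Measure X).map T) :=
      Measure.isProbabilityMeasure_map T.measurable.aemeasurable
    refine ext_of_forall_integral_eq_of_IsFiniteMeasure fun f => ?_
    rw [integral_map T.measurable.aemeasurable f.continuous.measurable.aestronglyMeasurable]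
    have h1 := ProbabilityMeasure.tendsto_iff_forall_integral_tendsto.1 hlim f
    have h2 := ProbabilityMeasure.tendsto_iff_forall_integral_tendsto.1 hlim
      (f.compContinuous ⟨T, T.continuous⟩)
    simp only [BoundedContinuousFunction.compContinuous_apply, ContinuousMap.coe_mk] at h2
    have h3 : Tendsto (fun n : ℕ => (n : ℝ)⁻¹ * (2 * ‖f‖)) u (𝓝 0) := by
      have := (tendsto_inv_atTop_nhds_zero_nat (𝕜 := ℝ)).mul_const (2 * ‖f‖)
      rw [zero_mul] at this
      exact this.mono_left hutop
    have h4 := squeeze_zero_norm' (f := fun n => ∫ x, f (T x) ∂(μs n : Measure X) -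
      ∫ x, f x ∂(μs n : Measure X)) (by
        filter_upwards [hugood] with n hn
        rw [hμs n hn.2.ne', Real.norm_eq_abs]
        exact abs_integral_orbitMeasure_sub_le T _ f) h3
    exact sub_eq_zero.1 (tendsto_nhds_unique (h2.sub h1) h4)
  obtain ⟨r, C, hC, hfront, hcov, hdiam⟩ := exists_null_frontier_cover (μ : Measure X) hε
  refine ⟨μ, inferInstance, hinv, h, hh, r, C, hC, fun C' hC' q => ?_⟩
  have hent : ∀ S : Finset (ℤ × ℕ), Tendsto
      (fun n => setEntropy (μs n : Measure X) (dynSets T C) S) u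
      (𝓝 (setEntropy (μ : Measure X) (dynSets T C) S)) := by
    intro S
    refine tendsto_finsetSum _ fun A _ => (Real.continuous_negMulLog.tendsto _).comp ?_
    have hnull : (μ : Measure X) (frontier (cell (dynSets T C) S A)) = 0 := by
      refine measure_frontier_cell _ S A fun p _ => ?_
      rw [dynSets, ← (T ^ p.1).preimage_frontier,
        (measurePreserving_zpow hinv p.1).measure_preimage isClosed_frontier.nullMeasurableSet]
      exact hfront p.2
    exact (ENNReal.tendsto_toReal (measure_ne_top _ _)).comp
      (ProbabilityMeasure.tendsto_measure_of_null_frontier_of_tendsto' hlim hnull)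
  have hkey : h ≤ condVal (setEntropy (μ : Measure X) (dynSets T C)) (block 0 1 r)
      (block 1 (q + 1) r) := by
    have h1 : Tendsto (fun n : ℕ => condVal (setEntropy (μs n : Measure X) (dynSets T C))
        (block 0 1 r) (block 1 (q + 1) r) + (n : ℝ)⁻¹ * (q * (r * Real.log 2))) u
        (𝓝 (condVal (setEntropy (μ : Measure X) (dynSets T C)) (block 0 1 r)
          (block 1 (q + 1) r) + 0 * (q * (r * Real.log 2)))) :=
      ((hent _).sub (hent _)).add
        (((tendsto_inv_atTop_nhds_zero_nat (𝕜 := ℝ)).mono_left hutop).mul_const _)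
    rw [zero_mul, add_zero] at h1
    refine ge_of_tendsto h1 ?_
    filter_upwards [hugood] with n hn
    have hn0 : (0 : ℝ) < n := by exact_mod_cast hn.2
    have hP := hE n hn
    have h2 := hP.1.trans (log_card_le T hn.2.ne' hP.2.1 hP.2.2
      (fun j => (hC j).measurableSet) hcov hdiam q)
    rw [hμs n hn.2.ne']
    rw [mul_comm h, ← le_div_iff₀' hn0] at h2
    refine h2.trans_eq ?_
    field_simp
  have hcongr : ∀ S : Finset (ℤ × ℕ), (∀ p ∈ S, p.2 < r) →
      setEntropy (μ : Measure X) (dynSets T C') S = setEntropy (μ : Measure X) (dynSets T C) S :=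
    fun S hS => setEntropy_congr _ fun p hp => by rw [dynSets, dynSets, hC' _ (hS p hp)]
  rw [condVal, hcongr, hcongr]
  · exact hkey
  · intro p hp
    exact (mem_block.1 hp).2
  · intro p hp
    rw [Finset.mem_union, mem_block, mem_block] at hp
    omega

end

lemma splitEntropy_comm (u v : ℝ) : splitEntropy u v = splitEntropy v u := by
  simp only [splitEntropy, add_comm]

lemma exists_splitEntropy_lt {ε : ℝ} (hε : 0 < ε) :
    ∃ δ : ℝ, 0 < δ ∧ ∀ u v : ℝ, 0 ≤ u → 0 ≤ v → u + v ≤ 1 → v < δ → splitEntropy u v < ε := by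
  have huc := (isCompact_Icc (a := (0 : ℝ)) (b := 1)).uniformContinuousOn_of_continuous
    Real.continuous_negMulLog.continuousOn
  rw [Metric.uniformContinuousOn_iff] at huc
  obtain ⟨δ, hδ, h⟩ := huc (ε / 2) (half_pos hε)
  refine ⟨δ, hδ, fun u v hu hv huv hvδ => ?_⟩
  have h1 := h u ⟨hu, by linarith⟩ (u + v) ⟨by linarith, huv⟩ (by
    rw [Real.dist_eq]; simpa [abs_of_nonneg hv] using hvδ)
  have h2 := h v ⟨hv, by linarith⟩ 0 ⟨le_rfl, zero_le_one⟩ (by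
    rw [Real.dist_eq]; simpa [abs_of_nonneg hv] using hvδ)
  rw [Real.dist_eq] at h1 h2
  have h3 := (abs_lt.1 h1).2
  have h4 := (abs_lt.1 h2).2
  rw [Real.negMulLog_zero] at h4
  rw [splitEntropy]
  linarith

section
variable {ι Ω : Type*} [DecidableEq ι] [mΩ : MeasurableSpace Ω]

lemma entropyGain_le_empty (ν : Measure Ω) [IsFiniteMeasure ν] {B : ι → Set Ω}
    (hB : ∀ i, MeasurableSet (B i)) (S : Finset ι) (i : ι) :
    entropyGain ν B S i ≤ entropyGain ν B ∅ i := by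
  induction S using Finset.induction_on with
  | empty => exact le_rfl
  | insert j S hj ih => exact (entropyGain_insert_le ν hB i hj).trans ih

/-- The set `A` is a union of atoms of the partition generated by `B i`, `i ∈ S`. -/
def Determined (B : ι → Set Ω) (S : Finset ι) (A : Set Ω) : Prop :=
  ∀ x y, (∀ i ∈ S, (x ∈ B i ↔ y ∈ B i)) → (x ∈ A ↔ y ∈ A)

lemma Determined.mono {B : ι → Set Ω} {S S' : Finset ι} {A : Set Ω} (h : Determined B S A)
    (hS : S ⊆ S') : Determined B S' A :=
  fun x y hxy => h x y fun i hi => hxy i (hS hi)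

lemma entropyGain_le_of_determined (ν : Measure Ω) [IsFiniteMeasure ν] {B : ι → Set Ω}
    (hB : ∀ i, MeasurableSet (B i)) {S : Finset ι} {A : Set Ω}
    (h : Determined B S A) (i : ι) :
    entropyGain ν B S i ≤ splitEntropy (ν.real (A ∩ B i)) (ν.real (A \ B i)) +
      splitEntropy (ν.real (Aᶜ ∩ B i)) (ν.real (Aᶜ \ B i)) := by
  have hempty : ∀ A : Set Ω, entropyGain (ν.restrict A) B ∅ i =
      splitEntropy (ν.real (A ∩ B i)) (ν.real (A \ B i)) := by
    intro A
    simp only [entropyGain, Finset.powerset_empty, Finset.sum_singleton, cell_self_empty,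
      Set.univ_inter]
    rw [measureReal_restrict_apply (hB i),
        measureReal_restrict_apply (MeasurableSet.univ.diff (hB i)),
      Set.inter_comm]
    congr 2
    ext x; simp [and_comm]
  rw [← hempty, ← hempty]
  refine le_trans (le_of_eq ?_) (add_le_add (entropyGain_le_empty (ν.restrict A) hB S i)
    (entropyGain_le_empty (ν.restrict Aᶜ) hB S i))
  simp only [entropyGain]
  rw [← Finset.sum_add_distrib]
  refine Finset.sum_congr rfl fun T _ => ?_
  have hc := measurableSet_cell hB S T
  rw [measureReal_restrict_apply (hc.inter (hB i)), measureReal_restrict_apply (hc.inter (hB i)),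
    measureReal_restrict_apply (hc.diff (hB i)), measureReal_restrict_apply (hc.diff (hB i))]
  have hcell : cell B S T ⊆ A ∨ cell B S T ⊆ Aᶜ := by
    by_cases hne : (cell B S T ∩ A).Nonempty
    · left
      obtain ⟨x, hx, hxA⟩ := hne
      intro y hy
      exact (h x y fun i hi => (hx i hi).trans (hy i hi).symm).1 hxA
    · right
      intro y hy hyA
      exact hne ⟨y, hy, hyA⟩
  have h0 : splitEntropy 0 0 = 0 := by simp [splitEntropy]
  have hin : ∀ {Q R : Set Ω}, cell B S T ⊆ Q → R ⊆ cell B S T → R ∩ Q = R :=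
    fun hQ hR => Set.inter_eq_left.2 (hR.trans hQ)
  have hout : ∀ {Q R : Set Ω}, cell B S T ⊆ Qᶜ → R ⊆ cell B S T → R ∩ Q = ∅ :=
    fun hQ hR => Set.disjoint_iff_inter_eq_empty.1
      (Set.disjoint_left.2 fun x hx hxQ => hQ (hR hx) hxQ)
  rcases hcell with hcell | hcell
  · rw [hin hcell Set.inter_subset_left, hin hcell Set.sdiff_subset,
      hout (Q := Aᶜ) (by simpa using hcell) Set.inter_subset_left,
      hout (Q := Aᶜ) (by simpa using hcell) Set.sdiff_subset]
    simp [h0]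
  · rw [hin hcell Set.inter_subset_left, hin hcell Set.sdiff_subset,
      hout hcell Set.inter_subset_left, hout hcell Set.sdiff_subset]
    simp [h0]

lemma condVal_singleton_le (ν : Measure Ω) [IsFiniteMeasure ν] {B : ι → Set Ω}
    (hB : ∀ i, MeasurableSet (B i)) (S : Finset ι) (i : ι) :
    condVal (setEntropy ν B) {i} S ≤ entropyGain ν B S i := by
  rw [condVal, Finset.singleton_union]
  by_cases hi : i ∈ S
  · rw [Finset.insert_eq_of_mem hi, sub_self]
    exact entropyGain_nonneg _ _ _ _
  · rw [setEntropy_insert ν hB hi]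
    linarith

lemma condVal_le_sum {H : Finset ι → ℝ} (hH : IsPolymatroid H) (A S : Finset ι) :
    condVal H A S ≤ ∑ i ∈ A, condVal H {i} S := by
  induction A using Finset.induction_on with
  | empty => simp [condVal]
  | insert i A hi ih =>
    rw [Finset.sum_insert hi, Finset.insert_eq, condVal_union]
    exact add_le_add (condVal_antitone hH _ Finset.subset_union_right) ih

/-- Sets in the `σ`-algebra generated by a family are approximated by sets determined by finitely
many members. -/
lemma exists_determined_approx (μ : Measure Ω) [IsProbabilityMeasure μ] {B : ι → Set Ω}
    (hB : ∀ i, MeasurableSet (B i)) (𝓗 : Set ι) {G : Set Ω}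
    (hG : MeasurableSet[MeasurableSpace.generateFrom (B '' 𝓗)] G) {δ : ℝ} (hδ : 0 < δ) :
    ∃ (S : Finset ι) (A : Set Ω), (S : Set ι) ⊆ 𝓗 ∧ Determined B S A ∧ MeasurableSet A ∧
      μ.real (symmDiff A G) < δ := by
  have hle : MeasurableSpace.generateFrom (B '' 𝓗) ≤ mΩ := MeasurableSpace.generateFrom_le (by
    rintro _ ⟨i, _, rfl⟩; exact hB i)
  let R : Set (Set Ω) := {A | MeasurableSet[MeasurableSpace.generateFrom (B '' 𝓗)] A ∧ ∃ S :
      Finset ι, (S : Set ι) ⊆ 𝓗 ∧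
    Determined B S A}
  have hR : IsSetRing R := by
    refine ⟨⟨@MeasurableSet.empty _ (MeasurableSpace.generateFrom (B '' 𝓗)), ∅, by simp,
        fun x y _ => by simp⟩, ?_, ?_⟩
    · rintro A A' ⟨h1, S, hS, hd⟩ ⟨h1', S', hS', hd'⟩
      refine ⟨MeasurableSet.union h1 h1', S ∪ S', by simp [hS, hS'], fun x y hxy => ?_⟩
      rw [Set.mem_union, Set.mem_union, hd.mono Finset.subset_union_left x y hxy,
        hd'.mono Finset.subset_union_right x y hxy]
    · rintro A A' ⟨h1, S, hS, hd⟩ ⟨h1', S', hS', hd'⟩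
      refine ⟨MeasurableSet.diff h1 h1', S ∪ S', by simp [hS, hS'], fun x y hxy => ?_⟩
      rw [Set.mem_sdiff, Set.mem_sdiff, hd.mono Finset.subset_union_left x y hxy,
        hd'.mono Finset.subset_union_right x y hxy]
  have hgen : MeasurableSpace.generateFrom (B '' 𝓗) = MeasurableSpace.generateFrom R := by
    apply le_antisymm
    · refine MeasurableSpace.generateFrom_mono ?_
      rintro _ ⟨i, hi, rfl⟩
      exact ⟨MeasurableSpace.measurableSet_generateFrom ⟨i, hi, rfl⟩, {i}, by simpa using hi,
        fun x y hxy => hxy i (by simp)⟩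
    · exact MeasurableSpace.generateFrom_le fun A hA => hA.1
  have hfin : IsFiniteMeasure (μ.trim hle) := isFiniteMeasure_trim hle
  obtain ⟨A, ⟨hAm, S, hS, hd⟩, hA⟩ := @exists_measure_symmDiff_lt_of_generateFrom_isSetRing Ω
    (MeasurableSpace.generateFrom (B '' 𝓗))
    (μ.trim hle) hfin R hR ⟨{Set.univ}, by simp, by
      rintro _ rfl; exact ⟨@MeasurableSet.univ _ (MeasurableSpace.generateFrom (B '' 𝓗)), ∅,
          by simp, fun x y _ => by simp⟩, by simp⟩
    hgen G hG (ENNReal.ofReal δ) (by simpa using hδ)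
  refine ⟨S, A, hS, hd, hle _ hAm, ?_⟩
  rw [trim_measurableSet_eq hle (MeasurableSet.symmDiff hAm hG)] at hA
  rw [measureReal_def]
  exact (ENNReal.toReal_lt_of_lt_ofReal hA)

lemma exists_condVal_lt_of_ae_eq (μ : Measure Ω) [IsProbabilityMeasure μ] {B : ι → Set Ω}
    (hB : ∀ i, MeasurableSet (B i)) (𝓗 : Set ι) {G : Set Ω}
    (hG : MeasurableSet[MeasurableSpace.generateFrom (B '' 𝓗)] G) {i : ι} (hGi : B i =ᵐ[μ] G)
    {ε : ℝ} (hε : 0 < ε) :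
    ∃ S : Finset ι, (S : Set ι) ⊆ 𝓗 ∧ condVal (setEntropy μ B) {i} S < ε := by
  obtain ⟨δ, hδ, hsplit⟩ := exists_splitEntropy_lt (half_pos hε)
  obtain ⟨S, A, hS, hd, hA, hAδ⟩ := exists_determined_approx μ hB 𝓗 hG hδ
  have hAδ' : μ.real (symmDiff A (B i)) < δ := by
    rwa [measureReal_congr ((ae_eq_refl A).symmDiff hGi)]
  refine ⟨S, hS, ?_⟩
  refine lt_of_le_of_lt ((condVal_singleton_le μ hB S i).trans
    (entropyGain_le_of_determined μ hB hd i)) ?_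
  have hone : ∀ A : Set Ω, μ.real (A ∩ B i) + μ.real (A \ B i) ≤ 1 := fun A => by
    rw [measureReal_inter_add_sdiff (hB i)]
    exact measureReal_le_one
  have h1 := hsplit _ _ measureReal_nonneg measureReal_nonneg (hone A)
    (lt_of_le_of_lt (measureReal_mono fun x hx => Or.inl hx) hAδ')
  have h2 := hsplit (μ.real (Aᶜ \ B i)) (μ.real (Aᶜ ∩ B i)) measureReal_nonneg measureReal_nonneg
    (by rw [add_comm]; exact hone Aᶜ)
    (lt_of_le_of_lt (measureReal_mono fun x hx => Or.inr ⟨hx.2, hx.1⟩) hAδ')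
  rw [splitEntropy_comm (μ.real (Aᶜ ∩ B i))]
  linarith

end

section
variable {X : Type*} [MetricSpace X] [MeasurableSpace X] [BorelSpace X] [CompactSpace X]

/-- The `σ`-algebra generated by the sets `T^{-t} B_j` for `(t - m, j) ∈ 𝓗`. -/
abbrev futureAlg (T : X ≃ₜ X) (B : ℕ → Set X) (𝓗 : Set (ℤ × ℕ)) (m : ℤ) : MeasurableSpace X :=
  MeasurableSpace.generateFrom (dynSets T B '' (timeShift m '' 𝓗))

/-- An invariant measure with a countable basis and a future that does not determine the
present. -/
structure FutureSystem (T : X ≃ₜ X) (μ : Measure X) (B : ℕ → Set X) (𝓗 : Set (ℤ × ℕ)) : Prop where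
  prob : IsProbabilityMeasure μ
  inv : MeasurePreserving T μ μ
  isOpen : ∀ j, IsOpen (B j)
  basis : ∀ (x : X) (U : Set X), IsOpen U → x ∈ U → ∃ j, x ∈ B j ∧ B j ⊆ U
  up : ∀ t j, (t, j) ∈ 𝓗 → (t + 1, j) ∈ 𝓗
  ray : ∀ j, ∃ R : ℤ, ∀ t, R ≤ t → (t, j) ∈ 𝓗
  nontrivial : ∃ j, ∀ G, MeasurableSet[futureAlg T B 𝓗 0] G → ¬ B j =ᵐ[μ] G

theorem exists_futureSystem (T : X ≃ₜ X) (hent : 0 < Dynamics.coverEntropy T Set.univ) :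
    ∃ (μ : Measure X) (B : ℕ → Set X) (𝓗 : Set (ℤ × ℕ)), FutureSystem T μ B 𝓗 := by
  obtain ⟨μ, hprob, hinv, h, hh, r, C, hC, hpos⟩ := exists_measure T hent
  obtain ⟨b, hbc, -, hb⟩ := TopologicalSpace.exists_countable_basis X
  obtain ⟨U, hU⟩ := (hbc.insert ∅).exists_eq_range (Set.insert_nonempty _ _)
  have hUo : ∀ k, IsOpen (U k) := by
    intro k
    have : U k ∈ insert ∅ b := hU ▸ Set.mem_range_self k
    rcases this with h | h
    · rw [h]; exact isOpen_empty
    · exact hb.isOpen h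
  let B : ℕ → Set X := fun j => if j < r then C j else U (j - r)
  have hBo : ∀ j, IsOpen (B j) := by
    intro j
    simp only [B]
    split_ifs
    · exact hC j
    · exact hUo _
  have hB : ∀ j, MeasurableSet (B j) := fun j => (hBo j).measurableSet
  have hst := isStationary_setEntropy hinv hB
  obtain ⟨𝓗, hup, hray, hcond⟩ := exists_future hst hh
    (hpos B fun j hj => by simp [B, hj])
  refine ⟨μ, B, 𝓗, hprob, hinv, hBo, ?_, hup, hray, ?_⟩
  · intro x V hV hx
    obtain ⟨W, hW, hxW, hWV⟩ := hb.exists_subset_of_mem_open hx hV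
    obtain ⟨k, rfl⟩ : W ∈ Set.range U := hU ▸ Set.mem_insert_of_mem _ hW
    exact ⟨r + k, by simpa [B] using hxW, by simpa [B] using hWV⟩
  · by_contra! hcon
    have hBm := measurableSet_dynSets T hB
    have h1 : ∀ j : ℕ, ∃ S : Finset (ℤ × ℕ), (S : Set (ℤ × ℕ)) ⊆ 𝓗 ∧
        condVal (setEntropy μ (dynSets T B)) {((0 : ℤ), j)} S < h / (2 * (r + 1)) := by
      intro j
      obtain ⟨G, hG, hjG⟩ := hcon j
      have e : timeShift 0 '' 𝓗 = 𝓗 := by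
        have : ⇑(timeShift 0) = id := by ext p <;> simp [timeShift]
        rw [this, Set.image_id]
      rw [futureAlg, e] at hG
      exact exists_condVal_lt_of_ae_eq μ hBm 𝓗 hG
        (show dynSets T B (0, j) =ᵐ[μ] G from hjG) (by positivity)
    choose S hS𝓗 hS using h1
    have h2 := hcond ((Finset.range r).biUnion S) (by
      simp only [Finset.coe_biUnion, Set.iUnion_subset_iff]
      exact fun j _ => hS𝓗 j)
    have h3 := condVal_le_sum hst.poly (block 0 1 r) ((Finset.range r).biUnion S)
    have h4 : ∑ p ∈ block 0 1 r, condVal (setEntropy μ (dynSets T B)) {p}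
        ((Finset.range r).biUnion S) ≤ ∑ p ∈ block 0 1 r, h / (2 * (r + 1)) := by
      refine Finset.sum_le_sum fun p hp => ?_
      rw [mem_block] at hp
      obtain ⟨t, j⟩ := p
      obtain rfl : t = 0 := by simp only at hp; omega
      refine (condVal_antitone hst.poly _ ?_).trans (hS j).le
      exact Finset.subset_biUnion_of_mem S (Finset.mem_range.2 hp.2)
    have h5 : (block 0 1 r).card = r := by simp [block]
    rw [Finset.sum_const, h5, nsmul_eq_mul] at h4
    have h6 : (r : ℝ) * (h / (2 * (r + 1))) < h / 2 := by
      rw [mul_div_assoc', div_lt_div_iff₀ (by positivity) (by positivity)]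
      nlinarith
    linarith

end

section
variable {X : Type*} [MetricSpace X] [mX : MeasurableSpace X] [BorelSpace X] [CompactSpace X]

/-- An invariant measure together with a decreasing family of `σ`-algebras, shifted by the dynamics,
generated by members of a countable family of open sets, whose atoms are asymptotic classes. -/
structure TailSystem {ι : Type*} (T : X ≃ₜ X) (μ : Measure X) (𝓕 : ℤ → MeasurableSpace X)
    (Q : ι → Set X) : Prop where
  prob : IsProbabilityMeasure μ
  inv : MeasurePreserving T μ μ
  isOpen : ∀ p, IsOpen (Q p)
  basis : ∀ (x : X) (U : Set X), IsOpen U → x ∈ U → ∃ p, x ∈ Q p ∧ Q p ⊆ U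
  shift_Q : ∀ (s : ℤ) p, ∃ q, Q q = ⇑(T ^ s) ⁻¹' Q p
  le : ∀ m, 𝓕 m ≤ mX
  anti : Antitone 𝓕
  shift : ∀ (m s : ℤ) (A : Set X), MeasurableSet[𝓕 m] A →
    MeasurableSet[𝓕 (m + s)] (⇑(T ^ s) ⁻¹' A)
  sup : mX ≤ ⨆ m, 𝓕 m
  gen : ∀ m, ∃ S : Set ι, 𝓕 m = MeasurableSpace.generateFrom (Q '' S) ∧
    ∀ x y, (∀ p ∈ S, (x ∈ Q p ↔ y ∈ Q p)) →
      Tendsto (fun t : ℤ => dist ((T ^ t) x) ((T ^ t) y)) atTop (𝓝 0)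
  nontrivial : ∃ p, ∀ G, MeasurableSet[⨅ m, 𝓕 m] G → ¬ Q p =ᵐ[μ] G

variable {T : X ≃ₜ X} {μ : Measure X} {B : ℕ → Set X} {𝓗 : Set (ℤ × ℕ)}

lemma FutureSystem.up_add (h : FutureSystem T μ B 𝓗) {t : ℤ} {j : ℕ} (ht : (t, j) ∈ 𝓗) (k : ℕ) :
    (t + k, j) ∈ 𝓗 := by
  induction k with
  | zero => simpa using ht
  | succ k ih =>
    have := h.up _ _ ih
    rwa [add_assoc] at this

lemma FutureSystem.asymptotic (h : FutureSystem T μ B 𝓗) (m : ℤ) {x y : X}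
    (hxy : ∀ p ∈ timeShift m '' 𝓗, (x ∈ dynSets T B p ↔ y ∈ dynSets T B p)) :
    Tendsto (fun t : ℤ => dist ((T ^ t) x) ((T ^ t) y)) atTop (𝓝 0) := by
  rw [Metric.tendsto_nhds]
  intro ε hε
  choose j hj hjU using fun z : X =>
    h.basis z (Metric.ball z (ε / 2)) Metric.isOpen_ball (Metric.mem_ball_self (half_pos hε))
  obtain ⟨J, hJ⟩ := isCompact_univ.elim_finite_subcover (fun z => B (j z)) (fun z => h.isOpen _)
    fun z _ => Set.mem_iUnion.2 ⟨z, hj z⟩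
  choose R hR using h.ray
  have hev : ∀ᶠ t : ℤ in atTop, ∀ z ∈ J, R (j z) + m ≤ t :=
    (Filter.eventually_all_finset J).2 fun z _ => eventually_ge_atTop _
  filter_upwards [hev] with t ht
  obtain ⟨z, hz, hxz⟩ := Set.mem_iUnion₂.1 (hJ (Set.mem_univ ((T ^ t) x)))
  have hmem : ((t, j z) : ℤ × ℕ) ∈ timeShift m '' 𝓗 :=
    ⟨(t - m, j z), hR _ _ (by linarith [ht z hz]), by simp⟩
  have hyz : (T ^ t) y ∈ B (j z) := (hxy _ hmem).1 hxz
  have h1 := hjU z hxz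
  have h2 := hjU z hyz
  rw [Metric.mem_ball] at h1 h2
  rw [dist_zero_right, Real.norm_of_nonneg dist_nonneg]
  linarith [dist_triangle_right ((T ^ t) x) ((T ^ t) y) z]

lemma FutureSystem.tailSystem (h : FutureSystem T μ B 𝓗) :
    TailSystem T μ (futureAlg T B 𝓗) (dynSets T B) where
  prob := h.prob
  inv := h.inv
  isOpen p := (h.isOpen p.2).preimage (T ^ p.1).continuous
  basis x U hU hx := by
    obtain ⟨j, hj, hjU⟩ := h.basis x U hU hx
    exact ⟨(0, j), hj, hjU⟩
  shift_Q s p := ⟨timeShift s p, (preimage_dynSets T B s p).symm⟩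
  le m := MeasurableSpace.generateFrom_le (by
    rintro _ ⟨p, _, rfl⟩
    exact measurableSet_dynSets T (fun j => (h.isOpen j).measurableSet) p)
  anti := by
    intro m m' hm
    refine MeasurableSpace.generateFrom_mono (Set.image_mono ?_)
    rintro _ ⟨⟨t, j⟩, ht, rfl⟩
    obtain ⟨k, hk⟩ := Int.le.dest hm
    refine ⟨(t + k, j), h.up_add ht k, ?_⟩
    simp only [timeShift_apply, Prod.mk.injEq, and_true]
    omega
  shift m s A hA := by
    have hle : futureAlg T B 𝓗 m ≤ (futureAlg T B 𝓗 (m + s)).map ⇑(T ^ s) := by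
      refine MeasurableSpace.generateFrom_le ?_
      rintro _ ⟨_, ⟨⟨t, j⟩, ht, rfl⟩, rfl⟩
      refine MeasurableSpace.measurableSet_generateFrom ?_
      rw [preimage_dynSets]
      exact ⟨_, ⟨(t, j), ht, by simp [add_assoc]⟩, rfl⟩
    exact hle A hA
  sup := by
    have hb : TopologicalSpace.IsTopologicalBasis (Set.range B) :=
      TopologicalSpace.isTopologicalBasis_of_isOpen_of_nhds (by
        rintro _ ⟨j, rfl⟩; exact h.isOpen j) (by
        intro x U hx hU
        obtain ⟨j, hj, hjU⟩ := h.basis x U hU hx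
        exact ⟨_, ⟨j, rfl⟩, hj, hjU⟩)
    rw [BorelSpace.measurable_eq (α := X), hb.borel_eq_generateFrom]
    refine MeasurableSpace.generateFrom_le ?_
    rintro _ ⟨j, rfl⟩
    obtain ⟨R, hR⟩ := h.ray j
    refine (le_iSup (futureAlg T B 𝓗) (-R)) _ (MeasurableSpace.measurableSet_generateFrom ?_)
    exact ⟨(0, j), ⟨(R, j), hR R le_rfl, by simp⟩, rfl⟩
  gen m := ⟨timeShift m '' 𝓗, rfl, fun x y hxy => h.asymptotic m hxy⟩
  nontrivial := by
    obtain ⟨j, hj⟩ := h.nontrivial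
    exact ⟨(0, j), fun G hG => hj G (iInf_le (futureAlg T B 𝓗) 0 G hG)⟩

theorem exists_tailSystem (T : X ≃ₜ X) (hent : 0 < Dynamics.coverEntropy T Set.univ) :
    ∃ (μ : Measure X) (𝓕 : ℤ → MeasurableSpace X) (Q : ℤ × ℕ → Set X), TailSystem T μ 𝓕 Q := by
  obtain ⟨μ, B, 𝓗, h⟩ := exists_futureSystem T hent
  exact ⟨μ, _, _, h.tailSystem⟩

end

section
variable {Ω : Type*} [mΩ : MeasurableSpace Ω] {μ : Measure Ω} [IsProbabilityMeasure μ]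

lemma exists_tendsto_condExp {𝓖 : ℕ → MeasurableSpace Ω} (h𝓖 : Antitone 𝓖) (hle : ∀ n, 𝓖 n ≤ mΩ)
    {f : Ω → ℝ} (hf : MemLp f 2 μ) :
    ∃ g : Ω → ℝ, MemLp g 2 μ ∧ Tendsto (fun n => eLpNorm (μ[f | 𝓖 n] - g) 2 μ) atTop (𝓝 0) := by
  have : ∀ n, Fact (𝓖 n ≤ mΩ) := fun n => ⟨hle n⟩
  let K : ℕ → Submodule ℝ (Lp ℝ 2 μ) := fun n => lpMeas ℝ ℝ (𝓖 n) 2 μ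
  have : ∀ n, (K n).HasOrthogonalProjection := fun n => by
    have : CompleteSpace (K n) := inferInstanceAs (CompleteSpace (lpMeas ℝ ℝ (𝓖 n) 2 μ))
    infer_instance
  have hK : Monotone fun n => (K n)ᗮ := by
    intro n n' hn
    refine Submodule.orthogonal_le ?_
    intro x hx
    obtain ⟨y, hy, hxy⟩ := mem_lpMeas_iff_aestronglyMeasurable.1 hx
    exact mem_lpMeas_iff_aestronglyMeasurable.2 ⟨y, hy.mono (h𝓖 hn), hxy⟩
  have hlim := Submodule.starProjection_tendsto_closure_iSup (fun n => (K n)ᗮ) hK hf.toLp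
  set z := (⨆ n, (K n)ᗮ).topologicalClosure.starProjection hf.toLp
  refine ⟨⇑(hf.toLp - z), Lp.memLp _, ?_⟩
  have hlim2 : Tendsto (fun n => (K n).starProjection hf.toLp) atTop (𝓝 (hf.toLp - z)) := by
    have : (fun n => (K n).starProjection hf.toLp) =
        fun n => hf.toLp - (K n)ᗮ.starProjection hf.toLp := by
      ext1 n
      rw [Submodule.starProjection_orthogonal_val]
      abel
    rw [this]
    exact hlim.const_sub _
  rw [Lp.tendsto_Lp_iff_tendsto_eLpNorm'] at hlim2
  refine hlim2.congr fun n => eLpNorm_congr_ae ?_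
  have h1 : ((K n).starProjection hf.toLp : Ω → ℝ) =ᵐ[μ] μ[f | 𝓖 n] :=
    MemLp.condExpL2_ae_eq_condExp (𝕜 := ℝ) (hle n) hf
  filter_upwards [h1] with x hx
  simp only [Pi.sub_apply, hx]

lemma measurable_limsup_iInf {𝓖 : ℕ → MeasurableSpace Ω} (h𝓖 : Antitone 𝓖) {ns : ℕ → ℕ}
    (hns : StrictMono ns) {u : ℕ → Ω → ℝ} (hu : ∀ n, Measurable[𝓖 n] (u n)) :
    Measurable[⨅ n, 𝓖 n] fun x => limsup (fun k => u (ns k) x) atTop := by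
  intro A hA
  rw [MeasurableSpace.measurableSet_iInf]
  intro n
  have h1 : (fun x => limsup (fun k => u (ns k) x) atTop) =
      fun x => limsup (fun k => u (ns (k + n)) x) atTop := by
    ext x
    exact (limsup_nat_add (fun k => u (ns k) x) n).symm
  rw [h1]
  refine Measurable.limsup (mδ := 𝓖 n) (fun k => ?_) hA
  have : n ≤ ns (k + n) := le_trans (Nat.le_add_left n k) (hns.id_le _)
  exact (hu _).mono (h𝓖 this) le_rfl

/-- Convergence of conditional expectations along a decreasing sequence of `σ`-algebras. -/
theorem tendsto_condExp_iInf {𝓖 : ℕ → MeasurableSpace Ω} (h𝓖 : Antitone 𝓖) (hle : ∀ n, 𝓖 n ≤ mΩ)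
    {f : Ω → ℝ} (hf : MemLp f 2 μ) :
    Tendsto (fun n => ∫ x, |(μ[f | 𝓖 n]) x - (μ[f | ⨅ n, 𝓖 n]) x| ∂μ) atTop (𝓝 0) := by
  have hle' : ⨅ n, 𝓖 n ≤ mΩ := (iInf_le 𝓖 0).trans (hle 0)
  have hfi : Integrable f μ := hf.integrable (by norm_num)
  obtain ⟨g, hgL, hg⟩ := exists_tendsto_condExp h𝓖 hle hf
  have hgi : Integrable g μ := hgL.integrable (by norm_num)
  have hL1 : Tendsto (fun n => ∫ x, |(μ[f | 𝓖 n]) x - g x| ∂μ) atTop (𝓝 0) := by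
    have h1 : ∀ n, ∫ x, |(μ[f | 𝓖 n]) x - g x| ∂μ = (eLpNorm (μ[f | 𝓖 n] - g) 1 μ).toReal := by
      intro n
      rw [eLpNorm_one_eq_lintegral_enorm,
        ← integral_norm_eq_lintegral_enorm (integrable_condExp.sub hgi).aestronglyMeasurable]
      rfl
    simp only [h1]
    have h2 : Tendsto (fun n => eLpNorm (μ[f | 𝓖 n] - g) 1 μ) atTop (𝓝 0) :=
      tendsto_of_tendsto_of_tendsto_of_le_of_le tendsto_const_nhds hg (fun n => zero_le)
        fun n => eLpNorm_le_eLpNorm_of_exponent_le one_le_two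
          (integrable_condExp.sub hgi).aestronglyMeasurable
    simpa [Function.comp_def] using (ENNReal.tendsto_toReal ENNReal.zero_ne_top).comp h2
  have hmeas : TendstoInMeasure μ (fun n => μ[f | 𝓖 n]) atTop g :=
    tendstoInMeasure_of_tendsto_eLpNorm two_ne_zero
      (fun n => integrable_condExp.aestronglyMeasurable) hgi.aestronglyMeasurable hg
  obtain ⟨ns, hns, hae⟩ := hmeas.exists_seq_tendsto_ae
  have hgm : AEStronglyMeasurable[⨅ n, 𝓖 n] g μ := by
    refine ⟨fun x => limsup (fun k => (μ[f | 𝓖 (ns k)]) x) atTop,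
      (measurable_limsup_iInf h𝓖 hns fun n =>
        stronglyMeasurable_condExp.measurable).stronglyMeasurable, ?_⟩
    filter_upwards [hae] with x hx using hx.limsup_eq.symm
  have hgeq : g =ᵐ[μ] μ[f | ⨅ n, 𝓖 n] := by
    refine ae_eq_condExp_of_forall_setIntegral_eq hle' hfi (fun s _ _ => hgi.integrableOn)
      (fun s hs _ => ?_) hgm
    have hc : Tendsto (fun n => ∫ x in s, (μ[f | 𝓖 n]) x ∂μ) atTop (𝓝 (∫ x in s, g x ∂μ)) := by
      rw [tendsto_iff_dist_tendsto_zero]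
      refine squeeze_zero (fun _ => dist_nonneg) (fun n => ?_) hL1
      rw [Real.dist_eq, ← integral_sub integrable_condExp.integrableOn hgi.integrableOn]
      refine (abs_integral_le_integral_abs).trans ?_
      exact setIntegral_le_integral (integrable_condExp.sub hgi).abs
        (ae_of_all _ fun x => abs_nonneg _)
    refine tendsto_nhds_unique hc (tendsto_const_nhds.congr fun n => ?_)
    rw [setIntegral_condExp (hle n) hfi ((iInf_le 𝓖 n) _ hs)]
  refine hL1.congr fun n => integral_congr_ae ?_
  filter_upwards [hgeq] with x hx
  rw [hx]

end

section
variable {Ω : Type*} {𝓖 : MeasurableSpace Ω} (m : MeasurableSpace Ω) [mΩ : MeasurableSpace Ω]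
  [StandardBorelSpace Ω] (μ : Measure Ω) [IsProbabilityMeasure μ]

/-- The conditional probability of the set `U` given the `σ`-algebra `m`, as a function. -/
noncomputable def condMeas (U : Set Ω) (y : Ω) : ℝ := (ProbabilityTheory.condExpKernel μ m y).real U

lemma condMeas_nonneg (U : Set Ω) (y : Ω) : 0 ≤ condMeas m μ U y := measureReal_nonneg

lemma condMeas_le_one (U : Set Ω) (y : Ω) : condMeas m μ U y ≤ 1 := measureReal_le_one

lemma condMeas_mono {U V : Set Ω} (h : U ⊆ V) (y : Ω) : condMeas m μ U y ≤ condMeas m μ V y :=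
  measureReal_mono h

variable {m} {U V : Set Ω}

lemma measurable_condMeas (hU : MeasurableSet U) : Measurable[m] (condMeas m μ U) :=
  Measurable.ennreal_toReal (mα := m) (ProbabilityTheory.measurable_condExpKernel hU)

lemma measurable_condMeas' (hm : m ≤ mΩ) (hU : MeasurableSet U) : Measurable (condMeas m μ U) :=
  (measurable_condMeas μ hU).mono hm le_rfl

lemma integrable_of_abs_le_one {f : Ω → ℝ} (hf : Measurable f) (h : ∀ x, |f x| ≤ 1) :
    Integrable f μ :=
  Integrable.of_bound hf.aestronglyMeasurable 1 (ae_of_all _ h)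

lemma abs_condMeas_le_one (U : Set Ω) (y : Ω) : |condMeas m μ U y| ≤ 1 := by
  rw [abs_of_nonneg (condMeas_nonneg m μ U y)]
  exact condMeas_le_one m μ U y

lemma integrable_condMeas (hm : m ≤ mΩ) (hU : MeasurableSet U) : Integrable (condMeas m μ U) μ :=
  integrable_of_abs_le_one μ (measurable_condMeas' μ hm hU) (abs_condMeas_le_one μ U)

lemma condMeas_ae_eq (hm : m ≤ mΩ) (hU : MeasurableSet U) :
    condMeas m μ U =ᵐ[μ] μ[U.indicator fun _ => (1 : ℝ) | m] :=
  ProbabilityTheory.condExpKernel_ae_eq_condExp hm hU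

lemma memLp_indicator_one (hU : MeasurableSet U) : MemLp (U.indicator fun _ => (1 : ℝ)) 2 μ :=
  memLp_indicator_const 2 hU 1 (Or.inr (measure_ne_top μ U))

lemma integrable_indicator_one (hU : MeasurableSet U) :
    Integrable (U.indicator fun _ => (1 : ℝ)) μ :=
  (memLp_indicator_one μ hU).integrable (by norm_num)

lemma setIntegral_condMeas (hm : m ≤ mΩ) (hU : MeasurableSet U) {G : Set Ω}
    (hG : MeasurableSet[m] G) : ∫ y in G, condMeas m μ U y ∂μ = μ.real (U ∩ G) := by
  rw [setIntegral_congr_ae (g := μ[U.indicator fun _ => (1 : ℝ) | m]) (hm _ hG)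
    ((condMeas_ae_eq μ hm hU).mono fun x hx _ => hx),
    setIntegral_condExp hm (integrable_indicator_one μ hU) hG, integral_indicator hU,
    setIntegral_const, smul_eq_mul, mul_one, measureReal_restrict_apply' (hm _ hG)]

lemma condMeas_ae_eq_indicator (hm : m ≤ mΩ) (hU : MeasurableSet[m] U) :
    condMeas m μ U =ᵐ[μ] U.indicator fun _ => (1 : ℝ) := by
  refine (condMeas_ae_eq μ hm (hm _ hU)).trans ?_
  rw [condExp_of_stronglyMeasurable hm ((stronglyMeasurable_const).indicator hU)
    (integrable_indicator_one μ (hm _ hU))]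

lemma abs_condMeas_sub_le (y : Ω) (hU : MeasurableSet U) (hV : MeasurableSet V) :
    |condMeas m μ U y - condMeas m μ V y| ≤ condMeas m μ (symmDiff U V) y :=
  abs_measureReal_sub_le_measureReal_symmDiff hU.nullMeasurableSet hV.nullMeasurableSet

lemma integral_condMeas (hm : m ≤ mΩ) (hU : MeasurableSet U) :
    ∫ y, condMeas m μ U y ∂μ = μ.real U := by
  rw [← setIntegral_univ, setIntegral_condMeas μ hm hU MeasurableSet.univ, Set.inter_univ]

lemma integral_abs_condMeas_sub_le (hm : m ≤ mΩ) (hU : MeasurableSet U) (hV : MeasurableSet V) :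
    ∫ y, |condMeas m μ U y - condMeas m μ V y| ∂μ ≤ μ.real (symmDiff U V) := by
  rw [← integral_condMeas μ hm (hU.symmDiff hV)]
  exact integral_mono ((integrable_condMeas μ hm hU).sub (integrable_condMeas μ hm hV)).abs
    (integrable_condMeas μ hm (hU.symmDiff hV)) fun y => abs_condMeas_sub_le μ y hU hV

/-- Asymptotic independence of `U` and a set `C` that is measurable for a larger `σ`-algebra. -/
lemma integral_abs_condMeas_inter_sub_le (hm : m ≤ 𝓖) (h𝓖 : 𝓖 ≤ mΩ)
    (hU : MeasurableSet U) {C : Set Ω} (hC : MeasurableSet[𝓖] C) :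
    ∫ y, |condMeas m μ (U ∩ C) y - condMeas m μ U y * condMeas m μ C y| ∂μ ≤
      ∫ y, |(μ[U.indicator fun _ => (1 : ℝ) | 𝓖]) y - (μ[U.indicator fun _ =>
          (1 : ℝ) | m]) y| ∂μ := by
  have hm' := hm.trans h𝓖
  have hC' := h𝓖 _ hC
  set u : Ω → ℝ := U.indicator fun _ => (1 : ℝ) with hu
  set w : Ω → ℝ := C.indicator fun _ => (1 : ℝ) with hw
  have hui := integrable_indicator_one μ hU
  have hwi := integrable_indicator_one μ hC'
  have huw : (U ∩ C).indicator (fun _ => (1 : ℝ)) = u * w := by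
    ext x
    by_cases h1 : x ∈ U <;> by_cases h2 : x ∈ C <;> simp [hu, hw, h1, h2]
  have hbd : ∀ g : Ω → ℝ, Integrable g μ → Integrable (g * w) μ := fun g hg => by
    refine Integrable.mul_bdd hg hwi.aestronglyMeasurable (c := 1) (ae_of_all _ fun x => ?_)
    by_cases h2 : x ∈ C <;> simp [hw, h2]
  have h1 : condMeas m μ (U ∩ C) =ᵐ[μ] μ[μ[u | 𝓖] * w | m] := by
    refine (condMeas_ae_eq μ hm' (hU.inter hC')).trans ?_
    rw [huw]
    refine (condExp_condExp_of_le hm h𝓖).symm.trans (condExp_congr_ae ?_)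
    exact condExp_mul_of_stronglyMeasurable_right (stronglyMeasurable_const.indicator hC)
      (hbd u hui) hui
  have h2 : condMeas m μ U * condMeas m μ C =ᵐ[μ] μ[μ[u | m] * w | m] := by
    refine ((condMeas_ae_eq μ hm' hU).mul (condMeas_ae_eq μ hm' hC')).trans ?_
    exact (condExp_mul_of_stronglyMeasurable_left stronglyMeasurable_condExp
      (hbd _ integrable_condExp) hwi).symm
  have h3 : (fun y => |condMeas m μ (U ∩ C) y - condMeas m μ U y * condMeas m μ C y|) =ᵐ[μ]
      fun y => |(μ[μ[u | 𝓖] * w - μ[u | m] * w | m]) y| := by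
    filter_upwards [h1, h2, condExp_sub (hbd _ integrable_condExp) (hbd _ integrable_condExp) m]
      with y hy1 hy2 hy3
    rw [hy3, Pi.sub_apply, hy1, ← hy2, Pi.mul_apply]
  rw [integral_congr_ae h3]
  refine (integral_abs_condExp_le _).trans (integral_mono ?_ ?_ fun y => ?_)
  · exact ((hbd _ integrable_condExp).sub (hbd _ integrable_condExp)).abs
  · exact (integrable_condExp.sub integrable_condExp).abs
  · simp only [Pi.sub_apply, Pi.mul_apply, ← sub_mul, abs_mul]
    refine mul_le_of_le_one_right (abs_nonneg _) ?_
    by_cases h2 : y ∈ C <;> simp [hw, h2]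

end

section
variable {X : Type*} [MetricSpace X] [mX : MeasurableSpace X] [BorelSpace X] [CompactSpace X]
variable {ι : Type*} {T : X ≃ₜ X} {μ : Measure X} {𝓕 : ℤ → MeasurableSpace X} {Q : ι → Set X}

namespace TailSystem

lemma iInf_le' (h : TailSystem T μ 𝓕 Q) : ⨅ m, 𝓕 m ≤ mX := (iInf_le 𝓕 0).trans (h.le 0)

lemma measurableSet (h : TailSystem T μ 𝓕 Q) (p : ι) : MeasurableSet (Q p) :=
    (h.isOpen p).measurableSet

lemma measurePreserving (h : TailSystem T μ 𝓕 Q) (s : ℤ) : MeasurePreserving ⇑(T ^ s) μ μ :=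
    measurePreserving_zpow h.inv s

lemma measurableSet_preimage (h : TailSystem T μ 𝓕 Q) {A : Set X} (hA : MeasurableSet A) (s : ℤ) :
    MeasurableSet (⇑(T ^ s) ⁻¹' A) := (h.measurePreserving s).measurable hA

lemma shift_iInf (h : TailSystem T μ 𝓕 Q) (s : ℤ) {A : Set X} (hA : MeasurableSet[⨅ m, 𝓕 m] A) :
    MeasurableSet[⨅ m, 𝓕 m] (⇑(T ^ s) ⁻¹' A) := by
  rw [MeasurableSpace.measurableSet_iInf] at hA ⊢
  intro m
  have := h.shift (m - s) s A (hA _)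
  rwa [sub_add_cancel] at this

lemma condMeas_preimage (h : TailSystem T μ 𝓕 Q) [IsProbabilityMeasure μ] (s : ℤ) {A : Set X}
    (hA : MeasurableSet A) :
    condMeas (⨅ m, 𝓕 m) μ (⇑(T ^ s) ⁻¹' A) =ᵐ[μ] fun y => condMeas (⨅ m, 𝓕 m) μ A ((T ^ s) y) := by
  have hle := h.iInf_le'
  have hA' := h.measurableSet_preimage hA s
  refine (condMeas_ae_eq μ hle hA').trans (Filter.EventuallyEq.symm ?_)
  have hmeas := measurable_condMeas (m := ⨅ m, 𝓕 m) μ hA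
  have hcomp : Measurable[⨅ m, 𝓕 m] fun y => condMeas (⨅ m, 𝓕 m) μ A ((T ^ s) y) :=
    fun V hV => h.shift_iInf s (hmeas hV)
  have hint : Integrable (fun y => condMeas (⨅ m, 𝓕 m) μ A ((T ^ s) y)) μ :=
    integrable_of_abs_le_one μ (hcomp.mono hle le_rfl) fun y => abs_condMeas_le_one μ A _
  refine ae_eq_condExp_of_forall_setIntegral_eq hle (integrable_indicator_one μ hA')
    (fun G _ _ => hint.integrableOn)
        (fun G hG _ => ?_) hcomp.stronglyMeasurable.aestronglyMeasurable
  have hGs : ⇑(T ^ s) ⁻¹' (⇑(T ^ (-s)) ⁻¹' G) = G := by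
    ext x
    simp only [Set.mem_preimage]
    rw [← zpow_apply_add, neg_add_cancel]
    simp
  have hG' := h.shift_iInf (-s) hG
  rw [integral_indicator hA', setIntegral_const, smul_eq_mul, mul_one,
    measureReal_restrict_apply' (hle _ hG)]
  conv_lhs => rw [← hGs]
  rw [(h.measurePreserving s).setIntegral_preimage_emb (T ^ s).measurableEmbedding
    (fun y => condMeas (⨅ m, 𝓕 m) μ A y), setIntegral_condMeas μ hle hA hG']
  rw [← (h.measurePreserving s).measureReal_preimage (hA.inter (hle _ hG')).nullMeasurableSet,
    Set.preimage_inter, hGs]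

lemma exists_approx (h : TailSystem T μ 𝓕 Q) [IsProbabilityMeasure μ] {A : Set X}
    (hA : MeasurableSet A) {ε : ℝ}
    (hε : 0 < ε) : ∃ (k : ℤ) (A' : Set X), MeasurableSet[𝓕 k] A' ∧ μ.real (symmDiff A' A) < ε := by
  let R : Set (Set X) := {A | ∃ k, MeasurableSet[𝓕 k] A}
  have hR : IsSetRing R := by
    refine ⟨⟨0, @MeasurableSet.empty _ (𝓕 0)⟩, ?_, ?_⟩
    · rintro A A' ⟨k, hk⟩ ⟨k', hk'⟩
      exact ⟨min k k', MeasurableSet.union (h.anti (min_le_left _ _) _ hk)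
        (h.anti (min_le_right _ _) _ hk')⟩
    · rintro A A' ⟨k, hk⟩ ⟨k', hk'⟩
      exact ⟨min k k', MeasurableSet.diff (h.anti (min_le_left _ _) _ hk)
        (h.anti (min_le_right _ _) _ hk')⟩
  have hgen : mX = MeasurableSpace.generateFrom R := by
    apply le_antisymm
    · refine h.sup.trans (iSup_le fun k A hA => ?_)
      exact MeasurableSpace.measurableSet_generateFrom ⟨k, hA⟩
    · exact MeasurableSpace.generateFrom_le fun A ⟨k, hk⟩ => h.le k _ hk
  obtain ⟨A', ⟨k, hk⟩, hA'⟩ := exists_measure_symmDiff_lt_of_generateFrom_isSetRing (μ := μ) hR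
    ⟨{Set.univ}, by simp, by
      rintro _ rfl; exact ⟨0, @MeasurableSet.univ _ (𝓕 0)⟩, by simp⟩
    hgen hA (ε := ENNReal.ofReal ε) (by simpa using hε)
  exact ⟨k, A', hk, ENNReal.toReal_lt_of_lt_ofReal hA'⟩

lemma iInf_nat (h : TailSystem T μ 𝓕 Q) : ⨅ n : ℕ, 𝓕 n = ⨅ m : ℤ, 𝓕 m := by
  refine le_antisymm (le_iInf fun m => ?_) (le_iInf fun n => iInf_le 𝓕 n)
  exact (iInf_le (fun n : ℕ => 𝓕 n) m.toNat).trans (h.anti (Int.self_le_toNat m))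

lemma tendsto_condExp (h : TailSystem T μ 𝓕 Q) [IsProbabilityMeasure μ] {U : Set X}
    (hU : MeasurableSet U) :
    Tendsto (fun n : ℤ => ∫ y, |(μ[U.indicator fun _ => (1 : ℝ) | 𝓕 n]) y -
      (μ[U.indicator fun _ => (1 : ℝ) | ⨅ m, 𝓕 m]) y| ∂μ) atTop (𝓝 0) := by
  have h1 := tendsto_condExp_iInf (𝓖 := fun n : ℕ => 𝓕 n) (μ := μ)
    (fun a b hab => h.anti (by exact_mod_cast hab)) (fun n => h.le n) (memLp_indicator_one μ hU)
  rw [h.iInf_nat] at h1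
  have h2 : Tendsto Int.toNat atTop atTop := tendsto_atTop.2 fun n =>
    (eventually_ge_atTop (n : ℤ)).mono fun m hm => by omega
  refine (h1.comp h2).congr' ?_
  filter_upwards [eventually_ge_atTop (0 : ℤ)] with n hn
  simp only [Function.comp_def, Int.toNat_of_nonneg hn]

/-- Relative mixing over the tail `σ`-algebra. -/
theorem mixing (h : TailSystem T μ 𝓕 Q) [IsProbabilityMeasure μ] {U A : Set X}
    (hU : MeasurableSet U) (hA : MeasurableSet A) :
    Tendsto (fun t : ℤ => ∫ y, |condMeas (⨅ m, 𝓕 m) μ (U ∩ ⇑(T ^ t) ⁻¹' A) y -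
      condMeas (⨅ m, 𝓕 m) μ U y * condMeas (⨅ m, 𝓕 m) μ A ((T ^ t) y)| ∂μ) atTop (𝓝 0) := by
  have hle := h.iInf_le'
  rw [Metric.tendsto_nhds]
  intro ε hε
  obtain ⟨k, A', hA', hAA'⟩ := h.exists_approx (μ := μ) hA (show 0 < ε / 4 by positivity)
  have hlim : Tendsto (fun t : ℤ => ∫ y, |(μ[U.indicator fun _ => (1 : ℝ) | 𝓕 (k + t)]) y -
      (μ[U.indicator fun _ => (1 : ℝ) | ⨅ m, 𝓕 m]) y| ∂μ) atTop (𝓝 0) :=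
    (h.tendsto_condExp hU).comp (tendsto_atTop_add_const_left _ k tendsto_id)
  filter_upwards [hlim.eventually (gt_mem_nhds (show 0 < ε / 4 by positivity))] with t ht
  set q := condMeas (⨅ m, 𝓕 m) μ with hq
  set C := ⇑(T ^ t) ⁻¹' A with hCdef
  set C' := ⇑(T ^ t) ⁻¹' A' with hC'def
  have hC : MeasurableSet C := h.measurableSet_preimage hA t
  have hC' : MeasurableSet C' := h.measurableSet_preimage (h.le _ _ hA') t
  have hCC' : μ.real (symmDiff C' C) < ε / 4 := by
    rw [hCdef, hC'def, ← Set.preimage_symmDiff, (h.measurePreserving t).measureReal_preimage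
      ((h.le _ _ hA').symmDiff hA).nullMeasurableSet]
    exact hAA'
  have e1 : ∫ y, |q (U ∩ C) y - q U y * q A ((T ^ t) y)| ∂μ = ∫ y,
      |q (U ∩ C) y - q U y * q C y| ∂μ := by
    refine integral_congr_ae ?_
    filter_upwards [h.condMeas_preimage t hA] with y hy
    rw [hq, ← hy]
  have i1 := integrable_condMeas μ hle (hU.inter hC)
  have i2 := integrable_condMeas μ hle (hU.inter hC')
  have iq : ∀ {C : Set X}, MeasurableSet C → Integrable (fun y => q U y * q C y) μ := fun hC =>
    integrable_of_abs_le_one μ ((measurable_condMeas' μ hle hU).mul (measurable_condMeas' μ hle hC))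
      fun y => by
        rw [abs_mul]
        exact mul_le_one₀ (abs_condMeas_le_one μ _ _) (abs_nonneg _) (abs_condMeas_le_one μ _ _)
  have i3 : Integrable (fun y => |q (U ∩ C') y - q (U ∩ C) y|) μ := (i2.sub i1).abs
  have i4 : Integrable (fun y => |q (U ∩ C') y - q U y * q C' y|) μ := (i2.sub (iq hC')).abs
  have i5 : Integrable (fun y => |q C' y - q C y|) μ :=
    ((integrable_condMeas μ hle hC').sub (integrable_condMeas μ hle hC)).abs
  have b3 : ∫ y, |q (U ∩ C') y - q (U ∩ C) y| ∂μ < ε / 4 := by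
    refine ((integral_abs_condMeas_sub_le μ hle (hU.inter hC') (hU.inter hC)).trans
      (measureReal_mono ?_)).trans_lt hCC'
    rw [← Set.inter_symmDiff_distrib_left]
    exact Set.inter_subset_right
  have b4 := (integral_abs_condMeas_inter_sub_le μ (iInf_le 𝓕 (k + t)) (h.le _) hU
    (h.shift k t A' hA')).trans_lt ht
  have b5 := (integral_abs_condMeas_sub_le μ hle hC' hC).trans_lt hCC'
  rw [dist_zero_right, Real.norm_of_nonneg (integral_nonneg fun _ => abs_nonneg _), e1]
  have hmono : ∫ y, |q (U ∩ C) y - q U y * q C y| ∂μ ≤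
      ∫ y, (|q (U ∩ C') y - q (U ∩ C) y| + |q (U ∩ C') y - q U y * q C' y|) +
          |q C' y - q C y| ∂μ := by
    refine integral_mono (i1.sub (iq hC)).abs ((i3.add i4).add i5) fun y => ?_
    have hb : |q U y * (q C' y - q C y)| ≤ |q C' y - q C y| := by
      rw [abs_mul]
      exact mul_le_of_le_one_left (abs_nonneg _) (abs_condMeas_le_one μ _ _)
    have : q (U ∩ C) y - q U y * q C y = -(q (U ∩ C') y - q (U ∩ C) y) +
        (q (U ∩ C') y - q U y * q C' y) + q U y * (q C' y - q C y) := by ring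
    simp only
    rw [this]
    refine (abs_add_three _ _ _).trans ?_
    rw [abs_neg]
    linarith
  have hsum := integral_add (i3.add i4) i5
  simp only [Pi.add_apply] at hsum
  rw [hsum, integral_add i3 i4] at hmono
  linarith

end TailSystem
end

section
variable {X : Type*} [MetricSpace X] [mX : MeasurableSpace X] [BorelSpace X] [CompactSpace X]
variable {ι : Type*} [Countable ι]

/-- The support of `κ`, tested on the family `Q`. -/
def qSupport (κ : Measure X) (Q : ι → Set X) : Set X := {x | ∀ p, x ∈ Q p → 0 < κ.real (Q p)}

/-- The pieces of a box are at positive mutual distances. -/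
def SepBox (Q : ι → Set X) {n : ℕ} (A : Fin n → ι) : Prop :=
  ∃ δ : ℝ, 0 < δ ∧ ∀ i j, i ≠ j → ∀ x ∈ Q (A i), ∀ x' ∈ Q (A j), δ ≤ dist x x'

variable {κ : Measure X} [IsProbabilityMeasure κ] {Q : ι → Set X}

lemma measure_compl_qSupport (κ : Measure X) [IsProbabilityMeasure κ] (Q : ι → Set X) :
    κ (qSupport κ Q)ᶜ = 0 := by
  have : (qSupport κ Q)ᶜ ⊆ ⋃ p : {p // κ.real (Q p) = 0}, Q p.1 := by
    intro x hx
    simp only [qSupport, Set.mem_compl_iff, Set.mem_ofPred_eq, not_forall, not_lt] at hx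
    obtain ⟨p, hp, h0⟩ := hx
    exact Set.mem_iUnion.2 ⟨⟨p, le_antisymm h0 measureReal_nonneg⟩, hp⟩
  refine measure_mono_null this (measure_iUnion_null fun p => ?_)
  exact (measureReal_eq_zero_iff).1 p.2

lemma isClosed_qSupport (hQ : ∀ p, IsOpen (Q p)) : IsClosed (qSupport κ Q) := by
  have : qSupport κ Q = ⋂ p : {p // ¬ 0 < κ.real (Q p)}, (Q p.1)ᶜ := by
    ext x
    simp only [qSupport, Set.mem_ofPred_eq, Set.mem_iInter, Set.mem_compl_iff, Subtype.forall]
    exact forall_congr' fun p => not_imp_not.symm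
  rw [this]
  exact isClosed_iInter fun p => (hQ _).isClosed_compl

lemma exists_mem_qSupport {V : Set X} (hV : 0 < κ.real V) : ∃ x ∈ V, x ∈ qSupport κ Q := by
  by_contra! hcon
  have : κ V = 0 := measure_mono_null hcon (measure_compl_qSupport κ Q)
  rw [measureReal_def, this] at hV
  simp at hV

lemma qSupport_exists_ne (hb : ∀ (x : X) (U : Set X), IsOpen U → x ∈ U → ∃ p, x ∈ Q p ∧ Q p ⊆ U)
    (hQ : ∀ p, MeasurableSet (Q p))
    (hsplit : ∀ p, 0 < κ.real (Q p) → ∃ r, 0 < κ.real (Q p ∩ Q r) ∧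
      κ.real (Q p ∩ Q r) < κ.real (Q p)) {x : X} (hx : x ∈ qSupport κ Q) {U : Set X}
    (hU : IsOpen U) (hxU : x ∈ U) : ∃ x' ∈ qSupport κ Q, x' ∈ U ∧ x' ≠ x := by
  obtain ⟨p, hp, hpU⟩ := hb x U hU hxU
  obtain ⟨r, h1, h2⟩ := hsplit p (hx p hp)
  have h3 : 0 < κ.real (Q p \ Q r) := by
    have := measureReal_inter_add_sdiff (μ := κ) (s := Q p) (hQ r)
    linarith
  obtain ⟨y, hy, hyS⟩ := exists_mem_qSupport (Q := Q) h1
  obtain ⟨z, hz, hzS⟩ := exists_mem_qSupport (Q := Q) h3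
  by_cases hyx : y = x
  · refine ⟨z, hzS, hpU hz.1, ?_⟩
    rintro rfl
    exact hz.2 (hyx ▸ hy.2)
  · exact ⟨y, hyS, hpU hy.1, hyx⟩

lemma exists_sepBox (hb : ∀ (x : X) (U : Set X), IsOpen U → x ∈ U → ∃ p, x ∈ Q p ∧ Q p ⊆ U)
    (hQ : ∀ p, MeasurableSet (Q p))
    (hsplit : ∀ p, 0 < κ.real (Q p) → ∃ r, 0 < κ.real (Q p ∩ Q r) ∧
      κ.real (Q p ∩ Q r) < κ.real (Q p)) (n : ℕ) :
    ∃ A : Fin n → ι, SepBox Q A ∧ ∀ i, 0 < κ.real (Q (A i)) := by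
  have hinf : (qSupport κ Q).Infinite := by
    intro hfin
    obtain ⟨x, -, hx⟩ := exists_mem_qSupport (κ := κ) (Q := Q) (V := Set.univ) (by simp)
    obtain ⟨x', hx', hU, hne⟩ := qSupport_exists_ne hb hQ hsplit hx
      (U := (qSupport κ Q \ {x})ᶜ) (hfin.subset Set.sdiff_subset).isClosed.isOpen_compl (by simp)
    exact hU ⟨hx', hne⟩
  obtain ⟨F, hF, hcard⟩ := hinf.exists_subset_card_eq n
  let e := (Finset.equivFinOfCardEq hcard).symm
  have hinj : Function.Injective fun i : Fin n => ((e i : F) : X) :=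
    Subtype.val_injective.comp e.injective
  obtain ⟨δ, hδ, hsep⟩ : ∃ δ : ℝ, 0 < δ ∧ ∀ i j : Fin n, i ≠ j → δ ≤ dist (e i : X) (e j) := by
    have hev : ∀ᶠ δ : ℝ in 𝓝[>] 0, ∀ i j : Fin n, i ≠ j → δ ≤ dist (e i : X) (e j) := by
      simp only [eventually_all]
      intro i j hij
      filter_upwards [Ioo_mem_nhdsGT (dist_pos.2 (hinj.ne hij))] with δ hδ using hδ.2.le
    obtain ⟨δ, h1, h2⟩ := (hev.and self_mem_nhdsWithin).exists
    exact ⟨δ, h2, h1⟩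
  choose A hA hAU using fun i : Fin n => hb (e i : X) (Metric.ball (e i : X) (δ / 3))
    Metric.isOpen_ball (Metric.mem_ball_self (by positivity))
  refine ⟨A, ⟨δ / 3, by positivity, fun i j hij x hx x' hx' => ?_⟩, fun i =>
    hF (e i).2 _ (hA i)⟩
  have h1 := hAU i hx
  have h2 := hAU j hx'
  rw [Metric.mem_ball] at h1 h2
  have h3 := dist_triangle4 (e i : X) x x' (e j)
  rw [dist_comm (e i : X) x] at h3
  linarith [hsep i j hij]

end

lemma tendsto_cesaro_Icc {u : ℕ → ℝ} (hu : Tendsto u atTop (𝓝 0)) :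
    Tendsto (fun N : ℕ => (N : ℝ)⁻¹ * ∑ k ∈ Finset.Icc 1 N, u k) atTop (𝓝 0) := by
  have h1 := ((tendsto_add_atTop_iff_nat 1).2 hu).cesaro
  refine h1.congr fun N => ?_
  congr 1
  rw [Finset.range_eq_Ico, Finset.sum_Ico_add' u 0 N 1]
  rfl

lemma measurableSet_small {X : Type*} [MeasurableSpace X] {D : Set X} (hD : MeasurableSet D)
    {Ψ : ℕ → X → ℝ} (hΨ : ∀ l, Measurable (Ψ l)) (L : ℕ) (c : ℝ) :
    MeasurableSet {y ∈ D | ∀ l ≤ L, Ψ l y < c} := by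
  have : {y ∈ D | ∀ l ≤ L, Ψ l y < c} = D ∩ ⋂ l, ⋂ (_ : l ≤ L), Ψ l ⁻¹' Set.Iio c := by
    ext; simp
  rw [this]
  exact hD.inter
    (MeasurableSet.iInter fun l => MeasurableSet.iInter fun _ => hΨ l measurableSet_Iio)

section
variable {X : Type*} [MetricSpace X] [mX : MeasurableSpace X] [BorelSpace X] [CompactSpace X]
variable {ι : Type*} {T : X ≃ₜ X} {μ : Measure X} {𝓕 : ℤ → MeasurableSpace X} {Q : ι → Set X}
variable [IsProbabilityMeasure μ] [Countable ι]

/-- The set of points whose conditional measure over the tail is not `{0, 1}`-valued on `Q`. -/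
def splitSet (𝓕 : ℤ → MeasurableSpace X) (μ : Measure X) [IsProbabilityMeasure μ]
    (Q : ι → Set X) : Set X :=
  {y | ∃ p, 0 < condMeas (⨅ m, 𝓕 m) μ (Q p) y ∧ condMeas (⨅ m, 𝓕 m) μ (Q p) y < 1}

namespace TailSystem

lemma measurable_tail (h : TailSystem T μ 𝓕 Q) {U : Set X} (hU : MeasurableSet U) :
    Measurable (condMeas (⨅ m, 𝓕 m) μ U) := measurable_condMeas' μ h.iInf_le' hU

lemma measurable_tail_comp (h : TailSystem T μ 𝓕 Q) {U : Set X} (hU : MeasurableSet U) (s : ℤ) :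
    Measurable fun y => condMeas (⨅ m, 𝓕 m) μ U ((T ^ s) y) :=
  (h.measurable_tail hU).comp (h.measurePreserving s).measurable

lemma measurableSet_splitSet (h : TailSystem T μ 𝓕 Q) : MeasurableSet (splitSet 𝓕 μ Q) := by
  have : splitSet 𝓕 μ Q = ⋃ p, condMeas (⨅ m, 𝓕 m) μ (Q p) ⁻¹' Set.Ioo 0 1 := by
    ext y; simp [splitSet]
  rw [this]
  exact MeasurableSet.iUnion fun p => h.measurable_tail (h.measurableSet p) measurableSet_Ioo

lemma measure_splitSet_ne_zero (h : TailSystem T μ 𝓕 Q) : μ (splitSet 𝓕 μ Q) ≠ 0 := by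
  intro h0
  obtain ⟨p, hp⟩ := h.nontrivial
  have hle := h.iInf_le'
  have hQ := h.measurableSet p
  set q := condMeas (⨅ m, 𝓕 m) μ (Q p) with hq
  let G : Set X := q ⁻¹' {1}
  have hG : MeasurableSet[⨅ m, 𝓕 m] G := measurable_condMeas μ hQ (measurableSet_singleton 1)
  have hae : ∀ᵐ y ∂μ, q y = 0 ∨ q y = 1 := by
    have : ∀ᵐ y ∂μ, y ∉ splitSet 𝓕 μ Q := measure_eq_zero_iff_ae_notMem.1 h0
    filter_upwards [this] with y hy
    by_contra! hcon
    exact hy ⟨p, lt_of_le_of_ne (condMeas_nonneg _ _ _ _) hcon.1.symm,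
      lt_of_le_of_ne (condMeas_le_one _ _ _ _) hcon.2⟩
  refine hp G hG ?_
  have h1 : μ.real (Q p ∩ Gᶜ) = 0 := by
    rw [← setIntegral_condMeas μ hle hQ hG.compl]
    refine setIntegral_eq_zero_of_ae_eq_zero ?_
    filter_upwards [hae] with y hy hyG
    exact hy.resolve_right hyG
  have h2 : μ.real (Q p ∩ G) = μ.real G := by
    rw [← setIntegral_condMeas μ hle hQ hG,
      setIntegral_congr_fun (g := fun _ => (1 : ℝ)) (hle _ hG) fun y hy => hy]
    simp
  have h3 : μ.real (G \ Q p) = 0 := by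
    have := measureReal_inter_add_sdiff (μ := μ) (s := G) hQ
    rw [Set.inter_comm] at this
    linarith
  rw [measureReal_eq_zero_iff] at h1 h3
  refine ae_le_set.2 ?_ |>.antisymm (ae_le_set.2 h3)
  rwa [Set.sdiff_eq]

lemma splitSet_shift (h : TailSystem T μ 𝓕 Q) (s : ℤ) : ∀ᵐ y ∂μ, y ∈ splitSet 𝓕 μ Q →
    (T ^ s) y ∈ splitSet 𝓕 μ Q := by
  have hae : ∀ᵐ y ∂μ, ∀ p, condMeas (⨅ m, 𝓕 m) μ (⇑(T ^ s) ⁻¹' Q p) y =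
      condMeas (⨅ m, 𝓕 m) μ (Q p) ((T ^ s) y) :=
    ae_all_iff.2 fun p => h.condMeas_preimage s (h.measurableSet p)
  filter_upwards [hae] with y hy
  rintro ⟨p, hp0, hp1⟩
  obtain ⟨r, hr⟩ := h.shift_Q (-s) p
  have hrp : ⇑(T ^ s) ⁻¹' Q r = Q p := by
    rw [hr]
    ext x
    simp only [Set.mem_preimage]
    rw [← zpow_apply_add, neg_add_cancel]
    simp
  have := hy r
  rw [hrp] at this
  exact ⟨r, by rwa [← this], by rwa [← this]⟩

lemma exists_small {D : Set X} (hD : MeasurableSet D) {Ψ : ℕ → X → ℝ}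
    (hΨ : ∀ l, Measurable (Ψ l))
    (hpos : ∀ᵐ y ∂μ, y ∈ D → ∃ l, 0 < Ψ l y) {η : ℝ} (hη : 0 < η) :
    ∃ L : ℕ, μ.real {y ∈ D | ∀ l ≤ L, Ψ l y < 1 / ((L : ℝ) + 1)} < η := by
  let Z : ℕ → Set X := fun L => {y ∈ D | ∀ l ≤ L, Ψ l y < 1 / ((L : ℝ) + 1)}
  have hZ : ∀ L, MeasurableSet (Z L) := fun L => measurableSet_small hD hΨ L _
  have hanti : Antitone Z := by
    intro L L' hL y hy
    refine ⟨hy.1, fun l hl => (hy.2 l (hl.trans hL)).trans_le ?_⟩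
    exact Nat.one_div_le_one_div hL
  have hnull : μ (⋂ L, Z L) = 0 := by
    rw [measure_eq_zero_iff_ae_notMem]
    filter_upwards [hpos] with y hy hmem
    rw [Set.mem_iInter] at hmem
    obtain ⟨l, hl⟩ := hy (hmem 0).1
    obtain ⟨L, hL⟩ := exists_nat_one_div_lt hl
    have h1 := (hmem (max l L)).2 l (le_max_left _ _)
    have h2 : 1 / (((max l L : ℕ) : ℝ) + 1) ≤ 1 / ((L : ℝ) + 1) :=
      Nat.one_div_le_one_div (le_max_right _ _)
    linarith
  have ht := tendsto_measure_iInter_atTop (μ := μ) (fun L => (hZ L).nullMeasurableSet) hanti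
    ⟨0, measure_ne_top _ _⟩
  rw [hnull] at ht
  obtain ⟨L, hL⟩ := (ht.eventually (gt_mem_nhds (ENNReal.ofReal_pos.2 hη))).exists
  exact ⟨L, ENNReal.toReal_lt_of_lt_ofReal hL⟩

lemma integral_le_of_small (h : TailSystem T μ 𝓕 Q) {D : Set X} (hD : MeasurableSet D)
    {Ψ : ℕ → X → ℝ}
    (hΨ : ∀ l, Measurable (Ψ l)) (h0 : ∀ l y, 0 ≤ Ψ l y) (h1 : ∀ l y, Ψ l y ≤ 1) (L : ℕ)
    {w : X → ℝ} (hw : Measurable w) (hw0 : ∀ y, 0 ≤ w y) (hw1 : ∀ y, w y ≤ 1)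
    (hwD : ∀ y, y ∉ D → w y = 0) {s : ℤ} (hs : ∀ᵐ y ∂μ, y ∈ D → (T ^ s) y ∈ D) :
    ∫ y, w y ∂μ ≤ ((L : ℝ) + 1) * ∑ l ∈ Finset.range (L + 1), ∫ y, w y * Ψ l ((T ^ s) y) ∂μ +
      μ.real {y ∈ D | ∀ l ≤ L, Ψ l y < 1 / ((L : ℝ) + 1)} := by
  set Z : Set X := {y ∈ D | ∀ l ≤ L, Ψ l y < 1 / ((L : ℝ) + 1)} with hZdef
  have hZ : MeasurableSet Z := measurableSet_small hD hΨ L _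
  have hTs := (h.measurePreserving s).measurable
  have hi : ∀ l, Integrable (fun y => w y * Ψ l ((T ^ s) y)) μ := fun l =>
    integrable_of_abs_le_one μ (hw.mul ((hΨ l).comp hTs)) fun y => by
      rw [abs_of_nonneg (mul_nonneg (hw0 _) (h0 _ _))]
      exact mul_le_one₀ (hw1 _) (h0 _ _) (h1 _ _)
  have hZs := h.measurableSet_preimage hZ s
  have hiZ : Integrable ((⇑(T ^ s) ⁻¹' Z).indicator (1 : X → ℝ)) μ := integrable_indicator_one μ hZs
  rw [← (h.measurePreserving s).measureReal_preimage hZ.nullMeasurableSet,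
    ← integral_indicator_one hZs, ← integral_finsetSum _ fun l _ => hi l, ← integral_const_mul,
    ← integral_add ((integrable_finsetSum _ fun l _ => hi l).const_mul _)
      hiZ]
  refine integral_mono_ae (integrable_of_abs_le_one μ hw fun y => by
    rw [abs_of_nonneg (hw0 y)]; exact hw1 y)
        (((integrable_finsetSum _ fun l _ => hi l).const_mul _).add
      hiZ) ?_
  filter_upwards [hs] with y hy
  have hL0 : (0 : ℝ) < (L : ℝ) + 1 := by positivity
  have hsum0 : 0 ≤ ∑ l ∈ Finset.range (L + 1), w y * Ψ l ((T ^ s) y) :=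
    Finset.sum_nonneg fun l _ => mul_nonneg (hw0 _) (h0 _ _)
  by_cases hyD : y ∈ D
  · by_cases hyZ : (T ^ s) y ∈ Z
    · rw [Set.indicator_of_mem (show y ∈ ⇑(T ^ s) ⁻¹' Z from hyZ), Pi.one_apply]
      have := mul_nonneg hL0.le hsum0
      linarith [hw1 y]
    · rw [Set.indicator_of_notMem (show y ∉ ⇑(T ^ s) ⁻¹' Z from hyZ), add_zero]
      simp only [hZdef, Set.mem_ofPred_eq, not_and, not_forall, not_lt] at hyZ
      obtain ⟨l, hl, hle⟩ := hyZ (hy hyD)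
      have h2 := Finset.single_le_sum (f := fun l => w y * Ψ l ((T ^ s) y))
        (fun l _ => mul_nonneg (hw0 y) (h0 l _)) (Finset.mem_range.2 (Nat.lt_succ_of_le hl))
      rw [div_le_iff₀ hL0] at hle
      calc w y ≤ w y * (Ψ l ((T ^ s) y) * ((L : ℝ) + 1)) := le_mul_of_one_le_right (hw0 y) hle
        _ = ((L : ℝ) + 1) * (w y * Ψ l ((T ^ s) y)) := by ring
        _ ≤ _ := mul_le_mul_of_nonneg_left h2 hL0.le
  · rw [hwD y hyD]
    exact add_nonneg (mul_nonneg hL0.le (by simp))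
      (Set.indicator_nonneg (fun _ _ => zero_le_one) _)

/-- A weight supported on an invariant set which is asymptotically orthogonal to the averages of
countably many functions, at least one of which is positive at each point, vanishes. -/
lemma ae_eq_zero_of_tendsto (h : TailSystem T μ 𝓕 Q) {Λ : Type*} [Countable Λ] [Nonempty Λ]
    {D : Set X}
    (hD : MeasurableSet D) (hDs : ∀ s : ℤ, ∀ᵐ y ∂μ, y ∈ D → (T ^ s) y ∈ D)
    {Ψ : Λ → X → ℝ} (hΨ : ∀ l, Measurable (Ψ l)) (h0 : ∀ l y, 0 ≤ Ψ l y) (h1 : ∀ l y, Ψ l y ≤ 1)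
    (hpos : ∀ᵐ y ∂μ, y ∈ D → ∃ l, 0 < Ψ l y)
    {w : X → ℝ} (hw : Measurable w) (hw0 : ∀ y, 0 ≤ w y) (hw1 : ∀ y, w y ≤ 1)
    (hwD : ∀ y, y ∉ D → w y = 0) (a : ℕ → ℤ) {N : ℕ → ℕ} (hN : ∀ᶠ j in atTop, 1 ≤ N j)
    (hlim : ∀ l, Tendsto (fun j => ((N j : ℕ) : ℝ)⁻¹ * ∑ k ∈ Finset.Icc 1 (N j),
      ∫ y, w y * Ψ l ((T ^ (a k)) y) ∂μ) atTop (𝓝 0)) : w =ᵐ[μ] 0 := by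
  obtain ⟨e, he⟩ := exists_surjective_nat Λ
  have hwi : Integrable w μ := integrable_of_abs_le_one μ hw fun y => by
    rw [abs_of_nonneg (hw0 y)]; exact hw1 y
  have hle : ∀ η : ℝ, 0 < η → ∫ y, w y ∂μ ≤ 0 + η := by
    intro η hη
    obtain ⟨L, hL⟩ := exists_small hD (Ψ := fun l => Ψ (e l)) (fun l => hΨ _)
      (hpos.mono fun y hy hyD => by
        obtain ⟨l, hl⟩ := hy hyD
        obtain ⟨m, rfl⟩ := he l
        exact ⟨m, hl⟩) hη
    have hlim2 : Tendsto (fun j => ((L : ℝ) + 1) * ∑ l ∈ Finset.range (L + 1),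
        (((N j : ℕ) : ℝ)⁻¹ * ∑ k ∈ Finset.Icc 1 (N j),
          ∫ y, w y * Ψ (e l) ((T ^ (a k)) y) ∂μ) + η) atTop
        (𝓝 (((L : ℝ) + 1) * ∑ l ∈ Finset.range (L + 1), (0 : ℝ) + η)) :=
      ((tendsto_finsetSum _ fun l _ => hlim (e l)).const_mul _).add_const _
    simp only [Finset.sum_const_zero, mul_zero] at hlim2
    refine ge_of_tendsto hlim2 ?_
    filter_upwards [hN] with j hj
    have hNpos : (0 : ℝ) < N j := by exact_mod_cast hj
    have hb : ∀ k ∈ Finset.Icc 1 (N j), ∫ y, w y ∂μ ≤ ((L : ℝ) + 1) *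
        ∑ l ∈ Finset.range (L + 1), ∫ y, w y * Ψ (e l) ((T ^ (a k)) y) ∂μ + η := fun k _ =>
      (h.integral_le_of_small hD (Ψ := fun l => Ψ (e l)) (fun l => hΨ _) (fun l => h0 _)
        (fun l => h1 _) L hw hw0 hw1 hwD (hDs (a k))).trans (by gcongr)
    have hs := Finset.sum_le_sum hb
    rw [Finset.sum_const, Nat.card_Icc, Nat.add_sub_cancel, nsmul_eq_mul, Finset.sum_add_distrib,
      Finset.sum_const, Nat.card_Icc, Nat.add_sub_cancel, nsmul_eq_mul, ← Finset.mul_sum,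
      Finset.sum_comm] at hs
    rw [← Finset.mul_sum, ← mul_assoc, mul_comm ((L : ℝ) + 1), mul_assoc]
    rw [← mul_le_mul_iff_right₀ hNpos, mul_add, ← mul_assoc, mul_inv_cancel₀ hNpos.ne', one_mul]
    exact hs
  have hz : ∫ y, w y ∂μ = 0 := le_antisymm (le_of_forall_pos_le_add hle) (integral_nonneg hw0)
  exact (integral_eq_zero_iff_of_nonneg hw0 hwi).1 hz

end TailSystem
end

section
variable {X : Type*} [MetricSpace X] [mX : MeasurableSpace X] [BorelSpace X] [CompactSpace X]
variable {ι : Type*} {T : X ≃ₜ X} {μ : Measure X} {𝓕 : ℤ → MeasurableSpace X} {Q : ι → Set X}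
variable [IsProbabilityMeasure μ] [Countable ι]

namespace TailSystem

/-- Over the split set, the conditional measures over the tail have no atoms. -/
lemma exists_split (h : TailSystem T μ 𝓕 Q) [Nonempty ι] (p : ι) : ∀ᵐ y ∂μ, y ∈ splitSet 𝓕 μ Q →
    0 < condMeas (⨅ m, 𝓕 m) μ (Q p) y →
    ∃ r, 0 < condMeas (⨅ m, 𝓕 m) μ (Q p ∩ Q r) y ∧
      condMeas (⨅ m, 𝓕 m) μ (Q p ∩ Q r) y < condMeas (⨅ m, 𝓕 m) μ (Q p) y := by
  set q := condMeas (⨅ m, 𝓕 m) μ with hq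
  have hq0 : ∀ U y, 0 ≤ q U y := condMeas_nonneg _ _
  have hq1 : ∀ U y, q U y ≤ 1 := condMeas_le_one _ _
  have hqm : ∀ {U}, MeasurableSet U → Measurable (q U) := fun hU => h.measurable_tail hU
  have hQ := h.measurableSet
  have hD := h.measurableSet_splitSet
  let E : Set X := splitSet 𝓕 μ Q ∩ ⋂ r, ({y | q (Q p ∩ Q r) y = 0} ∪
    {y | q (Q p ∩ Q r) y = q (Q p) y})
  have hE : MeasurableSet E := hD.inter (MeasurableSet.iInter fun r =>
    ((hqm ((hQ p).inter (hQ r))) (measurableSet_singleton 0)).union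
      (measurableSet_eq_fun (hqm ((hQ p).inter (hQ r))) (hqm (hQ p))))
  let w : X → ℝ := E.indicator (q (Q p))
  have hw : Measurable w := (hqm (hQ p)).indicator hE
  have hw0 : ∀ y, 0 ≤ w y := fun y => Set.indicator_nonneg (fun y _ => hq0 _ _) y
  have hw1 : ∀ y, w y ≤ 1 := fun y => Set.indicator_le' (fun y _ => hq1 _ _)
    (fun _ _ => zero_le_one) y
  let Ψ : ι → X → ℝ := fun l y => min (q (Q l) y) (1 - q (Q l) y)
  have hΨ : ∀ l, Measurable (Ψ l) := fun l =>
    (hqm (hQ l)).min (measurable_const.sub (hqm (hQ l)))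
  have hΨ0 : ∀ l y, 0 ≤ Ψ l y := fun l y => le_min (hq0 _ _) (sub_nonneg.2 (hq1 _ _))
  have hΨ1 : ∀ l y, Ψ l y ≤ 1 := fun l y => (min_le_left _ _).trans (hq1 _ _)
  have hkey : w =ᵐ[μ] 0 := by
    refine h.ae_eq_zero_of_tendsto hD h.splitSet_shift hΨ hΨ0 hΨ1 (ae_of_all _ ?_) hw hw0 hw1
      (fun y hy => Set.indicator_of_notMem (fun hy' => hy hy'.1) _) (fun k => (k : ℤ))
      (N := fun j => j) (eventually_ge_atTop 1) fun l => ?_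
    · rintro y ⟨l, h0, h1⟩
      exact ⟨l, lt_min h0 (sub_pos.2 h1)⟩
    · refine tendsto_cesaro_Icc (u := fun k => ∫ y, w y * Ψ l ((T ^ (k : ℤ)) y) ∂μ) ?_
      have hm := (h.mixing (hQ p) (hQ l)).comp tendsto_natCast_atTop_atTop
      refine squeeze_zero (fun k => integral_nonneg fun y => mul_nonneg (hw0 _) (hΨ0 _ _))
        (fun k => ?_) hm
      have hTk := (h.measurePreserving k).measurable
      refine integral_mono_of_nonneg (ae_of_all _ fun y => mul_nonneg (hw0 _) (hΨ0 _ _)) ?_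
        (ae_of_all _ fun y => ?_)
      · refine integrable_of_abs_le_one μ ?_ fun y => ?_
        · exact ((hqm ((hQ p).inter (hTk (hQ l)))).sub
            ((hqm (hQ p)).mul ((hqm (hQ l)).comp hTk))).abs
        · rw [abs_abs, abs_le]
          have h1 := hq0 (Q p ∩ ⇑(T ^ (k : ℤ)) ⁻¹' Q l) y
          have h2 := hq1 (Q p ∩ ⇑(T ^ (k : ℤ)) ⁻¹' Q l) y
          have h3 := mul_nonneg (hq0 (Q p) y) (hq0 (Q l) ((T ^ (k : ℤ)) y))
          have h4 := mul_le_one₀ (hq1 (Q p) y) (hq0 (Q l) ((T ^ (k : ℤ)) y)) (hq1 _ _)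
          constructor <;> linarith
      · by_cases hy : y ∈ E
        · obtain ⟨r, hr⟩ := h.shift_Q k l
          have hyr := Set.mem_iInter.1 hy.2 r
          rw [hr] at hyr
          simp only [w, Ψ, Set.indicator_of_mem hy]
          have ha := hq0 (Q p) y
          rcases hyr with h0 | h0 <;> rw [Set.mem_ofPred_eq] at h0 <;> rw [← hq, h0]
          · rw [zero_sub, abs_neg, abs_of_nonneg (mul_nonneg (hq0 _ _) (hq0 _ _))]
            exact mul_le_mul_of_nonneg_left (min_le_left _ _) ha
          · refine (mul_le_mul_of_nonneg_left (min_le_right _ _) ha).trans ?_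
            rw [mul_sub, mul_one]
            exact le_abs_self _
        · simp only [w, Set.indicator_of_notMem hy, zero_mul]
          exact abs_nonneg _
  filter_upwards [hkey] with y hy hyD hpos
  by_contra! hcon
  have hyE : y ∈ E := by
    refine ⟨hyD, Set.mem_iInter.2 fun r => ?_⟩
    rcases (hq0 (Q p ∩ Q r) y).eq_or_lt with h0 | h0
    · exact Or.inl h0.symm
    · exact Or.inr (le_antisymm (condMeas_mono _ _ Set.inter_subset_left y) (hcon r h0))
  simp only [w, Set.indicator_of_mem hyE, Pi.zero_apply] at hy
  exact hpos.ne' hy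

end TailSystem
end

lemma abs_prod_sub_prod_le {α : Type*} (s : Finset α) {a b : α → ℝ} (ha0 : ∀ i, 0 ≤ a i)
    (ha1 : ∀ i, a i ≤ 1) (hb0 : ∀ i, 0 ≤ b i) (hb1 : ∀ i, b i ≤ 1) :
    |∏ i ∈ s, a i - ∏ i ∈ s, b i| ≤ ∑ i ∈ s, |a i - b i| := by
  classical
  induction s using Finset.induction_on with
  | empty => simp
  | insert i s hi ih =>
    rw [Finset.prod_insert hi, Finset.prod_insert hi, Finset.sum_insert hi]
    have hA0 := Finset.prod_nonneg (s := s) fun i _ => ha0 i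
    have hA1 := Finset.prod_le_one (s := s) (fun i _ => ha0 i) fun i _ => ha1 i
    calc |a i * ∏ i ∈ s, a i - b i * ∏ i ∈ s, b i|
        = |(a i - b i) * ∏ i ∈ s, a i + b i * (∏ i ∈ s, a i - ∏ i ∈ s, b i)| := by ring_nf
      _ ≤ |a i - b i| * |∏ i ∈ s, a i| + |b i| * |∏ i ∈ s, a i - ∏ i ∈ s, b i| := by
        rw [← abs_mul, ← abs_mul]; exact abs_add_le _ _
      _ ≤ |a i - b i| * 1 + 1 * |∏ i ∈ s, a i - ∏ i ∈ s, b i| := by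
        rw [abs_of_nonneg hA0, abs_of_nonneg (hb0 i)]
        gcongr
        exact hb1 i
      _ ≤ _ := by rw [mul_one, one_mul]; gcongr

section
variable {X : Type*} [mX : MeasurableSpace X] {μ : Measure X} [IsProbabilityMeasure μ]

lemma exists_subseq_tendsto_ae {Λ : Type*} [Countable Λ] [Nonempty Λ] {f : Λ → ℕ → X → ℝ}
    (hf : ∀ l N, Measurable (f l N)) (hf0 : ∀ l N y, 0 ≤ f l N y)
    (hfi : ∀ l N, Integrable (f l N) μ)
    (hlim : ∀ l, Tendsto (fun N => ∫ y, f l N y ∂μ) atTop (𝓝 0)) :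
    ∃ φ : ℕ → ℕ, StrictMono φ ∧ ∀ᵐ y ∂μ, ∀ l, Tendsto (fun j => f l (φ j) y) atTop (𝓝 0) := by
  obtain ⟨e, he⟩ := exists_surjective_nat Λ
  obtain ⟨φ, hφ, hP⟩ := extraction_forall_of_eventually
    (P := fun j N => ∀ l ≤ j, ∫ y, f (e l) N y ∂μ < (1 / 2) ^ j) fun j => by
      have : ∀ᶠ N in atTop, ∀ l ∈ Finset.Iic j, ∫ y, f (e l) N y ∂μ < (1 / 2) ^ j :=
        (Finset.eventually_all _).2 fun l _ =>
          (hlim (e l)).eventually (gt_mem_nhds (by positivity))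
      simpa using this
  refine ⟨φ, hφ, ?_⟩
  have key : ∀ l : ℕ, ∀ᵐ y ∂μ, Tendsto (fun j => f (e l) (φ j) y) atTop (𝓝 0) := by
    intro l
    have hfin : ∫⁻ y, ∑' j, ENNReal.ofReal (f (e l) (φ (j + l)) y) ∂μ ≠ ⊤ := by
      rw [lintegral_tsum fun j => (hf _ _).ennreal_ofReal.aemeasurable]
      refine ne_top_of_le_ne_top (b := ∑' j : ℕ, ENNReal.ofReal ((1 / 2) ^ j)) ?_
        (ENNReal.tsum_le_tsum fun j => ?_)
      · rw [← ENNReal.ofReal_tsum_of_nonneg (fun _ => by positivity) summable_geometric_two]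
        exact ENNReal.ofReal_ne_top
      · rw [← ofReal_integral_eq_lintegral_ofReal (hfi _ _) (ae_of_all _ (hf0 _ _))]
        refine ENNReal.ofReal_le_ofReal ((hP (j + l) l (Nat.le_add_left _ _)).le.trans ?_)
        exact pow_le_pow_of_le_one (by norm_num) (by norm_num) (Nat.le_add_right _ _)
    filter_upwards [ae_lt_top (Measurable.tsum fun j => (hf _ _).ennreal_ofReal) hfin]
      with y hy
    have h1 := ENNReal.tendsto_atTop_zero_of_tsum_ne_top hy.ne
    have h2 := (ENNReal.tendsto_toReal ENNReal.zero_ne_top).comp h1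
    rw [ENNReal.toReal_zero] at h2
    refine (tendsto_add_atTop_iff_nat l).1 (h2.congr fun j => ?_)
    simp [ENNReal.toReal_ofReal (hf0 _ _ _)]
  filter_upwards [ae_all_iff.2 key] with y hy l
  obtain ⟨m, rfl⟩ := he l
  exact hy m

end

section
variable {X : Type*} [MetricSpace X] [CompactSpace X] (m : MeasurableSpace X)
variable [mX : MeasurableSpace X] [BorelSpace X] (μ : Measure X) [IsProbabilityMeasure μ] {n : ℕ}

lemma abs_sub_le_one_of_mem_unit {s t : ℝ} (hs0 : 0 ≤ s) (hs1 : s ≤ 1) (ht0 : 0 ≤ t)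
    (ht1 : t ≤ 1) : |s - t| ≤ 1 := abs_le.2 ⟨by linarith, by linarith⟩

/-- The conditional measure of a box. -/
noncomputable def prodMeas (U : Fin n → Set X) (y : X) : ℝ := ∏ i, condMeas m μ (U i) y

lemma prodMeas_nonneg (U : Fin n → Set X) (y : X) : 0 ≤ prodMeas m μ U y :=
  Finset.prod_nonneg fun i _ => condMeas_nonneg m μ (U i) y

lemma prodMeas_le_one (U : Fin n → Set X) (y : X) : prodMeas m μ U y ≤ 1 :=
  Finset.prod_le_one (fun i _ => condMeas_nonneg m μ (U i) y) fun i _ => condMeas_le_one m μ (U i) y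

end

section
variable {X : Type*} [MetricSpace X] [mX : MeasurableSpace X] [BorelSpace X] [CompactSpace X]
variable {ι : Type*} {T : X ≃ₜ X} {μ : Measure X} {𝓕 : ℤ → MeasurableSpace X} {Q : ι → Set X}
variable [IsProbabilityMeasure μ] [Countable ι] {n : ℕ}

namespace TailSystem

lemma measurable_prodMeas (h : TailSystem T μ 𝓕 Q) {U : Fin n → Set X}
    (hU : ∀ i, MeasurableSet (U i)) :
    Measurable (prodMeas (⨅ m, 𝓕 m) μ U) :=
  Finset.measurable_fun_prod _ fun i _ => h.measurable_tail (hU i)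

lemma mixing_prod (h : TailSystem T μ 𝓕 Q) {U A : Fin n → Set X} (hU : ∀ i, MeasurableSet (U i))
    (hA : ∀ i, MeasurableSet (A i)) :
    Tendsto (fun t : ℤ => ∫ y, |prodMeas (⨅ m, 𝓕 m) μ (fun i => U i ∩ ⇑(T ^ t) ⁻¹' A i) y -
      prodMeas (⨅ m, 𝓕 m) μ U y * prodMeas (⨅ m, 𝓕 m) μ A ((T ^ t) y)| ∂μ) atTop (𝓝 0) := by
  have hs := tendsto_finsetSum Finset.univ fun i _ => h.mixing (hU i) (hA i)
  rw [Finset.sum_const_zero] at hs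
  refine squeeze_zero (fun t => integral_nonneg fun y => abs_nonneg _) (fun t => ?_) hs
  have hTt := (h.measurePreserving t).measurable
  have hi : ∀ i ∈ Finset.univ, Integrable (fun y =>
      |condMeas (⨅ m, 𝓕 m) μ (U i ∩ ⇑(T ^ t) ⁻¹' A i) y -
        condMeas (⨅ m, 𝓕 m) μ (U i) y * condMeas (⨅ m, 𝓕 m) μ (A i) ((T ^ t) y)|) μ := by
    intro i _
    refine integrable_of_abs_le_one μ ((h.measurable_tail ((hU i).inter (hTt (hA i)))).sub
      ((h.measurable_tail (hU i)).mul (h.measurable_tail_comp (hA i) t))).abs fun y => ?_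
    rw [abs_abs]
    exact abs_sub_le_one_of_mem_unit (condMeas_nonneg _ _ _ _) (condMeas_le_one _ _ _ _)
      (mul_nonneg (condMeas_nonneg _ _ _ _) (condMeas_nonneg _ _ _ _))
      (mul_le_one₀ (condMeas_le_one _ _ _ _) (condMeas_nonneg _ _ _ _) (condMeas_le_one _ _ _ _))
  rw [← integral_finsetSum _ hi]
  refine integral_mono_of_nonneg (ae_of_all _ fun y => abs_nonneg _) (integrable_finsetSum _ hi)
    (ae_of_all _ fun y => ?_)
  simp only [prodMeas, ← Finset.prod_mul_distrib]
  exact abs_prod_sub_prod_le _ (fun i => condMeas_nonneg _ _ _ _) (fun i => condMeas_le_one _ _ _ _)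
    (fun i => mul_nonneg (condMeas_nonneg _ _ _ _) (condMeas_nonneg _ _ _ _))
    fun i =>
      mul_le_one₀ (condMeas_le_one _ _ _ _) (condMeas_nonneg _ _ _ _) (condMeas_le_one _ _ _ _)

lemma exists_sepBox_pos (h : TailSystem T μ 𝓕 Q) [Nonempty ι] (n : ℕ) : ∀ᵐ y ∂μ,
    y ∈ splitSet 𝓕 μ Q →
    ∃ A : Fin n → ι, SepBox Q A ∧ 0 < prodMeas (⨅ m, 𝓕 m) μ (fun i => Q (A i)) y := by
  filter_upwards [ae_all_iff.2 h.exists_split] with y hy hyD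
  obtain ⟨A, hA, hpos⟩ := exists_sepBox (κ := ProbabilityTheory.condExpKernel μ (⨅ m, 𝓕 m) y)
    h.basis h.measurableSet (fun p hp => hy p hyD hp) n
  exact ⟨A, hA, Finset.prod_pos fun i _ => hpos i⟩

/-- Along `a`, almost every conditional measure charges a fixed separated box with positive upper
frequency, independently of the starting box. -/
lemma exists_frequency (h : TailSystem T μ 𝓕 Q) [Nonempty ι] {a : ℕ → ℤ}
    (ha : Tendsto a atTop atTop) (n : ℕ) :
    ∀ᵐ y ∂μ, y ∈ splitSet 𝓕 μ Q → ∃ A : Fin n → ι, SepBox Q A ∧ ∃ c : ℝ, 0 < c ∧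
      ∀ W : Fin n → ι, 0 < prodMeas (⨅ m, 𝓕 m) μ (fun i => Q (W i)) y → ∀ M : ℕ, ∃ N ≥ M,
        c * prodMeas (⨅ m, 𝓕 m) μ (fun i => Q (W i)) y < (N : ℝ)⁻¹ * ∑ k ∈ Finset.Icc 1 N,
          prodMeas (⨅ m, 𝓕 m) μ (fun i => Q (W i) ∩ ⇑(T ^ (a k)) ⁻¹' Q (A i)) y := by
  classical
  set q : (Fin n → Set X) → X → ℝ := prodMeas (⨅ m, 𝓕 m) μ with hq
  have hq0 : ∀ U y, 0 ≤ q U y := prodMeas_nonneg _ _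
  have hq1 : ∀ U y, q U y ≤ 1 := prodMeas_le_one _ _
  have hQ := h.measurableSet
  have hT := fun t : ℤ => (h.measurePreserving t).measurable
  have hD := h.measurableSet_splitSet
  let err : (Fin n → ι) × (Fin n → ι) → ℤ → X → ℝ := fun z t y =>
    |q (fun i => Q (z.1 i) ∩ ⇑(T ^ t) ⁻¹' Q (z.2 i)) y -
      q (fun i => Q (z.1 i)) y * q (fun i => Q (z.2 i)) ((T ^ t) y)|
  have herr : ∀ z t, Measurable (err z t) := fun z t =>
    ((h.measurable_prodMeas fun i => (hQ _).inter (hT t (hQ _))).sub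
      ((h.measurable_prodMeas fun i => hQ _).mul
        ((h.measurable_prodMeas fun i => hQ _).comp (hT t)))).abs
  have herr1 : ∀ z t y, |err z t y| ≤ 1 := fun z t y => by
    rw [abs_abs]
    exact abs_sub_le_one_of_mem_unit (hq0 _ _) (hq1 _ _) (mul_nonneg (hq0 _ _) (hq0 _ _))
      (mul_le_one₀ (hq1 _ _) (hq0 _ _) (hq1 _ _))
  have hierr : ∀ z t, Integrable (err z t) μ := fun z t =>
    integrable_of_abs_le_one μ (herr z t) (herr1 z t)
  obtain ⟨φ, hφ, hφlim⟩ := exists_subseq_tendsto_ae (μ := μ)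
    (f := fun z (N : ℕ) y => (N : ℝ)⁻¹ * ∑ k ∈ Finset.Icc 1 N, err z (a k) y)
    (fun z N => (Finset.measurable_fun_sum _ fun k _ => herr z (a k)).const_mul _)
    (fun z N y => mul_nonneg (by positivity) (Finset.sum_nonneg fun k _ => abs_nonneg _))
    (fun z N => (integrable_finsetSum _ fun k _ => hierr z (a k)).const_mul _)
    (fun z => by
      have := tendsto_cesaro_Icc ((h.mixing_prod (U := fun i => Q (z.1 i))
        (A := fun i => Q (z.2 i)) (fun i => hQ _) (fun i => hQ _)).comp ha)
      refine this.congr fun N => ?_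
      rw [integral_const_mul, integral_finsetSum _ fun k _ => hierr z (a k)]
      rfl)
  let Ψ : (Fin n → ι) → X → ℝ := fun A y => if SepBox Q A then q (fun i => Q (A i)) y else 0
  have hΨ : ∀ A, Measurable (Ψ A) := fun A => by
    by_cases hA : SepBox Q A
    · simpa only [Ψ, if_pos hA] using h.measurable_prodMeas fun i => hQ _
    · simpa only [Ψ, if_neg hA] using measurable_const
  have hΨ0 : ∀ A y, 0 ≤ Ψ A y := fun A y => by
    simp only [Ψ]; split_ifs; exacts [hq0 _ _, le_rfl]
  have hΨ1 : ∀ A y, Ψ A y ≤ 1 := fun A y => by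
    simp only [Ψ]; split_ifs; exacts [hq1 _ _, zero_le_one]
  let avg : (Fin n → ι) → ℕ → X → ℝ := fun A N y =>
    (N : ℝ)⁻¹ * ∑ k ∈ Finset.Icc 1 N, Ψ A ((T ^ (a k)) y)
  have havg : ∀ A N, Measurable (avg A N) := fun A N =>
    (Finset.measurable_fun_sum _ fun k _ => (hΨ A).comp (hT _)).const_mul _
  have havg0 : ∀ A N y, 0 ≤ avg A N y := fun A N y =>
    mul_nonneg (by positivity) (Finset.sum_nonneg fun k _ => hΨ0 _ _)
  have havg1 : ∀ A N y, avg A N y ≤ 1 := fun A N y => by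
    have h1 : ∑ k ∈ Finset.Icc 1 N, Ψ A ((T ^ (a k)) y) ≤ ∑ k ∈ Finset.Icc 1 N, 1 :=
      Finset.sum_le_sum fun k _ => hΨ1 _ _
    rw [Finset.sum_const, Nat.card_Icc, Nat.add_sub_cancel, nsmul_eq_mul, mul_one] at h1
    exact (mul_le_mul_of_nonneg_left h1 (by positivity)).trans (inv_mul_le_one)
  let E : Set X := splitSet 𝓕 μ Q ∩ ⋂ A, {y | Tendsto (fun j => avg A (φ j) y) atTop (𝓝 0)}
  have hE : MeasurableSet E := hD.inter (MeasurableSet.iInter fun A =>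
    measurableSet_tendsto _ fun j => havg A (φ j))
  have hnull : E.indicator (fun _ => (1 : ℝ)) =ᵐ[μ] 0 := by
    refine h.ae_eq_zero_of_tendsto hD h.splitSet_shift hΨ hΨ0 hΨ1 ?_
      (measurable_const.indicator hE) (Set.indicator_nonneg fun _ _ => zero_le_one)
      (Set.indicator_le' (fun _ _ => le_rfl) fun _ _ => zero_le_one)
      (fun y hy => Set.indicator_of_notMem (fun hy' => hy hy'.1) _) a (N := φ)
      (hφ.tendsto_atTop.eventually_ge_atTop 1) fun A => ?_
    · filter_upwards [h.exists_sepBox_pos n] with y hy hyD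
      obtain ⟨A, hA, hpos⟩ := hy hyD
      exact ⟨A, by simpa only [Ψ, if_pos hA] using hpos⟩
    · have hdc : Tendsto (fun j => ∫ y, E.indicator (fun _ => (1 : ℝ)) y * avg A (φ j) y ∂μ) atTop
          (𝓝 (∫ y, (0 : ℝ) ∂μ)) := by
        refine tendsto_integral_of_dominated_convergence (fun _ => 1)
          (fun j => ((measurable_const.indicator hE).mul (havg A (φ j))).aestronglyMeasurable)
          (integrable_const 1) (fun j => ae_of_all _ fun y => ?_) (ae_of_all _ fun y => ?_)
        · by_cases hy : y ∈ E
          · rw [Set.indicator_of_mem hy, one_mul, Real.norm_of_nonneg (havg0 _ _ _)]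
            exact havg1 _ _ _
          · simp [Set.indicator_of_notMem hy]
        · by_cases hy : y ∈ E
          · simp only [Set.indicator_of_mem hy, one_mul]
            exact Set.mem_iInter.1 hy.2 A
          · simp [Set.indicator_of_notMem hy]
      rw [integral_zero] at hdc
      refine hdc.congr fun j => ?_
      rw [← integral_finsetSum, ← integral_const_mul]
      · refine integral_congr_ae (ae_of_all _ fun y => ?_)
        simp only [avg, ← Finset.mul_sum]
        ring
      · intro k _
        refine integrable_of_abs_le_one μ ((measurable_const.indicator hE).mul
          ((hΨ A).comp (hT _))) fun y => ?_
        by_cases hy : y ∈ E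
        · rw [Set.indicator_of_mem hy, one_mul, abs_of_nonneg (hΨ0 _ _)]
          exact hΨ1 _ _
        · simp [Set.indicator_of_notMem hy]
  filter_upwards [hnull, hφlim] with y hy hyerr hyD
  have hyE : y ∉ E := fun hyE => by simp [Set.indicator_of_mem hyE] at hy
  have hyA : ∃ A, ¬ Tendsto (fun j => avg A (φ j) y) atTop (𝓝 0) := by
    by_contra! hcon
    exact hyE ⟨hyD, Set.mem_iInter.2 hcon⟩
  obtain ⟨A, hA⟩ := hyA
  have hsep : SepBox Q A := by
    by_contra hsep
    exact hA (by simp [avg, Ψ, if_neg hsep])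
  obtain ⟨c, hc, hfreq⟩ : ∃ c : ℝ, 0 < c ∧ ∃ᶠ j in atTop, 2 * c ≤ avg A (φ j) y := by
    by_contra! hcon
    refine hA (Metric.tendsto_nhds.2 fun ε hε => ?_)
    have := hcon (ε / 2) (by positivity)
    filter_upwards [this] with j hj
    rw [Real.dist_0_eq_abs, abs_of_nonneg (havg0 _ _ _)]
    linarith
  refine ⟨A, hsep, c, hc, fun W hW M => ?_⟩
  set P := q (fun i => Q (W i)) y with hP
  have he := (hyerr (W, A)).eventually (gt_mem_nhds (mul_pos hc hW))
  obtain ⟨j, hj1, hj2, hj3⟩ := (hfreq.and_eventually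
    (he.and (hφ.tendsto_atTop.eventually_ge_atTop M))).exists
  refine ⟨φ j, hj3, ?_⟩
  have hN0 : (0 : ℝ) ≤ ((φ j : ℕ) : ℝ)⁻¹ := by positivity
  have hsum : P * avg A (φ j) y ≤ ((φ j : ℕ) : ℝ)⁻¹ * ∑ k ∈ Finset.Icc 1 (φ j), err (W, A) (a k) y +
      ((φ j : ℕ) : ℝ)⁻¹ * ∑ k ∈ Finset.Icc 1 (φ j),
        q (fun i => Q (W i) ∩ ⇑(T ^ (a k)) ⁻¹' Q (A i)) y := by
    rw [← mul_add, ← Finset.sum_add_distrib]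
    simp only [avg, Ψ, if_pos hsep]
    rw [mul_left_comm, Finset.mul_sum]
    refine mul_le_mul_of_nonneg_left (Finset.sum_le_sum fun k _ => ?_) hN0
    have := neg_abs_le (q (fun i => Q (W i) ∩ ⇑(T ^ (a k)) ⁻¹' Q (A i)) y -
      q (fun i => Q (W i)) y * q (fun i => Q (A i)) ((T ^ (a k)) y))
    simp only [err]
    linarith
  have h2 : P * (2 * c) ≤ P * avg A (φ j) y := mul_le_mul_of_nonneg_left hj1 hW.le
  nlinarith

end TailSystem
end

section
variable {X : Type*} [MetricSpace X] {n : ℕ}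

lemma pairDist_eq_image (y : Fin n → X) :
    {r : ℝ | ∃ i j : Fin n, i < j ∧ r = dist (y i) (y j)} =
      (fun p : Fin n × Fin n => dist (y p.1) (y p.2)) ''
        ((Finset.univ.filter fun p : Fin n × Fin n => p.1 < p.2 : Finset _) : Set _) := by
  ext r
  simp [eq_comm]

lemma continuous_maxPairDist : Continuous (maxPairDist : (Fin n → X) → ℝ) := by
  change Continuous fun y : Fin n → X => maxPairDist y
  by_cases hne : (Finset.univ.filter fun p : Fin n × Fin n => p.1 < p.2).Nonempty
  · simp only [maxPairDist, pairDist_eq_image, ← Finset.sup'_eq_csSup_image _ hne]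
    exact Continuous.finset_sup'_apply hne fun p _ => by fun_prop
  · rw [Finset.not_nonempty_iff_eq_empty] at hne
    simp only [maxPairDist, pairDist_eq_image, hne]
    simpa using continuous_const

lemma continuous_minPairDist : Continuous (minPairDist : (Fin n → X) → ℝ) := by
  change Continuous fun y : Fin n → X => minPairDist y
  by_cases hne : (Finset.univ.filter fun p : Fin n × Fin n => p.1 < p.2).Nonempty
  · simp only [minPairDist, pairDist_eq_image, ← Finset.inf'_eq_csInf_image _ hne]
    exact Continuous.finset_inf'_apply hne fun p _ => by fun_prop
  · rw [Finset.not_nonempty_iff_eq_empty] at hne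
    simp only [minPairDist, pairDist_eq_image, hne]
    simpa using continuous_const

lemma maxPairDist_nonneg (y : Fin n → X) : 0 ≤ maxPairDist y := by
  refine Real.sSup_nonneg ?_
  rintro r ⟨i, j, -, rfl⟩
  exact dist_nonneg

lemma minPairDist_nonneg (y : Fin n → X) : 0 ≤ minPairDist y := by
  refine Real.sInf_nonneg ?_
  rintro r ⟨i, j, -, rfl⟩
  exact dist_nonneg

lemma maxPairDist_le_sum (y : Fin n → X) : maxPairDist y ≤ ∑ i, ∑ j, dist (y i) (y j) := by
  refine Real.sSup_le ?_ (Finset.sum_nonneg fun i _ => Finset.sum_nonneg fun j _ => dist_nonneg)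
  rintro r ⟨i, j, -, rfl⟩
  exact (Finset.single_le_sum (f := fun j => dist (y i) (y j)) (fun _ _ => dist_nonneg)
    (Finset.mem_univ j)).trans (Finset.single_le_sum (f := fun i => ∑ j, dist (y i) (y j))
      (fun _ _ => Finset.sum_nonneg fun j _ => dist_nonneg) (Finset.mem_univ i))

lemma le_minPairDist (hn : 2 ≤ n) {y : Fin n → X} {δ : ℝ}
    (h : ∀ i j, i ≠ j → δ ≤ dist (y i) (y j)) : δ ≤ minPairDist y := by
  refine le_csInf ⟨_, ⟨0, by omega⟩, ⟨1, by omega⟩, by simp, rfl⟩ ?_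
  rintro r ⟨i, j, hij, rfl⟩
  exact h i j hij.ne

lemma minPairDist_le_dist (y : Fin n → X) {i j : Fin n} (hij : i < j) :
    minPairDist y ≤ dist (y i) (y j) := by
  have hb : BddBelow {r : ℝ | ∃ i j : Fin n, i < j ∧ r = dist (y i) (y j)} := by
    refine ⟨0, ?_⟩
    rintro r ⟨i, j, -, rfl⟩
    exact dist_nonneg
  exact csInf_le hb ⟨i, j, hij, rfl⟩

/-- The average of `g` along the first `N` terms of the orbit of `x` sampled at the times `a`. -/
noncomputable def orbitAvg (T : X ≃ₜ X) (a : ℕ → ℤ) (g : (Fin n → X) → ℝ) (N : ℕ)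
    (x : Fin n → X) : ℝ :=
  (N : ℝ)⁻¹ * ∑ k ∈ Finset.Icc 1 N, g fun i => (T ^ (a k)) (x i)

variable {T : X ≃ₜ X} {a : ℕ → ℤ}

lemma continuous_orbitAvg {g : (Fin n → X) → ℝ} (hg : Continuous g) (N : ℕ) :
    Continuous (orbitAvg T a g N) := by
  refine continuous_const.mul (continuous_finsetSum _ fun k _ => hg.comp ?_)
  exact continuous_pi fun i => (T ^ (a k)).continuous.comp (continuous_apply i)

lemma tendsto_orbitAvg_maxPairDist (ha : Tendsto a atTop atTop) {x : Fin n → X}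
    (hx : ∀ i j, Tendsto (fun t : ℤ => dist ((T ^ t) (x i)) ((T ^ t) (x j))) atTop (𝓝 0)) :
    Tendsto (fun N => orbitAvg T a maxPairDist N x) atTop (𝓝 0) := by
  refine tendsto_cesaro_Icc (u := fun k => maxPairDist fun i => (T ^ (a k)) (x i)) ?_
  have hs : Tendsto (fun k => ∑ i, ∑ j, dist ((T ^ (a k)) (x i)) ((T ^ (a k)) (x j))) atTop
      (𝓝 (∑ i : Fin n, ∑ j : Fin n, 0)) :=
    tendsto_finsetSum _ fun i _ => tendsto_finsetSum _ fun j _ => (hx i j).comp ha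
  simp only [Finset.sum_const_zero] at hs
  exact squeeze_zero (fun k => maxPairDist_nonneg _) (fun k => maxPairDist_le_sum _) hs

lemma exists_box_subset {ι : Type*} {Q : ι → Set X}
    (hb : ∀ (x : X) (U : Set X), IsOpen U → x ∈ U → ∃ p, x ∈ Q p ∧ Q p ⊆ U)
    {O : Set (Fin n → X)} (hO : IsOpen O) {x : Fin n → X} (hx : x ∈ O) :
    ∃ V : Fin n → ι, (∀ i, x i ∈ Q (V i)) ∧ Set.univ.pi (fun i => Q (V i)) ⊆ O := by
  obtain ⟨u, hu, huO⟩ := isOpen_pi_iff'.1 hO x hx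
  choose V hV hVu using fun i => hb (x i) (u i) (hu i).1 (hu i).2
  exact ⟨V, hV, (Set.pi_mono fun i _ => hVu i).trans huO⟩

end

section
variable {X : Type*} [MetricSpace X] [mX : MeasurableSpace X] [BorelSpace X] [CompactSpace X]
variable {ι : Type*} {T : X ≃ₜ X} {μ : Measure X} {𝓕 : ℤ → MeasurableSpace X} {Q : ι → Set X}
variable [IsProbabilityMeasure μ] [Countable ι] {n : ℕ}

lemma measureReal_pi_box (κ : Measure X) [IsProbabilityMeasure κ] (U : Fin n → Set X) :
    (Measure.pi fun _ : Fin n => κ).real (Set.univ.pi U) = ∏ i, κ.real (U i) := by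
  rw [measureReal_def, Measure.pi_pi, ENNReal.toReal_prod]
  rfl

namespace TailSystem

lemma tendsto_condMeas (h : TailSystem T μ 𝓕 Q) {U : Set X} (hU : MeasurableSet U) :
    Tendsto (fun m : ℤ => ∫ y, |condMeas (𝓕 m) μ U y - condMeas (⨅ m, 𝓕 m) μ U y| ∂μ) atTop
      (𝓝 0) := by
  refine (h.tendsto_condExp hU).congr fun m => integral_congr_ae ?_
  filter_upwards [condMeas_ae_eq μ (h.le m) hU, condMeas_ae_eq μ h.iInf_le' hU] with y h1 h2
  rw [h1, h2]

/-- For almost every `z`, almost all points for the conditional measure at `z` over `𝓕 m` are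
asymptotic. -/
lemma ae_pi_asymptotic (h : TailSystem T μ 𝓕 Q) (m : ℤ) (n : ℕ) : ∀ᵐ z ∂μ,
    ∀ᵐ x ∂(Measure.pi fun _ : Fin n => ProbabilityTheory.condExpKernel μ (𝓕 m) z),
      ∀ i j, Tendsto (fun t : ℤ => dist ((T ^ t) (x i)) ((T ^ t) (x j))) atTop (𝓝 0) := by
  obtain ⟨S, hS, hasym⟩ := h.gen m
  have hmeas : ∀ p : S, MeasurableSet[𝓕 m] (Q p) := fun p => by
    rw [hS]
    exact MeasurableSpace.measurableSet_generateFrom ⟨p, p.2, rfl⟩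
  filter_upwards [ae_all_iff.2 fun p : S => condMeas_ae_eq_indicator μ (h.le m) (hmeas p)]
    with z hz
  have hx : ∀ᵐ x ∂(ProbabilityTheory.condExpKernel μ (𝓕 m) z), ∀ p : S, x ∈ Q p ↔ z ∈ Q p := by
    refine ae_all_iff.2 fun p => ?_
    have hp := hz p
    rw [condMeas] at hp
    by_cases hzp : z ∈ Q p
    · rw [Set.indicator_of_mem hzp, measureReal_def, ENNReal.toReal_eq_one_iff] at hp
      filter_upwards [(mem_ae_iff_prob_eq_one (h.measurableSet p)).2 hp] with x hx
      simp [hx, hzp]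
    · rw [Set.indicator_of_notMem hzp, measureReal_eq_zero_iff] at hp
      filter_upwards [measure_eq_zero_iff_ae_notMem.1 hp] with x hx
      simp [hx, hzp]
  have hall : ∀ᵐ x ∂(Measure.pi fun _ : Fin n => ProbabilityTheory.condExpKernel μ (𝓕 m) z),
      ∀ i, ∀ p : S, x i ∈ Q p ↔ z ∈ Q p :=
    ae_all_iff.2 fun i => (Measure.quasiMeasurePreserving_eval
      (fun _ : Fin n => ProbabilityTheory.condExpKernel μ (𝓕 m) z) i).ae hx
  filter_upwards [hall] with x hx i j
  exact hasym _ _ fun p hp => (hx i ⟨p, hp⟩).trans (hx j ⟨p, hp⟩).symm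

/-- A family of boxes covering all asymptotic tuples meets every box that is charged by the
conditional measure over the tail. -/
lemma exists_charged_box (h : TailSystem T μ 𝓕 Q) {𝒱 : Set (Fin n → ι)}
    (hcov : ∀ x : Fin n → X,
      (∀ i j, Tendsto (fun t : ℤ => dist ((T ^ t) (x i)) ((T ^ t) (x j))) atTop (𝓝 0)) →
        ∃ V ∈ 𝒱, ∀ i, x i ∈ Q (V i)) (W : Fin n → ι) :
    ∀ᵐ y ∂μ, 0 < prodMeas (⨅ m, 𝓕 m) μ (fun i => Q (W i)) y →
      ∃ V ∈ 𝒱, 0 < prodMeas (⨅ m, 𝓕 m) μ (fun i => Q (W i) ∩ Q (V i)) y := by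
  have hQ := h.measurableSet
  have hle := h.iInf_le'
  have hzero : ∀ (m : ℤ) (V : Fin n → ι), ∀ᵐ y ∂μ,
      prodMeas (⨅ m, 𝓕 m) μ (fun i => Q (W i) ∩ Q (V i)) y = 0 →
        prodMeas (𝓕 m) μ (fun i => Q (W i) ∩ Q (V i)) y = 0 := by
    intro m V
    have hi : ∀ i, ∀ᵐ y ∂μ, condMeas (⨅ m, 𝓕 m) μ (Q (W i) ∩ Q (V i)) y = 0 →
        condMeas (𝓕 m) μ (Q (W i) ∩ Q (V i)) y = 0 := by
      intro i
      have hU := (hQ (W i)).inter (hQ (V i))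
      let G : Set X := condMeas (⨅ m, 𝓕 m) μ (Q (W i) ∩ Q (V i)) ⁻¹' {0}
      have hG : MeasurableSet[⨅ m, 𝓕 m] G := measurable_condMeas μ hU (measurableSet_singleton 0)
      have h0 : ∫ y in G, condMeas (𝓕 m) μ (Q (W i) ∩ Q (V i)) y ∂μ = 0 := by
        rw [setIntegral_condMeas μ (h.le m) hU (iInf_le 𝓕 m _ hG),
          ← setIntegral_condMeas μ hle hU hG]
        exact setIntegral_eq_zero_of_forall_eq_zero fun y hy => hy
      rw [setIntegral_eq_zero_iff_of_nonneg_ae (ae_of_all _ fun y => condMeas_nonneg _ _ _ _)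
        (integrable_condMeas μ (h.le m) hU).integrableOn] at h0
      exact (ae_restrict_iff' (hle _ hG)).1 h0
    filter_upwards [ae_all_iff.2 hi] with y hy hy0
    obtain ⟨i, -, hi0⟩ := Finset.prod_eq_zero_iff.1 hy0
    exact Finset.prod_eq_zero (Finset.mem_univ i) (hy i hi0)
  let E : Set X := {y | ∀ V ∈ 𝒱, prodMeas (⨅ m, 𝓕 m) μ (fun i => Q (W i) ∩ Q (V i)) y = 0}
  have hE : MeasurableSet E := by
    have : E = ⋂ V ∈ 𝒱, prodMeas (⨅ m, 𝓕 m) μ (fun i => Q (W i) ∩ Q (V i)) ⁻¹' {0} := by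
      ext y; simp [E]
    rw [this]
    exact MeasurableSet.biInter 𝒱.to_countable fun V _ =>
      h.measurable_prodMeas (fun i => (hQ _).inter (hQ _)) (measurableSet_singleton 0)
  have hEm : ∀ m : ℤ, ∀ᵐ y ∂μ, y ∈ E → prodMeas (𝓕 m) μ (fun i => Q (W i)) y = 0 := by
    intro m
    filter_upwards [ae_all_iff.2 (hzero m), h.ae_pi_asymptotic m n] with y hy has hyE
    set κ := ProbabilityTheory.condExpKernel μ (𝓕 m) y with hκ
    have hpi : (Measure.pi fun _ : Fin n => κ) (Set.univ.pi fun i => Q (W i)) = 0 := by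
      have hsub : ∀ᵐ x ∂(Measure.pi fun _ : Fin n => κ), x ∈ (Set.univ.pi fun i => Q (W i)) →
          x ∈ ⋃ V ∈ 𝒱, Set.univ.pi fun i => Q (W i) ∩ Q (V i) := by
        filter_upwards [has] with x hx hxW
        obtain ⟨V, hV, hxV⟩ := hcov x hx
        exact Set.mem_biUnion hV fun i _ => ⟨hxW i trivial, hxV i⟩
      refine measure_mono_null_ae hsub ((measure_biUnion_null_iff 𝒱.to_countable).2 fun V hV => ?_)
      have := hy V (hyE V hV)
      rw [← measureReal_eq_zero_iff, measureReal_pi_box]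
      exact this
    rw [← measureReal_eq_zero_iff, measureReal_pi_box] at hpi
    exact hpi
  have hint : ∫ y in E, prodMeas (⨅ m, 𝓕 m) μ (fun i => Q (W i)) y ∂μ = 0 := by
    refine le_antisymm ?_ (setIntegral_nonneg hE fun y _ => prodMeas_nonneg _ _ _ _)
    have hs := tendsto_finsetSum Finset.univ fun i _ => h.tendsto_condMeas (hQ (W i))
    rw [Finset.sum_const_zero] at hs
    refine ge_of_tendsto hs (Eventually.of_forall fun m => ?_)
    have hi : ∀ i ∈ Finset.univ, Integrable (fun y =>
        |condMeas (𝓕 m) μ (Q (W i)) y - condMeas (⨅ m, 𝓕 m) μ (Q (W i)) y|) μ := fun i _ =>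
      ((integrable_condMeas μ (h.le m) (hQ _)).sub (integrable_condMeas μ hle (hQ _))).abs
    rw [← integral_finsetSum _ hi, ← integral_indicator hE]
    refine integral_mono_of_nonneg (ae_of_all _ fun y =>
      Set.indicator_nonneg (fun y _ => prodMeas_nonneg _ _ _ _) y) (integrable_finsetSum _ hi) ?_
    filter_upwards [hEm m] with y hy
    by_cases hyE : y ∈ E
    · rw [Set.indicator_of_mem hyE]
      have := abs_prod_sub_prod_le Finset.univ
        (a := fun i => condMeas (𝓕 m) μ (Q (W i)) y)
        (b := fun i => condMeas (⨅ m, 𝓕 m) μ (Q (W i)) y)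
        (fun i => condMeas_nonneg _ _ _ _) (fun i => condMeas_le_one _ _ _ _)
        (fun i => condMeas_nonneg _ _ _ _) (fun i => condMeas_le_one _ _ _ _)
      refine le_trans ?_ this
      have h1 := hy hyE
      simp only [prodMeas] at h1 ⊢
      rw [h1, zero_sub, abs_neg]
      exact le_abs_self _
    · rw [Set.indicator_of_notMem hyE]
      exact Finset.sum_nonneg fun i _ => abs_nonneg _
  rw [setIntegral_eq_zero_iff_of_nonneg_ae (ae_of_all _ fun y => prodMeas_nonneg _ _ _ _)
    (integrable_of_abs_le_one μ (h.measurable_prodMeas fun i => hQ _) fun y => by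
      rw [abs_of_nonneg (prodMeas_nonneg _ _ _ _)]
      exact prodMeas_le_one _ _ _ _).integrableOn] at hint
  filter_upwards [(ae_restrict_iff' hE).1 hint] with y hy hpos
  by_contra! hcon
  exact hpos.ne' (hy fun V hV => le_antisymm (hcon V hV) (prodMeas_nonneg _ _ _ _))

lemma exists_close_box (h : TailSystem T μ 𝓕 Q) {a : ℕ → ℤ} (ha : Tendsto a atTop atTop) (n : ℕ) :
    ∀ᵐ y ∂μ, ∀ (W : Fin n → ι) (l M : ℕ), 0 < prodMeas (⨅ m, 𝓕 m) μ (fun i => Q (W i)) y →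
      ∃ N ≥ M, ∃ V : Fin n → ι, (∀ x, (∀ i, x i ∈ Q (V i)) →
        orbitAvg T a maxPairDist N x < 1 / ((l : ℝ) + 1)) ∧
        0 < prodMeas (⨅ m, 𝓕 m) μ (fun i => Q (W i) ∩ Q (V i)) y := by
  refine ae_all_iff.2 fun W => ae_all_iff.2 fun l => ae_all_iff.2 fun M => ?_
  have hcov : ∀ x : Fin n → X,
      (∀ i j, Tendsto (fun t : ℤ => dist ((T ^ t) (x i)) ((T ^ t) (x j))) atTop (𝓝 0)) →
      ∃ V ∈ {V : Fin n → ι | ∃ N ≥ M, ∀ x, (∀ i, x i ∈ Q (V i)) →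
        orbitAvg T a maxPairDist N x < 1 / ((l : ℝ) + 1)}, ∀ i, x i ∈ Q (V i) := by
    intro x hx
    have hl : (0 : ℝ) < 1 / ((l : ℝ) + 1) := by positivity
    obtain ⟨N, hN, hNM⟩ := (((tendsto_orbitAvg_maxPairDist ha hx).eventually
      (gt_mem_nhds hl)).and (eventually_ge_atTop M)).exists
    obtain ⟨V, hxV, hV⟩ := exists_box_subset h.basis
      (isOpen_Iio.preimage (continuous_orbitAvg (T := T) (a := a) continuous_maxPairDist N)) hN
    exact ⟨V, ⟨N, hNM, fun x hx => hV fun i _ => hx i⟩, hxV⟩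
  filter_upwards [h.exists_charged_box hcov W] with y hy hpos
  obtain ⟨V, ⟨N, hN, hV⟩, hVpos⟩ := hy hpos
  exact ⟨N, hN, V, hV, hVpos⟩

end TailSystem
end

section
variable {X : Type*} [MetricSpace X] [mX : MeasurableSpace X] [BorelSpace X] [CompactSpace X]
variable {ι : Type*} {T : X ≃ₜ X} {μ : Measure X} {𝓕 : ℤ → MeasurableSpace X} {Q : ι → Set X}
variable [IsProbabilityMeasure μ] [Countable ι] {n : ℕ}

lemma exists_far_mem_qSupport (hQ : ∀ p, MeasurableSet (Q p)) (hn : 2 ≤ n) {κ : Measure X}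
    [IsProbabilityMeasure κ] {a : ℕ → ℤ} {A : Fin n → ι} {δ : ℝ} (hδ : 0 < δ)
    (hA : ∀ i j, i ≠ j → ∀ x ∈ Q (A i), ∀ x' ∈ Q (A j), δ ≤ dist x x') {c : ℝ}
    {W : Fin n → ι} {N : ℕ}
    (hN : c * ∏ i, κ.real (Q (W i)) < (N : ℝ)⁻¹ * ∑ k ∈ Finset.Icc 1 N,
      ∏ i, κ.real (Q (W i) ∩ ⇑(T ^ (a k)) ⁻¹' Q (A i))) :
    ∃ x : Fin n → X, (∀ i, x i ∈ Q (W i)) ∧ (∀ i, x i ∈ qSupport κ Q) ∧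
      c * δ < orbitAvg T a minPairDist N x := by
  let π := Measure.pi fun _ : Fin n => κ
  let B : ℕ → Set (Fin n → X) := fun k => Set.univ.pi fun i => ⇑(T ^ (a k)) ⁻¹' Q (A i)
  let Wb : Set (Fin n → X) := Set.univ.pi fun i => Q (W i)
  have hWb : MeasurableSet Wb := MeasurableSet.univ_pi fun i => hQ _
  have hB : ∀ k, MeasurableSet (B k) := fun k =>
    MeasurableSet.univ_pi fun i => (T ^ (a k)).continuous.measurable (hQ _)
  let F : (Fin n → X) → ℝ := fun x => (N : ℝ)⁻¹ * ∑ k ∈ Finset.Icc 1 N, (B k).indicator 1 x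
  have hiB : ∀ k ∈ Finset.Icc 1 N, Integrable ((B k).indicator (1 : (Fin n → X) → ℝ))
      (π.restrict Wb) := fun k _ => (integrable_const (1 : ℝ)).indicator (hB k)
  have hF : Integrable F (π.restrict Wb) := (integrable_finsetSum _ hiB).const_mul _
  have hint : ∫ x in Wb, F x ∂π = (N : ℝ)⁻¹ * ∑ k ∈ Finset.Icc 1 N,
      ∏ i, κ.real (Q (W i) ∩ ⇑(T ^ (a k)) ⁻¹' Q (A i)) := by
    rw [integral_const_mul, integral_finsetSum _ hiB]
    congr 1
    refine Finset.sum_congr rfl fun k _ => ?_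
    rw [integral_indicator_one (hB k), measureReal_restrict_apply (hB k), ← measureReal_pi_box,
      Set.inter_comm, ← Set.pi_inter_distrib]
  have hS : ∀ᵐ x ∂π, ∀ i, x i ∈ qSupport κ Q := ae_all_iff.2 fun i =>
    (Measure.quasiMeasurePreserving_eval (fun _ : Fin n => κ) i).ae
      (p := fun x => x ∈ qSupport κ Q) (measure_compl_qSupport κ Q)
  by_contra! hcon
  refine hN.not_ge ?_
  rw [← hint, ← measureReal_pi_box, mul_comm, ← smul_eq_mul, ← setIntegral_const]
  refine setIntegral_mono_on_ae hF (integrable_const _) hWb ?_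
  filter_upwards [hS] with x hx hxW
  have h1 := hcon x (fun i => hxW i trivial) hx
  have h2 : δ * F x ≤ orbitAvg T a minPairDist N x := by
    simp only [F, orbitAvg]
    rw [mul_left_comm, Finset.mul_sum]
    refine mul_le_mul_of_nonneg_left (Finset.sum_le_sum fun k _ => ?_) (by positivity)
    by_cases hk : x ∈ B k
    · rw [Set.indicator_of_mem hk, Pi.one_apply, mul_one]
      exact le_minPairDist hn fun i j hij => hA i j hij _ (hk i trivial) _ (hk j trivial)
    · rw [Set.indicator_of_notMem hk, mul_zero]
      exact minPairDist_nonneg _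
  rw [mul_comm] at h2
  exact le_of_mul_le_mul_right (h2.trans h1) hδ

end

/-- A nonempty closed set in which mean proximal and mean separated tuples
are dense. -/
def IsChaoticSet {X : Type*} [MetricSpace X] (T : X ≃ₜ X) (a : ℕ → ℤ) (S : Set X) : Prop :=
  IsClosed S ∧ S.Nonempty ∧
    ∀ n : ℕ, 2 ≤ n → ∃ c : ℝ, 0 < c ∧ ∀ U : Set (Fin n → X), IsOpen U →
      (∃ x ∈ U, ∀ i, x i ∈ S) → ∀ l M : ℕ,
        (∃ N ≥ M, ∃ x ∈ U, (∀ i, x i ∈ S) ∧ orbitAvg T a maxPairDist N x < 1 / ((l : ℝ) + 1)) ∧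
        ∃ N ≥ M, ∃ x ∈ U, (∀ i, x i ∈ S) ∧ c < orbitAvg T a minPairDist N x

theorem exists_isChaoticSet {X : Type*} [MetricSpace X] [CompactSpace X] (T : X ≃ₜ X)
    (hent : 0 < Dynamics.coverEntropy (⇑T) Set.univ) {a : ℕ → ℤ} (ha : Tendsto a atTop atTop) :
    ∃ S : Set X, IsChaoticSet T a S := by
  let _ : MeasurableSpace X := borel X
  have : BorelSpace X := ⟨rfl⟩
  obtain ⟨μ, 𝓕, Q, h⟩ := exists_tailSystem T hent
  have := h.prob
  have hQ := h.measurableSet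
  have hall := (ae_all_iff.2 (h.exists_frequency ha)).and (ae_all_iff.2 (h.exists_close_box ha))
  obtain ⟨y, hyD, hfar, hclose⟩ : ∃ y ∈ splitSet 𝓕 μ Q, _ := by
    by_contra! hcon
    refine h.measure_splitSet_ne_zero (measure_eq_zero_iff_ae_notMem.2 ?_)
    filter_upwards [hall] with y hy hyD
    exact hcon y hyD hy
  let κ := ProbabilityTheory.condExpKernel μ (⨅ m, 𝓕 m) y
  obtain ⟨x₀, -, hx₀⟩ := exists_mem_qSupport (κ := κ) (Q := Q) (V := Set.univ) (by simp)
  refine ⟨qSupport κ Q, isClosed_qSupport h.isOpen, ⟨x₀, hx₀⟩, fun n hn => ?_⟩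
  obtain ⟨A, ⟨δ, hδ, hA⟩, c, hc, hfreq⟩ := hfar n hyD
  refine ⟨c * δ, mul_pos hc hδ, fun U hU ⟨x, hxU, hxS⟩ l M => ?_⟩
  obtain ⟨W, hxW, hWU⟩ := exists_box_subset h.basis hU hxU
  have hWpos : 0 < prodMeas (⨅ m, 𝓕 m) μ (fun i => Q (W i)) y :=
    Finset.prod_pos fun i _ => hxS i _ (hxW i)
  constructor
  · obtain ⟨N, hN, V, hV, hVpos⟩ := hclose n W l M hWpos
    have hpos : ∀ i, 0 < κ.real (Q (W i) ∩ Q (V i)) := fun i =>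
      lt_of_le_of_ne measureReal_nonneg fun h0 =>
        hVpos.ne' (Finset.prod_eq_zero (Finset.mem_univ i) h0.symm)
    choose x' hx' hx'S using fun i => exists_mem_qSupport (Q := Q) (hpos i)
    exact ⟨N, hN, x', hWU fun i _ => (hx' i).1, hx'S, hV x' fun i => (hx' i).2⟩
  · obtain ⟨N, hN, hlt⟩ := hfreq W hWpos M
    obtain ⟨x', hx'W, hx'S, hx'⟩ := exists_far_mem_qSupport (κ := κ) hQ hn hδ hA hlt
    exact ⟨N, hN, x', hWU fun i _ => hx'W i, hx'S, hx'⟩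

section
variable {S : Type*} [MetricSpace S] {n : ℕ}

/-- Restriction of a binary sequence to its first `m` entries. -/
def binRestrict (m : ℕ) (z : ℕ → Bool) : Fin m → Bool := fun k => z k

lemma continuous_binRestrict (m : ℕ) : Continuous (binRestrict m) :=
  continuous_pi fun _ => continuous_apply _

lemma dense_comp_preimage {α : Type*} [Finite α] {O : Set (Fin n → S)} (hO : Dense O)
    {u : Fin n → α} (hu : Function.Injective u) : Dense {x : α → S | x ∘ u ∈ O} := by
  classical
  cases nonempty_fintype α
  refine dense_iff_inter_open.2 fun V hV ⟨x, hx⟩ => ?_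
  obtain ⟨w, hw, hwV⟩ := isOpen_pi_iff'.1 hV x hx
  obtain ⟨y, hyw, hyO⟩ := hO.inter_open_nonempty (Set.univ.pi fun i => w (u i))
    (isOpen_set_pi Set.finite_univ fun i _ => (hw (u i)).1) ⟨x ∘ u, fun i _ => (hw (u i)).2⟩
  refine ⟨Function.extend u y x, hwV fun k _ => ?_, ?_⟩
  · by_cases hk : ∃ i, u i = k
    · obtain ⟨i, rfl⟩ := hk
      rw [hu.extend_apply]
      exact hyw i trivial
    · rw [Function.extend_apply' _ _ _ hk]
      exact (hw k).2
  · rw [Set.mem_ofPred_eq, Function.extend_comp hu]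
    exact hyO

lemma exists_binRestrict_dist_lt (f : C(ℕ → Bool, S)) {ε : ℝ} (hε : 0 < ε) :
    ∃ M : ℕ, ∀ z z' : ℕ → Bool, binRestrict M z = binRestrict M z' → dist (f z) (f z') < ε := by
  by_contra! hcon
  let t : ℕ → Set ((ℕ → Bool) × (ℕ → Bool)) := fun M =>
    {p | binRestrict M p.1 = binRestrict M p.2 ∧ ε ≤ dist (f p.1) (f p.2)}
  have hcl : ∀ M, IsClosed (t M) := fun M =>
    (isClosed_eq ((continuous_binRestrict M).comp continuous_fst)
      ((continuous_binRestrict M).comp continuous_snd)).inter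
    (isClosed_le continuous_const ((f.continuous.comp continuous_fst).dist
      (f.continuous.comp continuous_snd)))
  obtain ⟨p, hp⟩ := IsCompact.nonempty_iInter_of_sequence_nonempty_isCompact_isClosed t
    (fun M p hp => ⟨funext fun k => congrFun hp.1 ⟨k, k.2.trans M.lt_succ_self⟩, hp.2⟩)
    (fun M => by
      obtain ⟨z, z', hz, hd⟩ := hcon M
      exact ⟨(z, z'), hz, hd⟩)
    (hcl 0).isCompact hcl
  rw [Set.mem_iInter] at hp
  have heq : p.1 = p.2 := funext fun k => congrFun (hp (k + 1)).1 ⟨k, k.lt_succ_self⟩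
  have := (hp 0).2
  rw [heq, dist_self] at this
  exact this.not_gt hε

variable [CompactSpace S]

/-- The maps sending all tuples that are distinct up to level `m` into `O`. -/
def goodMaps (O : Set (Fin n → S)) (m : ℕ) : Set C(ℕ → Bool, S) :=
  {f | ∀ z : Fin n → ℕ → Bool, Function.Injective (fun i => binRestrict m (z i)) →
    (fun i => f (z i)) ∈ O}

lemma isOpen_goodMaps {O : Set (Fin n → S)} (hO : IsOpen O) (m : ℕ) : IsOpen (goodMaps O m) := by
  have hZ : IsCompact {z : Fin n → ℕ → Bool |
      Function.Injective (fun i => binRestrict m (z i))} := by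
    refine IsClosed.isCompact ?_
    have hc : Continuous fun z : Fin n → ℕ → Bool => fun i => binRestrict m (z i) :=
      continuous_pi fun i => (continuous_binRestrict m).comp (continuous_apply i)
    exact (isClosed_discrete {v : Fin n → Fin m → Bool | Function.Injective v}).preimage hc
  refine isOpen_iff_mem_nhds.2 fun f hf => ?_
  have hcont : Continuous fun p : C(ℕ → Bool, S) × (Fin n → ℕ → Bool) => fun i => p.1 (p.2 i) :=
    continuous_pi fun i =>
      continuous_eval.comp (continuous_fst.prodMk ((continuous_apply i).comp continuous_snd))
  exact hZ.eventually_forall_of_forall_eventually fun z hz =>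
    (hO.preimage hcont).mem_nhds (hf z hz)

lemma dense_goodMaps {O : Set (Fin n → S)} (hO : IsOpen O) (hd : Dense O) (m : ℕ) :
    Dense (goodMaps O m) := by
  refine Metric.dense_iff.2 fun f ε hε => ?_
  obtain ⟨M, hmM, hM⟩ : ∃ M ≥ m, ∀ z z' : ℕ → Bool, binRestrict M z = binRestrict M z' →
      dist (f z) (f z') < ε / 2 := by
    obtain ⟨M, hM⟩ := exists_binRestrict_dist_lt f (half_pos hε)
    refine ⟨max m M, le_max_left _ _, fun z z' hz => hM z z' ?_⟩
    ext k
    exact congrFun hz ⟨k, k.2.trans_le (le_max_right _ _)⟩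
  let pad : (Fin M → Bool) → ℕ → Bool := fun u k => if hk : k < M then u ⟨k, hk⟩ else false
  have hpad : ∀ u, binRestrict M (pad u) = u := fun u => by
    ext k; simp [binRestrict, pad]
  have hdense : Dense (⋂ u : {u : Fin n → Fin M → Bool // Function.Injective u},
      {x : (Fin M → Bool) → S | x ∘ u.1 ∈ O}) :=
    dense_iInter_of_isOpen (fun u => hO.preimage (continuous_pi fun i => continuous_apply _))
      fun u => dense_comp_preimage hd u.2
  obtain ⟨x, hx, hxO⟩ := Metric.dense_iff.1 hdense (fun u => f (pad u)) (ε / 2) (by positivity)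
  let g : C(ℕ → Bool, S) := ⟨fun z => x (binRestrict M z),
    continuous_of_discreteTopology.comp (continuous_binRestrict M)⟩
  refine ⟨g, ?_, fun z hz => ?_⟩
  · rw [Metric.mem_ball, ContinuousMap.dist_lt_iff hε]
    intro z
    have h1 : dist (x (binRestrict M z)) (f (pad (binRestrict M z))) < ε / 2 :=
      (dist_le_pi_dist x (fun u => f (pad u)) _).trans_lt hx
    have h2 := hM (pad (binRestrict M z)) z (hpad _)
    have h3 := dist_triangle (x (binRestrict M z)) (f (pad (binRestrict M z))) (f z)
    change dist (x (binRestrict M z)) (f z) < ε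
    linarith
  · refine Set.mem_iInter.1 hxO ⟨fun i => binRestrict M (z i), fun i j hij => hz ?_⟩
    ext k
    exact congrFun hij ⟨k, k.2.trans_le hmM⟩

/-- A version of Mycielski's theorem: in a compact metric space, generic continuous images of the
Cantor space avoid countably many meagre relations. -/
theorem exists_generic_map [Nonempty S] {J : Type*} [Countable J] (d : J → ℕ)
    (O : (j : J) → Set (Fin (d j) → S)) (hO : ∀ j, IsOpen (O j)) (hd : ∀ j, Dense (O j)) :
    ∃ f : C(ℕ → Bool, S), ∀ j, ∀ z : Fin (d j) → ℕ → Bool, Function.Injective z →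
      (fun i => f (z i)) ∈ O j := by
  have hdense : Dense (⋂ p : J × ℕ, goodMaps (O p.1) p.2) :=
    dense_iInter_of_isOpen (fun p => isOpen_goodMaps (hO _) _) fun p => dense_goodMaps (hO _)
        (hd _) _
  have : Nonempty C(ℕ → Bool, S) := ⟨ContinuousMap.const _ (Classical.arbitrary S)⟩
  obtain ⟨f, hf⟩ := hdense.nonempty
  refine ⟨f, fun j z hz => ?_⟩
  have hev : ∀ᶠ m in atTop, ∀ i i', binRestrict m (z i) = binRestrict m (z i') → i = i' := by
    simp only [eventually_all]
    intro i i'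
    by_cases hii : i = i'
    · exact Eventually.of_forall fun m _ => hii
    · obtain ⟨k, hk⟩ := Function.ne_iff.1 (hz.ne hii)
      filter_upwards [eventually_gt_atTop k] with m hm heq
      exact absurd (congrFun heq ⟨k, hm⟩) hk
  obtain ⟨m, hm⟩ := hev.exists
  exact Set.mem_iInter.1 hf (j, m) z fun i i' hii => hm i i' hii

end

lemma isCantorSet_range {X : Type*} [MetricSpace X] {f : (ℕ → Bool) → X} (hf : Continuous f)
    (hinj : Function.Injective f) : IsCantorSet (Set.range f) := by
  have hcomp : IsCompact (Set.range f) := isCompact_range hf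
  refine ⟨Set.range_nonempty f, hcomp, ⟨hcomp.isClosed, ?_⟩, ?_⟩
  · rintro _ ⟨z, rfl⟩
    refine accPt_iff_nhds.2 fun U hU => ?_
    have hlim : Tendsto (fun k : ℕ => Function.update z k (!z k)) atTop (𝓝 z) := by
      refine tendsto_pi_nhds.2 fun i => tendsto_nhds_of_eventually_eq ?_
      filter_upwards [eventually_gt_atTop i] with k hk
      exact Function.update_of_ne hk.ne _ _
    obtain ⟨k, hk⟩ := (((hf.tendsto z).comp hlim).eventually_mem hU).exists
    refine ⟨_, ⟨hk, Set.mem_range_self _⟩, fun heq => ?_⟩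
    have := congrFun (hinj heq) k
    simp at this
  · exact (hf.isClosedEmbedding hinj).isEmbedding.isTotallyDisconnected_range.2 inferInstance

section
variable {X : Type*} [MetricSpace X] {n : ℕ} {T : X ≃ₜ X} {a : ℕ → ℤ}

lemma homeoIter_eq_zpow (T : X ≃ₜ X) (t : ℤ) (x : X) : homeoIter T t x = (T ^ t) x := by
  cases t with
  | ofNat k => exact (zpow_natCast_apply T k x).symm
  | negSucc k =>
    rw [zpow_negSucc, ← inv_pow, ← zpow_natCast]
    exact (zpow_natCast_apply T.symm (k + 1) x).symm

lemma orbitAvg_minPairDist_le_zero {x : Fin n → X} {i j : Fin n} (hij : i < j) (hx : x i = x j)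
    (N : ℕ) : orbitAvg T a minPairDist N x ≤ 0 := by
  refine mul_nonpos_of_nonneg_of_nonpos (by positivity) (Finset.sum_nonpos fun k _ => ?_)
  exact (minPairDist_le_dist _ hij).trans (by rw [hx, dist_self])

lemma orbitAvg_minPairDist_le [CompactSpace X] (hn : 2 ≤ n) (N : ℕ) (x : Fin n → X) :
    orbitAvg T a minPairDist N x ≤ Metric.diam (Set.univ : Set X) := by
  have h1 : ∑ k ∈ Finset.Icc 1 N, minPairDist (fun i => (T ^ (a k)) (x i)) ≤
      ∑ k ∈ Finset.Icc 1 N, Metric.diam (Set.univ : Set X) := Finset.sum_le_sum fun k _ =>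
    (minPairDist_le_dist _ (i := ⟨0, by omega⟩) (j := ⟨1, by omega⟩) (by simp)).trans
      (Metric.dist_le_diam_of_mem isCompact_univ.isBounded trivial trivial)
  rw [Finset.sum_const, Nat.card_Icc, Nat.add_sub_cancel, nsmul_eq_mul] at h1
  refine (mul_le_mul_of_nonneg_left h1 (by positivity)).trans ?_
  rw [← mul_assoc]
  exact mul_le_of_le_one_left Metric.diam_nonneg inv_mul_le_one

lemma dense_preimage_of_isOpen_inter {S : Set X} {P : Set (Fin n → X)}
    (h : ∀ U : Set (Fin n → X), IsOpen U → (∃ x ∈ U, ∀ i, x i ∈ S) →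
      ∃ x ∈ U, (∀ i, x i ∈ S) ∧ x ∈ P) :
    Dense {x : Fin n → S | (fun i => (x i : X)) ∈ P} := by
  have hinc : IsInducing fun (x : Fin n → S) i => (x i : X) :=
    IsInducing.piMap fun _ => .subtypeVal
  refine dense_iff_inter_open.2 fun V hV hVne => ?_
  obtain ⟨U, hU, rfl⟩ := hinc.isOpen_iff.1 hV
  obtain ⟨y, hy⟩ := hVne
  obtain ⟨x, hxU, hxS, hxP⟩ := h U hU ⟨_, hy, fun i => (y i).2⟩
  exact ⟨fun i => ⟨x i, hxS i⟩, hxU, hxP⟩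

lemma continuous_coe_pi {S : Set X} : Continuous fun (x : Fin n → S) i => (x i : X) := by
  fun_prop

lemma isOpen_exists_orbitAvg_maxPairDist_lt (M : ℕ) (ε : ℝ) :
    IsOpen {x : Fin n → X | ∃ N ≥ M, orbitAvg T a maxPairDist N x < ε} := by
  have : {x : Fin n → X | ∃ N ≥ M, orbitAvg T a maxPairDist N x < ε} =
      ⋃ N ≥ M, {x | orbitAvg T a maxPairDist N x < ε} := by
    ext; simp
  rw [this]
  exact isOpen_biUnion fun N _ =>
    isOpen_lt (continuous_orbitAvg continuous_maxPairDist N) continuous_const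

lemma isOpen_exists_lt_orbitAvg_minPairDist (M : ℕ) (c : ℝ) :
    IsOpen {x : Fin n → X | ∃ N ≥ M, c < orbitAvg T a minPairDist N x} := by
  have : {x : Fin n → X | ∃ N ≥ M, c < orbitAvg T a minPairDist N x} =
      ⋃ N ≥ M, {x | c < orbitAvg T a minPairDist N x} := by
    ext; simp
  rw [this]
  exact isOpen_biUnion fun N _ =>
    isOpen_lt continuous_const (continuous_orbitAvg continuous_minPairDist N)

/-- Chaotic sets contain Cantor sets all of whose tuples are mean proximal and mean separated. -/
lemma IsChaoticSet.exists_cantor [CompactSpace X] {S : Set X} (hS : IsChaoticSet T a S) :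
    ∃ K : Set X, IsCantorSet K ∧ ∀ n : ℕ, 2 ≤ n → ∃ c : ℝ, 0 < c ∧ ∀ x : Fin n → X,
      (∀ i, x i ∈ K) → Function.Injective x → ∀ l M : ℕ,
        (∃ N ≥ M, orbitAvg T a maxPairDist N x < 1 / ((l : ℝ) + 1)) ∧
        ∃ N ≥ M, c < orbitAvg T a minPairDist N x := by
  obtain ⟨hcl, hne, hdense⟩ := hS
  choose c hc hcd using fun n : ℕ => hdense (n + 2) (by omega)
  have : CompactSpace S := isCompact_iff_compactSpace.1 hcl.isCompact
  have : Nonempty S := hne.to_subtype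
  obtain ⟨f, hf⟩ := exists_generic_map (S := S) (J := ℕ × ℕ × ℕ) (fun j => j.1 + 2)
    (fun j => {x | (fun i => (x i : X)) ∈ {x : Fin (j.1 + 2) → X |
        ∃ N ≥ j.2.2, orbitAvg T a maxPairDist N x < 1 / ((j.2.1 : ℝ) + 1)}} ∩
      {x | (fun i => (x i : X)) ∈ {x : Fin (j.1 + 2) → X |
        ∃ N ≥ j.2.2, c j.1 < orbitAvg T a minPairDist N x}})
    (fun j => ((isOpen_exists_orbitAvg_maxPairDist_lt _ _).preimage continuous_coe_pi).inter
      ((isOpen_exists_lt_orbitAvg_minPairDist _ _).preimage continuous_coe_pi))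
    (fun j => by
      refine Dense.inter_of_isOpen_left (dense_preimage_of_isOpen_inter fun U hU hne => ?_)
        (dense_preimage_of_isOpen_inter fun U hU hne => ?_)
        ((isOpen_exists_orbitAvg_maxPairDist_lt _ _).preimage continuous_coe_pi)
      · obtain ⟨N, hN, x, hx, hxS, h⟩ := (hcd j.1 U hU hne j.2.1 j.2.2).1
        exact ⟨x, hx, hxS, N, hN, h⟩
      · obtain ⟨N, hN, x, hx, hxS, h⟩ := (hcd j.1 U hU hne j.2.1 j.2.2).2
        exact ⟨x, hx, hxS, N, hN, h⟩)
  have hinj : Function.Injective fun z => (f z : X) := by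
    intro z z' hzz
    by_contra hne
    have hz : Function.Injective ![z, z'] := by
      intro i j hij
      fin_cases i <;> fin_cases j <;> simp_all [eq_comm]
    obtain ⟨N, -, hN⟩ := (hf (0, 0, 0) ![z, z'] hz).2
    have := orbitAvg_minPairDist_le_zero (T := T) (a := a)
      (x := fun i : Fin 2 => (f (![z, z'] i) : X)) (i := 0) (j := 1) (by simp) hzz N
    exact absurd (hN.trans_le this) (hc 0).not_gt
  refine ⟨_, isCantorSet_range (f := fun z => (f z : X)) (by fun_prop) hinj, fun n hn => ?_⟩
  obtain ⟨n, rfl⟩ := Nat.exists_eq_add_of_le' hn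
  refine ⟨c n, hc n, fun x hxK hx l M => ?_⟩
  choose z hz using hxK
  obtain rfl : (fun i => (f (z i) : X)) = x := funext hz
  exact hf (n, l, M) z fun i j hij => hx (by simp only [hij])

lemma tendsto_floor_eval_atTop (p : Polynomial ℝ) (hdeg : 1 ≤ p.natDegree)
    (hlead : 0 < p.leadingCoeff) : Tendsto (fun k : ℕ => ⌊p.eval (k : ℝ)⌋) atTop atTop :=
  tendsto_floor_atTop.comp ((p.tendsto_atTop_of_leadingCoeff_nonneg
    (Polynomial.natDegree_pos_iff_degree_pos.1 hdeg) hlead.le).comp tendsto_natCast_atTop_atTop)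

lemma liminf_eq_zero_of_nonneg {u : ℕ → ℝ} (h0 : ∀ N, 0 ≤ u N)
    (h : ∀ l M : ℕ, ∃ N ≥ M, u N < 1 / ((l : ℝ) + 1)) : liminf u atTop = 0 := by
  have hb : IsBoundedUnder (· ≥ ·) atTop u := isBoundedUnder_of ⟨0, h0⟩
  refine le_antisymm (le_of_forall_pos_le_add fun ε hε => ?_) ?_
  · obtain ⟨l, hl⟩ := exists_nat_one_div_lt hε
    rw [zero_add]
    exact liminf_le_of_frequently_le (frequently_atTop.2 fun M =>
      (h l M).imp fun N hN => ⟨hN.1, (hN.2.trans hl).le⟩) hb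
  · refine le_liminf_of_le ?_ (.of_forall h0)
    exact IsCoboundedUnder.of_frequently_le (a := 1 / (((0 : ℕ) : ℝ) + 1)) <|
      frequently_atTop.2 fun M => (h 0 M).imp fun N hN => ⟨hN.1, hN.2.le⟩

end

end PolyChaos

/-- Positive topological entropy implies multivariant mean Li-Yorke chaos along
the sequence `a k = [p(k)]` for any real polynomial `p` of degree `m ≥ 1` with
positive leading coefficient. -/
theorem mean_LiYorke_chaos_along_polynomial
    {X : Type*} [MetricSpace X] [CompactSpace X] (T : X ≃ₜ X)
    (hent : 0 < Dynamics.coverEntropy (⇑T) Set.univ)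
    (p : Polynomial ℝ) (hdeg : 1 ≤ p.natDegree) (hlead : 0 < p.leadingCoeff)
    (a : ℕ → ℤ) (ha : ∀ k, a k = ⌊p.eval (k : ℝ)⌋) :
    ∃ K : Set X, IsCantorSet K ∧
      ∀ n : ℕ, 2 ≤ n → ∀ x : Fin n → X, (∀ i, x i ∈ K) → Function.Injective x →
        liminf (fun N : ℕ => (N : ℝ)⁻¹ * ∑ k ∈ Finset.Icc 1 N,
            maxPairDist fun i => homeoIter T (a k) (x i)) atTop = 0 ∧
        0 < limsup (fun N : ℕ => (N : ℝ)⁻¹ * ∑ k ∈ Finset.Icc 1 N,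
            minPairDist fun i => homeoIter T (a k) (x i)) atTop := by
  have hatop : Tendsto a atTop atTop := by
    rw [funext ha]
    exact PolyChaos.tendsto_floor_eval_atTop p hdeg hlead
  obtain ⟨S, hS⟩ := PolyChaos.exists_isChaoticSet T hent hatop
  obtain ⟨K, hK, h⟩ := hS.exists_cantor
  refine ⟨K, hK, fun n hn x hxK hx => ?_⟩
  obtain ⟨c, hc, h⟩ := h n hn
  specialize h x hxK hx
  simp only [PolyChaos.homeoIter_eq_zpow]
  refine ⟨PolyChaos.liminf_eq_zero_of_nonneg (fun N => ?_) fun l M => (h l M).1,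
    hc.trans_le (le_limsup_of_frequently_le (frequently_atTop.2 fun M =>
      (h 0 M).2.imp fun N hN => ⟨hN.1, hN.2.le⟩)
      (isBoundedUnder_of ⟨_, fun N => PolyChaos.orbitAvg_minPairDist_le hn N x⟩))⟩
  exact mul_nonneg (by positivity) (Finset.sum_nonneg fun k _ => PolyChaos.maxPairDist_nonneg _)
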